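/- arXiv:1808.09061 — 2 statements merged into one kernel-verified Lean document; each statement's English description precedes it below -/
import Mathlib

section
/- Every minimal subgroup of the Weyl group of a degree 1 del Pezzo surface satisfying condition (H1) preserves a conic bundle structure. Precisely: if G ≤ W is minimal and satisfies condition (H1), then there exists a conic class C ∈ Λ with g·C = C for all g ∈ G. -/
open scoped BigOperators

noncomputable section

/-- The Picard lattice of a degree 1 del Pezzo surface. -/
abbrev V : Type := Fin 9 → ℤ

/-- The intersection form. -/
def bil (x y : V) : ℤ := x 0 * y 0 - ∑ i ∈ Finset.Ioi (0 : Fin 9), x i * y i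

/-- The canonical class. -/
def Kvec : V := fun i => if i = 0 then -3 else 1

abbrev LatAut := V ≃ₗ[ℤ] V

/-- The Weyl group: automorphisms preserving the form and fixing K. -/
def W : Subgroup LatAut where
  carrier := {g | (∀ x y, bil (g x) (g y) = bil x y) ∧ g Kvec = Kvec}
  one_mem' := ⟨fun _ _ => rfl, rfl⟩
  mul_mem' := by
    rintro a b ⟨ha1, ha2⟩ ⟨hb1, hb2⟩
    refine ⟨fun x y => ?_, ?_⟩
    · show bil (a (b x)) (a (b y)) = bil x y
      rw [ha1, hb1]
    · show a (b Kvec) = Kvec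
      rw [hb2, ha2]
  inv_mem' := by
    rintro a ⟨ha1, ha2⟩
    refine ⟨fun x y => ?_, ?_⟩
    · have h := ha1 (a⁻¹ x) (a⁻¹ y)
      have hx : a (a⁻¹ x) = x := a.apply_symm_apply x
      have hy : a (a⁻¹ y) = y := a.apply_symm_apply y
      rw [hx, hy] at h
      exact h.symm
    · have h2 : a.symm (a Kvec) = a.symm Kvec := by rw [ha2]
      rw [a.symm_apply_apply] at h2
      exact (show a⁻¹ Kvec = a.symm Kvec from rfl).trans h2.symm

/-- Exceptional classes. -/
def Exc : Set V := {E | bil E E = -1 ∧ bil E Kvec = -1}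

/-- Conic classes. -/
def IsConic (C : V) : Prop := bil C C = 0 ∧ bil C Kvec = -2

/-- The orbit of a vector under a subgroup of `LatAut`. -/
def orb (G : Subgroup LatAut) (E : V) : Set V := {v | ∃ g ∈ G, g E = v}

/-- The set of orbits of exceptional classes. -/
def orbs (G : Subgroup LatAut) : Set (Set V) := {S | ∃ E ∈ Exc, S = orb G E}

/-- The stabilizer of a vector, as a subgroup of `LatAut`. -/
def stab (G : Subgroup LatAut) (E : V) : Subgroup LatAut where
  carrier := {g | g ∈ G ∧ g E = E}
  one_mem' := ⟨G.one_mem, rfl⟩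
  mul_mem' := by
    rintro a b ⟨haG, ha⟩ ⟨hbG, hb⟩
    exact ⟨G.mul_mem haG hbG, by show a (b E) = E; rw [hb, ha]⟩
  inv_mem' := by
    rintro a ⟨haG, ha⟩
    refine ⟨G.inv_mem haG, ?_⟩
    conv_lhs => rw [← ha]
    exact a.symm_apply_apply E

/-- `G` is minimal: no nonempty orbit of exceptional classes consists of pairwise
orthogonal classes. -/
def MinimalAction (G : Subgroup LatAut) : Prop :=
  ∀ E ∈ Exc, ¬ (∀ E₁ ∈ orb G E, ∀ E₂ ∈ orb G E, E₁ ≠ E₂ → bil E₁ E₂ = 0)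

/-- The natural representation of a subgroup of `LatAut` on the lattice. -/
def rep (G : Subgroup LatAut) : Representation ℤ G V where
  toFun g := (g : LatAut).toLinearMap
  map_one' := rfl
  map_mul' _ _ := rfl

/-- Condition (H1): the first group cohomology of every subgroup of `G`
with coefficients in the lattice vanishes. -/
def CondH1 (G : Subgroup LatAut) : Prop :=
  ∀ G' : Subgroup LatAut, G' ≤ G →
    Subsingleton (groupCohomology.H1 (Rep.of (rep G')))

namespace DP1

theorem bil_eq (x y : V) : bil x y = x 0 * y 0 - x 1 * y 1 - x 2 * y 2 - x 3 * y 3 - x 4 * y 4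
    - x 5 * y 5 - x 6 * y 6 - x 7 * y 7 - x 8 * y 8 := by
  have h : Finset.Ioi (0 : Fin 9) = {1, 2, 3, 4, 5, 6, 7, 8} := by decide
  rw [bil, h]
  simp
  ring

theorem bil_Kvec (x : V) : bil x Kvec = -3 * x 0 - x 1 - x 2 - x 3 - x 4 - x 5 - x 6 - x 7 - x 8 := by
  rw [bil_eq]
  simp [Kvec]
  ring

theorem bil_comm (x y : V) : bil x y = bil y x := by
  rw [bil_eq, bil_eq]; ring

theorem bil_add_left (x y z : V) : bil (x + y) z = bil x z + bil y z := by
  simp only [bil_eq, Pi.add_apply]; ring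

theorem bil_add_right (x y z : V) : bil x (y + z) = bil x y + bil x z := by
  simp only [bil_eq, Pi.add_apply]; ring

theorem bil_sub_left (x y z : V) : bil (x - y) z = bil x z - bil y z := by
  simp only [bil_eq, Pi.sub_apply]; ring

theorem bil_sub_right (x y z : V) : bil x (y - z) = bil x y - bil x z := by
  simp only [bil_eq, Pi.sub_apply]; ring

theorem bil_smul_left (n : ℤ) (x y : V) : bil (n • x) y = n * bil x y := by
  simp only [bil_eq, Pi.smul_apply, smul_eq_mul]; ring

theorem bil_smul_right (n : ℤ) (x y : V) : bil x (n • y) = n * bil x y := by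
  simp only [bil_eq, Pi.smul_apply, smul_eq_mul]; ring

theorem bil_Kvec_Kvec : bil Kvec Kvec = 1 := by
  rw [bil_eq]; simp [Kvec]

/-- The Cauchy–Schwarz inequality for the last eight coordinates. -/
theorem sum_sq_bound (a b c d e f g h : ℤ) :
    (a + b + c + d + e + f + g + h) ^ 2 ≤
      8 * (a ^ 2 + b ^ 2 + c ^ 2 + d ^ 2 + e ^ 2 + f ^ 2 + g ^ 2 + h ^ 2) := by
  have key := @sq_sum_le_card_mul_sum_sq (Fin 8) ℤ _ _ _ _ Finset.univ ![a, b, c, d, e, f, g, h]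
  simp [Fin.sum_univ_eight] at key
  linarith

theorem bil_self_bound (x : V) :
    x 0 ^ 2 + 6 * bil x Kvec * x 0 + bil x Kvec ^ 2 + 8 * bil x x ≤ 0 := by
  have h := sum_sq_bound (x 1) (x 2) (x 3) (x 4) (x 5) (x 6) (x 7) (x 8)
  rw [bil_eq x x, bil_Kvec]
  nlinarith [h]

theorem coord_sq_le (x : V) (i : Fin 9) : x i ^ 2 ≤ 2 * x 0 ^ 2 - bil x x := by
  rw [bil_eq x x]
  fin_cases i <;> simp <;>
  nlinarith [sq_nonneg (x 0), sq_nonneg (x 1), sq_nonneg (x 2), sq_nonneg (x 3), sq_nonneg (x 4),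
    sq_nonneg (x 5), sq_nonneg (x 6), sq_nonneg (x 7), sq_nonneg (x 8)]

theorem eq_zero_of_bil_self (x : V) (hK : bil x Kvec = 0) (h : 0 ≤ bil x x) : x = 0 := by
  have h1 := bil_self_bound x
  rw [hK] at h1
  have h0 : x 0 ^ 2 ≤ 0 := by nlinarith
  funext i
  have h2 := coord_sq_le x i
  have : x i ^ 2 ≤ 0 := by linarith
  exact pow_eq_zero_iff (two_ne_zero) |>.1 (le_antisymm this (sq_nonneg _))

theorem bil_self_nonpos (x : V) (hK : bil x Kvec = 0) : bil x x ≤ 0 := by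
  by_contra h
  have := eq_zero_of_bil_self x hK (by linarith)
  subst this
  simp [bil_eq] at h

theorem finite_level (a b : ℤ) : {x : V | bil x x = a ∧ bil x Kvec = b}.Finite := by
  have hsub : {x : V | bil x x = a ∧ bil x Kvec = b} ⊆
      Set.Icc (fun _ : Fin 9 => -(100 * (a ^ 2 + b ^ 2 + 1)))
        (fun _ : Fin 9 => 100 * (a ^ 2 + b ^ 2 + 1)) := by
    rintro x ⟨h1, h2⟩
    have h3 := bil_self_bound x
    rw [h1, h2] at h3
    have h0 : x 0 ^ 2 ≤ 34 * b ^ 2 - 16 * a := by nlinarith [sq_nonneg (x 0 + 6 * b)]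
    have key : ∀ i, |x i| ≤ 100 * (a ^ 2 + b ^ 2 + 1) := by
      intro i
      have h4 := coord_sq_le x i
      rw [h1] at h4
      have h5 : x i ^ 2 ≤ 68 * b ^ 2 - 33 * a := by linarith
      apply abs_le_of_sq_le_sq _ (by positivity)
      nlinarith [sq_nonneg (a + 1), sq_nonneg a, sq_nonneg b, sq_nonneg (a * b),
        sq_nonneg (a ^ 2), sq_nonneg (b ^ 2)]
    exact ⟨fun i => (abs_le.1 (key i)).1, fun i => (abs_le.1 (key i)).2⟩
  exact (Set.finite_Icc _ _).subset hsub

theorem finite_Exc : Exc.Finite := finite_level (-1) (-1)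

/-- The reflection in a vector of square `-2`. -/
def rootRefl (α x : V) : V := x + bil x α • α

theorem bil_rootRefl_rootRefl {α : V} (h : bil α α = -2) (x y : V) :
    bil (rootRefl α x) (rootRefl α y) = bil x y := by
  simp only [rootRefl, bil_add_left, bil_add_right, bil_smul_left, bil_smul_right, h, bil_comm α y]
  ring

theorem bil_rootRefl_Kvec {α : V} (h : bil α Kvec = 0) (x : V) :
    bil (rootRefl α x) Kvec = bil x Kvec := by
  rw [rootRefl, bil_add_left, bil_smul_left, h, mul_zero, add_zero]

theorem rootRefl_rootRefl {α : V} (h : bil α α = -2) (x : V) : rootRefl α (rootRefl α x) = x := by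
  simp only [rootRefl, bil_add_left, bil_smul_left, h]
  module

/-- `c` is rigid if a vector of `K^⊥` orthogonal to `c` and to all roots pairing maximally with
`c` vanishes. -/
def Rigid (c : V) : Prop :=
  ∀ w, bil w Kvec = 0 → bil w c = 0 →
    (∀ t, bil t t = -2 → bil t Kvec = 0 → bil t c = -2 → bil t w = 0) → w = 0

theorem Rigid.of_rootRefl {α c : V} (h : bil α α = -2) (hK : bil α Kvec = 0)
    (hc : Rigid (rootRefl α c)) : Rigid c := by
  intro w hw hwc ht
  have : rootRefl α w = 0 := by
    apply hc
    · rw [bil_rootRefl_Kvec hK, hw]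
    · rw [bil_rootRefl_rootRefl h, hwc]
    · intro t h1 h2 h3
      rw [← rootRefl_rootRefl h t, bil_rootRefl_rootRefl h]
      apply ht
      · rw [bil_rootRefl_rootRefl h, h1]
      · rw [bil_rootRefl_Kvec hK, h2]
      · rw [← h3, ← bil_rootRefl_rootRefl h, rootRefl_rootRefl h]
  rw [← rootRefl_rootRefl h w, this]
  simp [rootRefl, bil_eq]

theorem rigid_dominant : Rigid ![5, -1, -2, -2, -2, -2, -2, -2, -2] := by
  intro w hK hc ht
  have h1 := ht ![2, 0, -1, -1, -1, -1, -1, -1, 0] (by rw [bil_eq]; rfl) (by rw [bil_Kvec]; rfl) (by rw [bil_eq]; rfl)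
  have h2 := ht ![2, 0, -1, -1, -1, -1, -1, 0, -1] (by rw [bil_eq]; rfl) (by rw [bil_Kvec]; rfl) (by rw [bil_eq]; rfl)
  have h3 := ht ![2, 0, -1, -1, -1, -1, 0, -1, -1] (by rw [bil_eq]; rfl) (by rw [bil_Kvec]; rfl) (by rw [bil_eq]; rfl)
  have h4 := ht ![2, 0, -1, -1, -1, 0, -1, -1, -1] (by rw [bil_eq]; rfl) (by rw [bil_Kvec]; rfl) (by rw [bil_eq]; rfl)
  have h5 := ht ![2, 0, -1, -1, 0, -1, -1, -1, -1] (by rw [bil_eq]; rfl) (by rw [bil_Kvec]; rfl) (by rw [bil_eq]; rfl)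
  have h6 := ht ![2, 0, -1, 0, -1, -1, -1, -1, -1] (by rw [bil_eq]; rfl) (by rw [bil_Kvec]; rfl) (by rw [bil_eq]; rfl)
  have h7 := ht ![2, 0, 0, -1, -1, -1, -1, -1, -1] (by rw [bil_eq]; rfl) (by rw [bil_Kvec]; rfl) (by rw [bil_eq]; rfl)
  rw [bil_Kvec] at hK
  rw [bil_eq] at hc h1 h2 h3 h4 h5 h6 h7
  simp at hc h1 h2 h3 h4 h5 h6 h7
  funext i
  fin_cases i <;> simp <;> omega

theorem eq_dominant (c : V) (hc : bil c c = -4) (hK : bil c Kvec = 0)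
    (h1 : c 2 ≤ c 1) (h2 : c 3 ≤ c 2) (h3 : c 4 ≤ c 3) (h4 : c 5 ≤ c 4) (h5 : c 6 ≤ c 5)
    (h6 : c 7 ≤ c 6) (h7 : c 8 ≤ c 7) (h0 : c 0 + c 1 + c 2 + c 3 ≤ 0) :
    c = ![5, -1, -2, -2, -2, -2, -2, -2, -2] := by
  rw [bil_eq] at hc
  rw [bil_Kvec] at hK
  obtain ⟨d1, e1⟩ : ∃ d : ℕ, c 1 = c 2 + d := ⟨(c 1 - c 2).toNat, by omega⟩
  obtain ⟨d2, e2⟩ : ∃ d : ℕ, c 2 = c 3 + d := ⟨(c 2 - c 3).toNat, by omega⟩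
  obtain ⟨d3, e3⟩ : ∃ d : ℕ, c 3 = c 4 + d := ⟨(c 3 - c 4).toNat, by omega⟩
  obtain ⟨d4, e4⟩ : ∃ d : ℕ, c 4 = c 5 + d := ⟨(c 4 - c 5).toNat, by omega⟩
  obtain ⟨d5, e5⟩ : ∃ d : ℕ, c 5 = c 6 + d := ⟨(c 5 - c 6).toNat, by omega⟩
  obtain ⟨d6, e6⟩ : ∃ d : ℕ, c 6 = c 7 + d := ⟨(c 6 - c 7).toNat, by omega⟩
  obtain ⟨d7, e7⟩ : ∃ d : ℕ, c 7 = c 8 + d := ⟨(c 7 - c 8).toNat, by omega⟩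
  obtain ⟨d0, e0⟩ : ∃ d : ℕ, c 0 = -(c 1 + c 2 + c 3) - d :=
    ⟨(-(c 0 + c 1 + c 2 + c 3)).toNat, by omega⟩
  have e8 : c 8 = -3 * d0 - (2 * d1 + 4 * d2 + 6 * d3 + 5 * d4 + 4 * d5 + 3 * d6 + 2 * d7) := by
    omega
  rw [e0, e1, e2, e3, e4, e5, e6, e7, e8] at hc
  have hd : 8 * d0 ^ 2 + 4 * d1 ^ 2 + 14 * d2 ^ 2 + 30 * d3 ^ 2 + 20 * d4 ^ 2 + 12 * d5 ^ 2 +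
      6 * d6 ^ 2 + 2 * d7 ^ 2 + 4 * (d1 * d7) ≤ 4 := by
    zify
    have ho : (0 : ℤ) ≤ d0 * d1 * 10 + d0 * d2 * 20 + d0 * d3 * 30 + d0 * d4 * 24 + d0 * d5 * 18 +
        d0 * d6 * 12 + d0 * d7 * 6 + d1 * d2 * 14 + d1 * d3 * 20 + d1 * d4 * 16 + d1 * d5 * 12 +
        d1 * d6 * 8 + d2 * d3 * 40 + d2 * d4 * 32 + d2 * d5 * 24 + d2 * d6 * 16 + d2 * d7 * 8 +
        d3 * d4 * 48 + d3 * d5 * 36 + d3 * d6 * 24 + d3 * d7 * 12 + d4 * d5 * 30 + d4 * d6 * 20 +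
        d4 * d7 * 10 + d5 * d6 * 16 + d5 * d7 * 8 + d6 * d7 * 6 := by positivity
    linarith
  have hdiag : ∀ (k d : ℕ), 4 < k → k * d ^ 2 ≤ 4 → d = 0 := by
    intro k d hk h
    by_contra hne
    have : 1 ≤ d ^ 2 := Nat.one_le_pow _ _ (Nat.pos_of_ne_zero hne)
    have := Nat.mul_le_mul_left k this
    omega
  have z0 := hdiag 8 d0 (by norm_num) (by omega)
  have z2 := hdiag 14 d2 (by norm_num) (by omega)
  have z3 := hdiag 30 d3 (by norm_num) (by omega)
  have z4 := hdiag 20 d4 (by norm_num) (by omega)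
  have z5 := hdiag 12 d5 (by norm_num) (by omega)
  have z6 := hdiag 6 d6 (by norm_num) (by omega)
  subst z0 z2 z3 z4 z5 z6
  have hle : ∀ d : ℕ, d ^ 2 ≤ 2 → d ≤ 1 := by
    intro d h
    by_contra hlt
    have := Nat.pow_le_pow_left (show 2 ≤ d by omega) 2
    omega
  have b1 : d1 ≤ 1 := hle d1 (by omega)
  have b7 : d7 ≤ 1 := hle d7 (by omega)
  interval_cases d1 <;> interval_cases d7 <;> norm_num at hc
  simp at e0 e1 e2 e3 e4 e5 e6 e7 e8
  funext i
  fin_cases i <;> simp <;> omega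

theorem rigid_of_bil_self (c : V) (hc : bil c c = -4) (hK : bil c Kvec = 0) : Rigid c := by
  by_contra hbad
  let S : Set V := {x | (bil x x = -4 ∧ bil x Kvec = 0) ∧ ¬ Rigid x}
  have hS : S.Finite := (finite_level (-4) 0).subset fun x hx => hx.1
  obtain ⟨x, ⟨⟨hx, hxK⟩, hxbad⟩, hmin⟩ := Set.exists_min_image S
    (fun x => bil x ![2, 0, -1, -2, -3, -4, -5, -6, -7]) hS ⟨c, ⟨hc, hK⟩, hbad⟩
  have hdom : ∀ α : V, bil α α = -2 → bil α Kvec = 0 →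
      bil α ![2, 0, -1, -2, -3, -4, -5, -6, -7] = -1 → bil x α ≤ 0 := by
    intro α h1 h2 h3
    have h := hmin (rootRefl α x) ⟨⟨by rw [bil_rootRefl_rootRefl h1, hx],
      by rw [bil_rootRefl_Kvec h2, hxK]⟩, fun h => hxbad (h.of_rootRefl h1 h2)⟩
    simp only [rootRefl, bil_add_left, bil_smul_left, h3] at h
    linarith
  apply hxbad
  rw [eq_dominant x hx hxK]
  · exact rigid_dominant
  · have := hdom ![0, 1, -1, 0, 0, 0, 0, 0, 0] (by rw [bil_eq]; rfl) (by rw [bil_Kvec]; rfl)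
      (by rw [bil_eq]; rfl)
    rw [bil_eq] at this; simp at this; omega
  · have := hdom ![0, 0, 1, -1, 0, 0, 0, 0, 0] (by rw [bil_eq]; rfl) (by rw [bil_Kvec]; rfl)
      (by rw [bil_eq]; rfl)
    rw [bil_eq] at this; simp at this; omega
  · have := hdom ![0, 0, 0, 1, -1, 0, 0, 0, 0] (by rw [bil_eq]; rfl) (by rw [bil_Kvec]; rfl)
      (by rw [bil_eq]; rfl)
    rw [bil_eq] at this; simp at this; omega
  · have := hdom ![0, 0, 0, 0, 1, -1, 0, 0, 0] (by rw [bil_eq]; rfl) (by rw [bil_Kvec]; rfl)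
      (by rw [bil_eq]; rfl)
    rw [bil_eq] at this; simp at this; omega
  · have := hdom ![0, 0, 0, 0, 0, 1, -1, 0, 0] (by rw [bil_eq]; rfl) (by rw [bil_Kvec]; rfl)
      (by rw [bil_eq]; rfl)
    rw [bil_eq] at this; simp at this; omega
  · have := hdom ![0, 0, 0, 0, 0, 0, 1, -1, 0] (by rw [bil_eq]; rfl) (by rw [bil_Kvec]; rfl)
      (by rw [bil_eq]; rfl)
    rw [bil_eq] at this; simp at this; omega
  · have := hdom ![0, 0, 0, 0, 0, 0, 0, 1, -1] (by rw [bil_eq]; rfl) (by rw [bil_Kvec]; rfl)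
      (by rw [bil_eq]; rfl)
    rw [bil_eq] at this; simp at this; omega
  · have := hdom ![1, -1, -1, -1, 0, 0, 0, 0, 0] (by rw [bil_eq]; rfl) (by rw [bil_Kvec]; rfl)
      (by rw [bil_eq]; rfl)
    rw [bil_eq] at this; simp at this; omega

theorem exists_Exc_bil_neg (v : V) (hv : v ≠ 0) (hvK : bil v Kvec = 0) :
    ∃ E ∈ Exc, bil E v < 0 := by
  by_contra! hcon
  have hzero : ∀ E ∈ Exc, bil E v = 0 := by
    intro E hE
    have h1 := hcon E hE
    have h2 := hcon ((-2 : ℤ) • Kvec - E) (by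
      constructor
      · simp only [bil_sub_left, bil_sub_right, bil_smul_left, bil_smul_right, hE.1, hE.2,
          bil_comm Kvec E, bil_Kvec_Kvec]
        norm_num
      · simp only [bil_sub_left, bil_smul_left, hE.2, bil_Kvec_Kvec]
        norm_num)
    rw [bil_sub_left, bil_smul_left, bil_comm, hvK] at h2
    linarith
  have h1 := hzero ![0, 1, 0, 0, 0, 0, 0, 0, 0] ⟨by rw [bil_eq]; rfl, by rw [bil_Kvec]; rfl⟩
  have h2 := hzero ![0, 0, 1, 0, 0, 0, 0, 0, 0] ⟨by rw [bil_eq]; rfl, by rw [bil_Kvec]; rfl⟩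
  have h3 := hzero ![0, 0, 0, 1, 0, 0, 0, 0, 0] ⟨by rw [bil_eq]; rfl, by rw [bil_Kvec]; rfl⟩
  have h4 := hzero ![0, 0, 0, 0, 1, 0, 0, 0, 0] ⟨by rw [bil_eq]; rfl, by rw [bil_Kvec]; rfl⟩
  have h5 := hzero ![0, 0, 0, 0, 0, 1, 0, 0, 0] ⟨by rw [bil_eq]; rfl, by rw [bil_Kvec]; rfl⟩
  have h6 := hzero ![0, 0, 0, 0, 0, 0, 1, 0, 0] ⟨by rw [bil_eq]; rfl, by rw [bil_Kvec]; rfl⟩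
  have h7 := hzero ![0, 0, 0, 0, 0, 0, 0, 1, 0] ⟨by rw [bil_eq]; rfl, by rw [bil_Kvec]; rfl⟩
  have h8 := hzero ![0, 0, 0, 0, 0, 0, 0, 0, 1] ⟨by rw [bil_eq]; rfl, by rw [bil_Kvec]; rfl⟩
  have h0 := hzero ![1, -1, -1, 0, 0, 0, 0, 0, 0] ⟨by rw [bil_eq]; rfl, by rw [bil_Kvec]; rfl⟩
  rw [bil_eq] at h0 h1 h2 h3 h4 h5 h6 h7 h8
  simp at h0 h1 h2 h3 h4 h5 h6 h7 h8
  apply hv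
  funext i
  fin_cases i <;> simp <;> omega

/-- A minimal group fixing a nonzero vector of `K^⊥` preserves a conic class. -/
theorem exists_conic_of_fixed (G : Subgroup LatAut) (hGW : G ≤ W) (hmin : MinimalAction G) (v : V)
    (hv : v ≠ 0) (hvK : bil v Kvec = 0) (hfix : ∀ g ∈ G, g v = v) :
    ∃ C, IsConic C ∧ ∀ g ∈ G, g C = C := by
  obtain ⟨E₀, hE₀, hE₀neg⟩ := exists_Exc_bil_neg v hv hvK
  obtain ⟨E, hE, hEmin⟩ := Set.exists_min_image Exc (fun E => bil E v) finite_Exc ⟨E₀, hE₀⟩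
  have hm : bil E v < 0 := (hEmin E₀ hE₀).trans_lt hE₀neg
  have horb : ∀ F ∈ orb G E, F ∈ Exc ∧ bil F v = bil E v := by
    rintro F ⟨g, hg, rfl⟩
    obtain ⟨hg1, hg2⟩ := hGW hg
    refine ⟨⟨by rw [hg1, hE.1], ?_⟩, ?_⟩
    · conv_lhs => rw [← hg2]
      rw [hg1, hE.2]
    · conv_lhs => rw [← hfix g hg]
      rw [hg1]
  have hnot := hmin E hE
  push Not at hnot
  obtain ⟨E₁, hE₁, E₂, hE₂, hne, hE12⟩ := hnot
  obtain ⟨⟨h11, h1K⟩, h1v⟩ := horb E₁ hE₁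
  obtain ⟨⟨h22, h2K⟩, h2v⟩ := horb E₂ hE₂
  have hKv : bil Kvec v = 0 := by rw [bil_comm, hvK]
  have hle : bil E₁ E₂ ≤ 3 := by
    have := bil_self_nonpos (E₁ + E₂ + (2 : ℤ) • Kvec) (by
      simp only [bil_add_left, bil_smul_left, h1K, h2K, bil_Kvec_Kvec]; norm_num)
    simp only [bil_add_left, bil_add_right, bil_smul_left, bil_smul_right, h1K, h2K, h11, h22,
      bil_Kvec_Kvec, bil_comm Kvec, bil_comm E₂ E₁] at this
    linarith
  have hge : 0 ≤ bil E₁ E₂ := by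
    by_contra hlt
    have : E₁ - E₂ = 0 := by
      apply eq_zero_of_bil_self
      · simp only [bil_sub_left, h1K, h2K]; norm_num
      · simp only [bil_sub_left, bil_sub_right, h11, h22, bil_comm E₂ E₁]
        linarith
    exact hne (sub_eq_zero.1 this)
  have hne3 : bil E₁ E₂ ≠ 3 := by
    intro h3
    have : E₁ + E₂ + (2 : ℤ) • Kvec = 0 := by
      apply eq_zero_of_bil_self
      · simp only [bil_add_left, bil_smul_left, h1K, h2K, bil_Kvec_Kvec]; norm_num
      · simp only [bil_add_left, bil_add_right, bil_smul_left, bil_smul_right, h1K, h2K, h11, h22,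
          bil_Kvec_Kvec, bil_comm Kvec, bil_comm E₂ E₁, h3]
        norm_num
    have h4 : bil (E₁ + E₂ + (2 : ℤ) • Kvec) v = 0 := by rw [this]; simp [bil_eq]
    simp only [bil_add_left, bil_smul_left, h1v, h2v, hKv] at h4
    linarith
  have hne2 : bil E₁ E₂ ≠ 2 := by
    intro h2
    have h3 := hEmin (E₁ + E₂ + Kvec) ⟨by
      simp only [bil_add_left, bil_add_right, h1K, h2K, h11, h22,
          bil_Kvec_Kvec, bil_comm Kvec, bil_comm E₂ E₁, h2]
      norm_num, by
      simp only [bil_add_left, h1K, h2K, bil_Kvec_Kvec]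
      norm_num⟩
    simp only [bil_add_left, h1v, h2v, hKv] at h3
    linarith
  have h12 : bil E₁ E₂ = 1 := by omega
  set c := E₁ + E₂ + (2 : ℤ) • Kvec with hcdef
  have hcK : bil c Kvec = 0 := by
    simp only [hcdef, bil_add_left, bil_smul_left, h1K, h2K, bil_Kvec_Kvec]; norm_num
  have hcc : bil c c = -4 := by
    simp only [hcdef, bil_add_left, bil_add_right, bil_smul_left, bil_smul_right, h1K, h2K, h11,
      h22, bil_Kvec_Kvec, bil_comm Kvec, bil_comm E₂ E₁, h12]
    norm_num
  have hcv : bil c v = 2 * bil E v := by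
    simp only [hcdef, bil_add_left, bil_smul_left, h1v, h2v, hKv]; ring
  have hroot : ∀ t, bil t t = -2 → bil t Kvec = 0 → bil E v ≤ bil t v := by
    intro t ht htK
    have := hEmin (t - Kvec) ⟨by
      simp only [bil_sub_left, bil_sub_right, ht, htK, bil_Kvec_Kvec, bil_comm Kvec t]
      norm_num, by
      simp only [bil_sub_left, htK, bil_Kvec_Kvec]
      norm_num⟩
    simpa only [bil_sub_left, hKv, sub_zero] using this
  have hw : (2 : ℤ) • v + (bil E v) • c = 0 := by
    apply rigid_of_bil_self c hcc hcK
    · simp only [bil_add_left, bil_smul_left, hvK, hcK]; ring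
    · simp only [bil_add_left, bil_smul_left, hcc, bil_comm v c, hcv]; ring
    · intro t ht htK htc
      have h1 := hroot t ht htK
      have h2 := hroot (c - t) (by
        simp only [bil_sub_left, bil_sub_right, ht, htc, hcc, bil_comm c t]; norm_num) (by
        simp only [bil_sub_left, htK, hcK]; norm_num)
      simp only [bil_sub_left, hcv] at h2
      simp only [bil_add_right, bil_smul_right, htc]
      linarith
  refine ⟨E₁ + E₂, ⟨?_, ?_⟩, ?_⟩
  · simp only [bil_add_left, bil_add_right, h11, h22, h12, bil_comm E₂ E₁]; norm_num
  · simp only [bil_add_left, h1K, h2K]; norm_num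
  · intro g hg
    have h1 : g ((2 : ℤ) • v + (bil E v) • c) = 0 := by rw [hw, map_zero]
    rw [map_add, map_smul, map_smul, hfix g hg] at h1
    have h2 : bil E v • (g c - c) = 0 := by
      rw [smul_sub, sub_eq_zero]
      exact add_left_cancel (h1.trans hw.symm)
    have h3 : g c = c := by
      rcases smul_eq_zero.1 h2 with h | h
      · exact absurd h hm.ne
      · exact sub_eq_zero.1 h
    have h4 : E₁ + E₂ = c - (2 : ℤ) • Kvec := by rw [hcdef]; abel
    rw [h4, map_sub, map_smul, h3, (hGW hg).2]

open groupCohomology in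
/-- Vanishing of `H¹` lifts invariants modulo `n` to invariants. -/
theorem exists_invariant_lift {G : Subgroup LatAut} (hH1 : CondH1 G) {H : Subgroup LatAut}
    (hHG : H ≤ G) {n : ℤ} (hn : n ≠ 0) (x : V) (hx : ∀ g ∈ H, ∃ y, g x - x = n • y) :
    ∃ z, (∀ g ∈ H, g z = z) ∧ ∃ u, x - z = n • u := by
  have hx' : ∀ g : H, ∃ y, (g : LatAut) x - x = n • y := fun g => hx g g.2
  choose c hc using hx'
  have hcoc : c ∈ cocycles₁ (Rep.of (rep H)) := by
    rw [mem_cocycles₁_def]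
    intro g h
    show (g : LatAut) (c h) - c (g * h) + c g = 0
    have key : n • ((g : LatAut) (c h) - c (g * h) + c g) = 0 := by
      rw [smul_add, smul_sub, ← map_smul, ← hc, ← hc, ← hc, map_sub]
      show _ - ((g : LatAut) ((h : LatAut) x) - x) + _ = 0
      abel
    exact (smul_eq_zero.1 key).resolve_left hn
  have h0 : H1π (Rep.of (rep H)) ⟨c, hcoc⟩ = 0 :=
    @Subsingleton.elim _ (hH1 H hHG) _ _
  rw [H1π_eq_zero_iff] at h0
  obtain ⟨u, hu⟩ := h0
  have hu' : ∀ g : H, (g : LatAut) u - u = c g := fun g => congrFun hu g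
  refine ⟨x - n • u, fun g hg => ?_, u, by abel⟩
  have h1 := hu' ⟨g, hg⟩
  have h2 := hc ⟨g, hg⟩
  rw [← h1] at h2
  simp only at h2
  rw [map_sub, map_smul]
  rw [smul_sub, sub_eq_iff_eq_add] at h2
  rw [h2]
  abel

section Reduction

variable (k : Type*) [CommRing k]

/-- Base change of integral endomorphisms to `k`. -/
def red : Module.End ℤ V →+* Module.End k (Fin 9 → k) :=
  (Matrix.toLinAlgEquiv' : Matrix (Fin 9) (Fin 9) k ≃ₐ[k] _).toRingEquiv.toRingHom.comp
    ((Int.castRingHom k).mapMatrix.comp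
      (LinearMap.toMatrixAlgEquiv' : _ ≃ₐ[ℤ] Matrix (Fin 9) (Fin 9) ℤ).toRingEquiv.toRingHom)

/-- The action of lattice automorphisms on `k⁹`. -/
def act : LatAut →* Module.End k (Fin 9 → k) :=
  (red k).toMonoidHom.comp (LinearEquiv.automorphismGroup.toLinearMapMonoidHom)

/-- Reduction of lattice vectors. -/
def cv : V →+ (Fin 9 → k) where
  toFun x i := (x i : k)
  map_zero' := by ext; simp
  map_add' _ _ := by ext; simp

theorem red_cv (A : Module.End ℤ V) (x : V) : red k A (cv k x) = cv k (A x) := by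
  have h : A x = (LinearMap.toMatrixAlgEquiv' A).mulVec x := by
    rw [← Matrix.toLinAlgEquiv'_apply, Matrix.toLinAlgEquiv'_toMatrixAlgEquiv']
  rw [h]
  ext i
  simp [red, cv, Matrix.mulVec, dotProduct]

theorem act_cv (g : LatAut) (x : V) : act k g (cv k x) = cv k (g x) := red_cv k _ x

theorem cv_zsmul (n : ℤ) (x : V) : cv k (n • x) = (n : k) • cv k x := by
  ext i; simp [cv]

/-- The subspace of `k⁹` fixed by `H`. -/
def Fix (H : Subgroup LatAut) : Submodule k (Fin 9 → k) where
  carrier := {v | ∀ h ∈ H, act k h v = v}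
  add_mem' ha hb h hh := by rw [map_add, ha h hh, hb h hh]
  zero_mem' h _ := map_zero _
  smul_mem' c v hv h hh := by rw [map_smul, hv h hh]

/-- The subgroup fixing a vector of `k⁹`. -/
def fixer (v : Fin 9 → k) : Subgroup LatAut where
  carrier := {h | act k h v = v}
  one_mem' := by show act k 1 v = v; rw [map_one]; rfl
  mul_mem' {a b} ha hb := by
    show act k (a * b) v = v
    rw [map_mul, Module.End.mul_apply, hb, ha]
  inv_mem' {a} ha := by
    show act k a⁻¹ v = v
    have h : act k a⁻¹ (act k a v) = v := by
      rw [← Module.End.mul_apply, ← map_mul, inv_mul_cancel, map_one]; rfl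
    rwa [show act k a v = v from ha] at h

theorem mem_Fix {H : Subgroup LatAut} {v : Fin 9 → k} : v ∈ Fix k H ↔ H ≤ fixer k v := Iff.rfl

theorem mem_Fix_zpowers {g : LatAut} {v : Fin 9 → k} :
    v ∈ Fix k (Subgroup.zpowers g) ↔ act k g v = v := by
  rw [mem_Fix, Subgroup.zpowers_le]; rfl

theorem Fix_zpowers (g : LatAut) :
    Fix k (Subgroup.zpowers g) = LinearMap.ker (act k g - 1) := by
  ext v
  rw [mem_Fix_zpowers, LinearMap.mem_ker, LinearMap.sub_apply, sub_eq_zero]; rfl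

end Reduction

/-- The lattice vectors fixed by `H`. -/
def fixLat (H : Subgroup LatAut) : Submodule ℤ V where
  carrier := {v | ∀ h ∈ H, h v = v}
  add_mem' ha hb h hh := by rw [map_add, ha h hh, hb h hh]
  zero_mem' h _ := map_zero _
  smul_mem' c v hv h hh := by rw [map_smul, hv h hh]

theorem fixLat_saturated (H : Subgroup LatAut) (n : ℤ) (hn : n ≠ 0) (x : V)
    (hx : n • x ∈ fixLat H) : x ∈ fixLat H := by
  intro h hh
  have := hx h hh
  rw [map_smul] at this
  exact smul_right_injective V hn this

theorem cv_zmod_eq_zero {p : ℕ} (x : V) (hx : cv (ZMod p) x = 0) : ∃ y, x = (p : ℤ) • y := by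
  have h : ∀ i, ∃ y, x i = p * y := fun i =>
    (ZMod.intCast_zmod_eq_zero_iff_dvd (x i) p).1 (congrFun hx i)
  choose y hy using h
  exact ⟨y, by ext i; simp [hy i]⟩

theorem cv_zmod_surjective (p : ℕ) : Function.Surjective (cv (ZMod p)) := by
  intro v
  choose x hx using fun i => ZMod.intCast_surjective (v i)
  exact ⟨x, funext hx⟩

theorem cv_rat_injective : Function.Injective (cv ℚ) := by
  intro x y h
  ext i
  exact Int.cast_injective (congrFun h i)

theorem exists_smul_eq_cv (v : Fin 9 → ℚ) : ∃ (n : ℤ) (x : V), n ≠ 0 ∧ (n : ℚ) • v = cv ℚ x := by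
  obtain ⟨n, hn⟩ := IsLocalization.exist_integer_multiples_of_finite (nonZeroDivisors ℤ) v
  choose x hx using hn
  refine ⟨n, x, nonZeroDivisors.ne_zero n.2, ?_⟩
  ext i
  have := hx i
  simp at this
  simp [cv, this]

theorem finrank_span_cv_zmod (p : ℕ) [Fact p.Prime] (L : Submodule ℤ V)
    (hL : ∀ (n : ℤ) x, n ≠ 0 → n • x ∈ L → x ∈ L) :
    Module.finrank (ZMod p) (Submodule.span (ZMod p) (cv (ZMod p) '' L)) = Module.finrank ℤ L := by
  let b := Module.finBasis ℤ L
  have hspan : Submodule.span (ZMod p) (cv (ZMod p) '' L) =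
      Submodule.span (ZMod p) (Set.range fun i => cv (ZMod p) (b i : V)) := by
    apply le_antisymm
    · rw [Submodule.span_le]
      rintro _ ⟨x, hx, rfl⟩
      have : x = ∑ i, b.repr ⟨x, hx⟩ i • (b i : V) := by
        have := congrArg Subtype.val (b.sum_repr ⟨x, hx⟩)
        rw [AddSubmonoidClass.coe_finsetSum] at this
        exact this.symm
      rw [this, map_sum]
      refine Submodule.sum_mem _ fun i _ => ?_
      rw [cv_zsmul]
      exact Submodule.smul_mem _ _ (Submodule.subset_span ⟨i, rfl⟩)
    · apply Submodule.span_mono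
      rintro _ ⟨i, rfl⟩
      exact ⟨b i, (b i).2, rfl⟩
  have hli : LinearIndependent (ZMod p) fun i => cv (ZMod p) (b i : V) := by
    rw [Fintype.linearIndependent_iff]
    intro c hc i
    choose a ha using fun i => ZMod.intCast_surjective (c i)
    have h1 : cv (ZMod p) (∑ i, a i • (b i : V)) = 0 := by
      rw [map_sum, ← hc]
      exact Finset.sum_congr rfl fun i _ => by rw [cv_zsmul, ha]
    obtain ⟨y, hy⟩ := cv_zmod_eq_zero _ h1
    have hp : (p : ℤ) ≠ 0 := by exact_mod_cast (Fact.out : p.Prime).ne_zero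
    have hyL : y ∈ L := by
      apply hL p y hp
      rw [← hy]
      exact L.sum_mem fun i _ => L.smul_mem _ (b i).2
    have h2 : ∑ i, a i • b i = (p : ℤ) • (⟨y, hyL⟩ : L) := by
      apply Subtype.ext
      simpa using hy
    have h3 := congrArg (fun z => b.repr z i) h2
    simp only [b.repr_sum_self, map_smul, Finsupp.smul_apply, smul_eq_mul] at h3
    rw [← ha, h3]
    simp
  rw [hspan, finrank_span_eq_card hli, Fintype.card_fin]

theorem finrank_span_cv_rat (L : Submodule ℤ V) :
    Module.finrank ℚ (Submodule.span ℚ (cv ℚ '' L)) = Module.finrank ℤ L := by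
  let b := Module.finBasis ℤ L
  have hspan : Submodule.span ℚ (cv ℚ '' L) =
      Submodule.span ℚ (Set.range fun i => cv ℚ (b i : V)) := by
    apply le_antisymm
    · rw [Submodule.span_le]
      rintro _ ⟨x, hx, rfl⟩
      have : x = ∑ i, b.repr ⟨x, hx⟩ i • (b i : V) := by
        have := congrArg Subtype.val (b.sum_repr ⟨x, hx⟩)
        rw [AddSubmonoidClass.coe_finsetSum] at this
        exact this.symm
      rw [this, map_sum]
      refine Submodule.sum_mem _ fun i _ => ?_
      rw [cv_zsmul]
      exact Submodule.smul_mem _ _ (Submodule.subset_span ⟨i, rfl⟩)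
    · apply Submodule.span_mono
      rintro _ ⟨i, rfl⟩
      exact ⟨b i, (b i).2, rfl⟩
  have hli : LinearIndependent ℚ fun i => cv ℚ (b i : V) := by
    rw [← LinearIndependent.iff_fractionRing (R := ℤ)]
    have h1 : LinearIndependent ℤ fun i => (b i : V) :=
      b.linearIndependent.map' L.subtype (Submodule.ker_subtype L)
    exact h1.map' (cv ℚ).toIntLinearMap (LinearMap.ker_eq_bot.2 cv_rat_injective)
  rw [hspan, finrank_span_eq_card hli, Fintype.card_fin]

theorem Fix_rat_eq_span (H : Subgroup LatAut) :
    Fix ℚ H = Submodule.span ℚ (cv ℚ '' fixLat H) := by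
  apply le_antisymm
  · intro v hv
    obtain ⟨n, x, hn, hx⟩ := exists_smul_eq_cv v
    have hn' : (n : ℚ) ≠ 0 := by exact_mod_cast hn
    have hxL : x ∈ fixLat H := by
      intro h hh
      apply cv_rat_injective
      rw [← act_cv, ← hx, map_smul, hv h hh]
    rw [← inv_smul_smul₀ hn' v, hx]
    exact Submodule.smul_mem _ _ (Submodule.subset_span ⟨x, hxL, rfl⟩)
  · rw [Submodule.span_le]
    rintro _ ⟨x, hx, rfl⟩ h hh
    rw [act_cv, hx h hh]

theorem exists_fixed_lift {G : Subgroup LatAut} (hH1 : CondH1 G) {H : Subgroup LatAut}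
    (hHG : H ≤ G) (p : ℕ) [Fact p.Prime] (v : Fin 9 → ZMod p) (hv : v ∈ Fix (ZMod p) H) :
    ∃ z ∈ fixLat H, cv (ZMod p) z = v := by
  obtain ⟨x, rfl⟩ := cv_zmod_surjective p v
  have hp : (p : ℤ) ≠ 0 := by exact_mod_cast (Fact.out : p.Prime).ne_zero
  obtain ⟨z, hz, u, hu⟩ := exists_invariant_lift hH1 hHG hp x (fun g hg => by
    apply cv_zmod_eq_zero
    rw [map_sub, ← act_cv, hv g hg, sub_self])
  refine ⟨z, hz, ?_⟩
  have := congrArg (cv (ZMod p)) hu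
  rw [map_sub, cv_zsmul] at this
  simp at this
  exact (sub_eq_zero.1 this).symm

theorem Fix_zmod_eq_span {G : Subgroup LatAut} (hH1 : CondH1 G) {H : Subgroup LatAut}
    (hHG : H ≤ G) (p : ℕ) [Fact p.Prime] :
    Fix (ZMod p) H = Submodule.span (ZMod p) (cv (ZMod p) '' fixLat H) := by
  apply le_antisymm
  · intro v hv
    obtain ⟨z, hz, rfl⟩ := exists_fixed_lift hH1 hHG p v hv
    exact Submodule.subset_span ⟨z, hz, rfl⟩
  · rw [Submodule.span_le]
    rintro _ ⟨x, hx, rfl⟩ h hh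
    rw [act_cv, hx h hh]

/-- The rank of the fixed lattice of `g`. -/
def fixRank (g : LatAut) : ℕ := Module.finrank ℚ (LinearMap.ker (act ℚ g - 1))

theorem finrank_ker_zmod {G : Subgroup LatAut} (hH1 : CondH1 G) {g : LatAut} (hg : g ∈ G)
    (p : ℕ) [Fact p.Prime] :
    Module.finrank (ZMod p) (LinearMap.ker (act (ZMod p) g - 1)) = fixRank g := by
  rw [fixRank, ← Fix_zpowers, ← Fix_zpowers, Fix_rat_eq_span,
    Fix_zmod_eq_span hH1 ((Subgroup.zpowers_le).2 hg), finrank_span_cv_rat,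
    finrank_span_cv_zmod p _ fun n x hn => fixLat_saturated _ n hn x]

section LinearAlgebra

variable {k E : Type*} [Field k] [AddCommGroup E] [Module k E] [FiniteDimensional k E]

theorem finrank_comap_le (C : Module.End k E) (P : Submodule k E) :
    Module.finrank k (P.comap C) ≤
      Module.finrank k ↥(P ⊓ LinearMap.range C) + Module.finrank k (LinearMap.ker C) := by
  have h := LinearMap.finrank_range_add_finrank_ker (C.domRestrict (P.comap C))
  rw [LinearMap.range_domRestrict, Submodule.map_comap_eq, inf_comm] at h
  rw [← h]
  gcongr
  have hm : ∀ x : LinearMap.ker (C.domRestrict (P.comap C)), ((x : P.comap C) : E) ∈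
      LinearMap.ker C := fun x => x.2
  let φ : LinearMap.ker (C.domRestrict (P.comap C)) →ₗ[k] LinearMap.ker C :=
    LinearMap.codRestrict _ ((P.comap C).subtype.comp (Submodule.subtype _)) hm
  apply LinearMap.finrank_le_finrank_of_injective (f := φ)
  intro x y hxy
  apply Subtype.ext
  apply Subtype.ext
  exact congrArg (fun z : LinearMap.ker C => (z : E)) hxy

theorem finrank_ker_mul_le (B C : Module.End k E) :
    Module.finrank k (LinearMap.ker (B * C)) ≤
      Module.finrank k (LinearMap.ker B) + Module.finrank k (LinearMap.ker C) := by
  have h : LinearMap.ker (B * C) = (LinearMap.ker B).comap C := rfl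
  rw [h]
  refine (finrank_comap_le C _).trans ?_
  gcongr
  exact Submodule.finrank_mono inf_le_left

theorem finrank_ker_pow_le (A : Module.End k E) (n : ℕ) :
    Module.finrank k (LinearMap.ker (A ^ n)) ≤ n * Module.finrank k (LinearMap.ker A) := by
  induction n with
  | zero => simp [Module.End.one_eq_id, LinearMap.ker_id]
  | succ n ih =>
    rw [pow_succ]
    refine (finrank_ker_mul_le _ _).trans ?_
    linarith

theorem finrank_ker_pow_le_inf (A : Module.End k E) (n : ℕ) :
    Module.finrank k (LinearMap.ker (A ^ (n + 1))) ≤ Module.finrank k (LinearMap.ker A) +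
      n * Module.finrank k ↥(LinearMap.ker A ⊓ LinearMap.range A) := by
  induction n with
  | zero => rw [zero_add, pow_one, zero_mul, add_zero]
  | succ n ih =>
    have h : LinearMap.ker (A ^ (n + 1 + 1)) = (LinearMap.ker A).comap (A ^ (n + 1)) := by
      rw [pow_succ' A (n + 1)]; rfl
    rw [h]
    refine (finrank_comap_le _ _).trans ?_
    have h2 : LinearMap.range (A ^ (n + 1)) ≤ LinearMap.range A := by
      rw [pow_succ' A n]
      exact LinearMap.range_comp_le_range _ _
    have h3 := Submodule.finrank_mono (inf_le_inf_left (LinearMap.ker A) h2)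
    rw [add_mul, one_mul]
    linarith

theorem finrank_add_le_of_disjoint {P Q R : Submodule k E} (h : Disjoint P Q) (hP : P ≤ R)
    (hQ : Q ≤ R) : Module.finrank k P + Module.finrank k Q ≤ Module.finrank k R := by
  have h1 := Submodule.finrank_sup_add_finrank_inf_eq P Q
  rw [disjoint_iff.1 h, finrank_bot, add_zero] at h1
  rw [← h1]
  exact Submodule.finrank_mono (sup_le hP hQ)

end LinearAlgebra

/-- The pairing with the canonical class over `k`. -/
def pairK (k : Type*) [CommRing k] : (Fin 9 → k) →ₗ[k] k where
  toFun v := -3 * v 0 - v 1 - v 2 - v 3 - v 4 - v 5 - v 6 - v 7 - v 8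
  map_add' v w := by simp only [Pi.add_apply]; ring
  map_smul' c v := by simp only [Pi.smul_apply, smul_eq_mul, RingHom.id_apply]; ring

theorem pairK_cv (k : Type*) [CommRing k] (x : V) : pairK k (cv k x) = (bil x Kvec : ℤ) := by
  rw [bil_Kvec]
  simp [pairK, cv]

theorem bil_apply_Kvec {g : LatAut} (hg : g ∈ W) (x : V) : bil (g x) Kvec = bil x Kvec := by
  conv_lhs => rw [← hg.2]
  rw [hg.1]

theorem pairK_act {p : ℕ} {g : LatAut} (hg : g ∈ W) (v : Fin 9 → ZMod p) :
    pairK (ZMod p) (act (ZMod p) g v) = pairK (ZMod p) v := by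
  obtain ⟨x, rfl⟩ := cv_zmod_surjective p v
  rw [act_cv, pairK_cv, pairK_cv, bil_apply_Kvec hg]

theorem act_Kvec (k : Type*) [CommRing k] {g : LatAut} (hg : g ∈ W) :
    act k g (cv k Kvec) = cv k Kvec := by
  rw [act_cv, hg.2]

theorem Kvec_not_mem_range {p : ℕ} [Fact p.Prime] {g : LatAut} (hg : g ∈ W) :
    cv (ZMod p) Kvec ∉ LinearMap.range (act (ZMod p) g - 1) := by
  rintro ⟨v, hv⟩
  have h := congrArg (pairK (ZMod p)) hv
  rw [pairK_cv, bil_Kvec_Kvec, LinearMap.sub_apply, map_sub, pairK_act hg] at h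
  simp at h

theorem finrank_inf_lt {p : ℕ} [Fact p.Prime] {g : LatAut} (hg : g ∈ W) :
    Module.finrank (ZMod p) ↥(LinearMap.ker (act (ZMod p) g - 1) ⊓
      LinearMap.range (act (ZMod p) g - 1)) <
    Module.finrank (ZMod p) (LinearMap.ker (act (ZMod p) g - 1)) := by
  apply Submodule.finrank_lt_finrank_of_lt
  refine lt_of_le_of_ne inf_le_left fun h => Kvec_not_mem_range (p := p) hg ?_
  have : cv (ZMod p) Kvec ∈ LinearMap.ker (act (ZMod p) g - 1) := by
    rw [LinearMap.mem_ker, LinearMap.sub_apply, act_Kvec _ hg]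
    exact sub_self _
  rw [← h] at this
  exact this.2

theorem act_pow_sub_one {p : ℕ} [Fact p.Prime] (g : LatAut) :
    act (ZMod p) (g ^ p) - 1 = (act (ZMod p) g - 1) ^ p := by
  have : CharP (Module.End (ZMod p) (Fin 9 → ZMod p)) p :=
    charP_of_injective_algebraMap
      (FaithfulSMul.algebraMap_injective (ZMod p) (Module.End (ZMod p) (Fin 9 → ZMod p))) p
  rw [sub_pow_char_of_commute _ (Commute.one_right _), one_pow, map_pow]

/-- The standing hypotheses: a group of isometries fixing `K`, with vanishing `H¹` for all
subgroups and trivial determinant. -/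
structure Nice (Γ : Subgroup LatAut) : Prop where
  le_W : Γ ≤ W
  h1 : CondH1 Γ
  det_eq : ∀ g ∈ Γ, LinearMap.det (g : V →ₗ[ℤ] V) = 1

theorem fixRank_pow_le_inf {Γ : Subgroup LatAut} (h1 : CondH1 Γ) {g : LatAut}
    (hg : g ∈ Γ) {p : ℕ} [hp : Fact p.Prime] :
    fixRank (g ^ p) ≤ fixRank g + (p - 1) *
      Module.finrank (ZMod p) ↥(LinearMap.ker (act (ZMod p) g - 1) ⊓
        LinearMap.range (act (ZMod p) g - 1)) := by
  have h := finrank_ker_pow_le_inf (act (ZMod p) g - 1) (p - 1)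
  rw [Nat.sub_add_cancel hp.out.one_le, ← act_pow_sub_one, finrank_ker_zmod h1 hg,
    finrank_ker_zmod h1 (Γ.pow_mem hg p)] at h
  exact h

/-- `f(g^p) ≤ p f(g)`, where `f` is the rank of the fixed lattice in `K^⊥`. -/
theorem fixRank_pow_prime_le {Γ : Subgroup LatAut} (hΓ : Nice Γ) {g : LatAut} (hg : g ∈ Γ) {p : ℕ}
    (hp : p.Prime) : fixRank (g ^ p) + p ≤ p * fixRank g + 1 := by
  have : Fact p.Prime := ⟨hp⟩
  have h1 := fixRank_pow_le_inf hΓ.h1 hg (p := p)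
  have h2 := finrank_inf_lt (p := p) (hΓ.le_W hg)
  rw [finrank_ker_zmod hΓ.h1 hg] at h2
  obtain ⟨n, rfl⟩ : ∃ n, p = n + 1 := ⟨p - 1, by have := hp.pos; omega⟩
  obtain ⟨m, hm⟩ : ∃ m, fixRank g = m + 1 := ⟨fixRank g - 1, by omega⟩
  rw [hm] at h1 h2 ⊢
  have h3 : n * Module.finrank (ZMod (n + 1)) ↥(LinearMap.ker (act (ZMod (n + 1)) g - 1) ⊓
        LinearMap.range (act (ZMod (n + 1)) g - 1)) ≤ n * m :=
    Nat.mul_le_mul_left n (by omega)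
  rw [Nat.add_sub_cancel] at h1
  nlinarith

theorem fixRank_pow_mul_le {Γ : Subgroup LatAut} (hΓ : Nice Γ) {g : LatAut} (hg : g ∈ Γ)
    {p q : ℕ} (hp : p.Prime) (hq : q.Prime) (hpq : p ≠ q) :
    fixRank (g ^ (p * q)) + p * fixRank g ≤ fixRank (g ^ p) + p * fixRank (g ^ q) := by
  have : Fact p.Prime := ⟨hp⟩
  set A := act (ZMod p) g - 1 with hA
  set Ψ : Module.End (ZMod p) (Fin 9 → ZMod p) := ∑ i ∈ Finset.range q, act (ZMod p) g ^ i with hΨ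
  have hAΨ : A * Ψ = act (ZMod p) (g ^ q) - 1 := by
    rw [hA, hΨ, map_pow, mul_geom_sum]
  have hΨA : Ψ * A = act (ZMod p) (g ^ q) - 1 := by
    rw [hA, hΨ, map_pow, geom_sum_mul]
  have hcomm : Commute A Ψ := hAΨ.trans hΨA.symm
  have hker : ∀ v ∈ LinearMap.ker A, Ψ v = (q : ZMod p) • v := by
    intro v hv
    have hv' : act (ZMod p) g v = v := sub_eq_zero.1 hv
    have hpow : ∀ i : ℕ, (act (ZMod p) g ^ i) v = v := by
      intro i
      induction i with
      | zero => rfl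
      | succ i ih => rw [pow_succ, Module.End.mul_apply, hv', ih]
    rw [hΨ, LinearMap.sum_apply, Finset.sum_congr rfl fun i _ => hpow i, Finset.sum_const,
      Finset.card_range, Nat.cast_smul_eq_nsmul]
  have hq0 : (q : ZMod p) ≠ 0 := by
    rw [Ne, ZMod.natCast_eq_zero_iff]
    exact fun h => hpq ((Nat.prime_dvd_prime_iff_eq hp hq).1 h)
  have hdisj : Disjoint (LinearMap.ker A) (LinearMap.ker Ψ) := by
    rw [Submodule.disjoint_def]
    intro v h1 h2
    rw [LinearMap.mem_ker, hker v h1] at h2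
    exact (smul_eq_zero.1 h2).resolve_left hq0
  have h1 : Module.finrank (ZMod p) (LinearMap.ker A) + Module.finrank (ZMod p) (LinearMap.ker Ψ) ≤
      Module.finrank (ZMod p) (LinearMap.ker (act (ZMod p) (g ^ q) - 1)) := by
    apply finrank_add_le_of_disjoint hdisj
    · rw [← hΨA]; exact LinearMap.ker_le_ker_comp _ _
    · rw [← hAΨ]; exact LinearMap.ker_le_ker_comp _ _
  have h2 : act (ZMod p) (g ^ (p * q)) - 1 = A ^ p * Ψ ^ p := by
    rw [mul_comm p q, pow_mul, act_pow_sub_one, ← hAΨ, hcomm.mul_pow]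
  have h3 := finrank_ker_mul_le (A ^ p) (Ψ ^ p)
  have h4 := finrank_ker_pow_le Ψ p
  rw [← h2, finrank_ker_zmod hΓ.h1 (Γ.pow_mem hg _), hA, ← act_pow_sub_one,
    finrank_ker_zmod hΓ.h1 (Γ.pow_mem hg _)] at h3
  rw [hA, finrank_ker_zmod hΓ.h1 hg, finrank_ker_zmod hΓ.h1 (Γ.pow_mem hg _)] at h1
  nlinarith

theorem fixRank_mono_of_zpowers {g h : LatAut} (hh : h ∈ Subgroup.zpowers g) :
    fixRank g ≤ fixRank h := by
  rw [fixRank, fixRank, ← Fix_zpowers, ← Fix_zpowers]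
  apply Submodule.finrank_mono
  intro v hv
  rw [mem_Fix] at hv ⊢
  exact ((Subgroup.zpowers_le).2 hh).trans hv

theorem fixRank_le_pow (g : LatAut) (n : ℕ) : fixRank g ≤ fixRank (g ^ n) :=
  fixRank_mono_of_zpowers (Subgroup.npow_mem_zpowers g n)

theorem fixRank_add_le (g : LatAut) {p q : ℕ} (hpq : p.Coprime q) :
    fixRank (g ^ p) + fixRank (g ^ q) ≤ fixRank (g ^ (p * q)) + fixRank g := by
  unfold fixRank
  rw [← Fix_zpowers, ← Fix_zpowers, ← Fix_zpowers, ← Fix_zpowers, ← Submodule.finrank_sup_add_finrank_inf_eq]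
  apply add_le_add
  · apply Submodule.finrank_mono
    apply sup_le
    · intro v hv
      rw [mem_Fix] at hv ⊢
      rw [pow_mul]
      exact ((Subgroup.zpowers_le).2 (Subgroup.npow_mem_zpowers _ _)).trans hv
    · intro v hv
      rw [mem_Fix] at hv ⊢
      rw [mul_comm, pow_mul]
      exact ((Subgroup.zpowers_le).2 (Subgroup.npow_mem_zpowers _ _)).trans hv
  · apply Submodule.finrank_mono
    rintro v ⟨h1, h2⟩
    rw [SetLike.mem_coe, mem_Fix, Subgroup.zpowers_le] at h1 h2
    rw [mem_Fix, Subgroup.zpowers_le]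
    have hb := Nat.gcd_eq_gcd_ab p q
    rw [hpq] at hb
    have : g = (g ^ p) ^ (p.gcdA q) * (g ^ q) ^ (p.gcdB q) := by
      rw [← zpow_natCast, ← zpow_natCast, ← zpow_mul, ← zpow_mul, ← zpow_add, ← hb]
      simp
    rw [this]
    exact Subgroup.mul_mem _ (Subgroup.zpow_mem _ h1 _) (Subgroup.zpow_mem _ h2 _)

theorem fixRank_one : fixRank 1 = 9 := by
  rw [fixRank, map_one, sub_self, LinearMap.ker_zero, finrank_top]
  simp

theorem eq_one_of_act_rat {g : LatAut} (h : ∀ v, act ℚ g v = v) : g = 1 := by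
  ext1 x
  apply cv_rat_injective
  rw [← act_cv, h]
  rfl

theorem fixRank_le (g : LatAut) : fixRank g ≤ 9 := by
  have := Submodule.finrank_le (LinearMap.ker (act ℚ g - 1))
  rw [← fixRank] at this
  simpa using this

theorem eq_one_of_fixRank {g : LatAut} (h : fixRank g = 9) : g = 1 := by
  apply eq_one_of_act_rat
  intro v
  have : LinearMap.ker (act ℚ g - 1) = ⊤ := by
    apply Submodule.eq_top_of_finrank_eq
    rw [← fixRank, h]; simp
  have hv : v ∈ LinearMap.ker (act ℚ g - 1) := by rw [this]; trivial
  exact sub_eq_zero.1 hv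

theorem finite_W : (W : Set LatAut).Finite := by
  let φ : LatAut → (Fin 9 → V) := fun g i => g (Pi.single i 1)
  have hinj : Function.Injective φ := by
    intro g h hgh
    apply LinearEquiv.toLinearMap_injective
    apply LinearMap.pi_ext'
    intro i
    ext1
    exact congrFun hgh i
  apply Set.Finite.of_finite_image (f := φ) _ hinj.injOn
  apply (Set.Finite.pi' (t := fun i : Fin 9 => {x : V | bil x x = bil (Pi.single i 1) (Pi.single i 1) ∧
    bil x Kvec = bil (Pi.single i 1) Kvec}) fun i => finite_level _ _).subset
  rintro _ ⟨g, hg, rfl⟩ i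
  exact ⟨hg.1 _ _, bil_apply_Kvec hg _⟩

/-- The matrix of a lattice automorphism. -/
def mat : LatAut →* Matrix (Fin 9) (Fin 9) ℤ :=
  (LinearMap.toMatrixAlgEquiv' : _ ≃ₐ[ℤ] Matrix (Fin 9) (Fin 9) ℤ).toRingEquiv.toRingHom.toMonoidHom.comp
    LinearEquiv.automorphismGroup.toLinearMapMonoidHom

/-- The trace of a lattice automorphism. -/
def tr (g : LatAut) : ℤ := (mat g).trace

theorem act_eq_toLin' (k : Type*) [CommRing k] (g : LatAut) :
    act k g = Matrix.toLin' ((Int.castRingHom k).mapMatrix (mat g)) := rfl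

theorem trace_act (k : Type*) [CommRing k] (g : LatAut) :
    LinearMap.trace k _ (act k g) = (tr g : k) := by
  rw [act_eq_toLin', LinearMap.trace_eq_matrix_trace k (Pi.basisFun k (Fin 9)),
    LinearMap.toMatrix_eq_toMatrix', LinearMap.toMatrix'_toLin', tr]
  simp [Matrix.trace]

theorem tr_one : tr 1 = 9 := by
  rw [tr, map_one, Matrix.trace_one]; rfl

theorem dvd_tr_pow_sub {p : ℕ} (hp : p.Prime) (g : LatAut) : (p : ℤ) ∣ tr (g ^ p) - tr g := by
  have : Fact p.Prime := ⟨hp⟩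
  have key : ∀ h : LatAut, ((tr h : ℤ) : ZMod p) =
      ((Int.castRingHom (ZMod p)).mapMatrix (mat h)).trace := by
    intro h
    simp [tr, Matrix.trace]
  rw [← ZMod.intCast_zmod_eq_zero_iff_dvd]
  push_cast
  rw [key, key, map_pow, map_pow, ZMod.trace_pow_card, ZMod.pow_card, sub_self]

/-- Rationality of the trace: it only depends on the generated cyclic group. -/
theorem tr_pow_coprime {g : LatAut} {n : ℕ} (hn : 0 < n) (hg : g ^ n = 1) {i : ℕ}
    (hi : i.Coprime n) : tr (g ^ i) = tr g := by
  have : NeZero n := ⟨hn.ne'⟩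
  obtain ⟨P, hP, hPp, hPi⟩ := Nat.forall_exists_prime_gt_and_eq_mod
    ((ZMod.isUnit_iff_coprime i n).2 hi) (tr (g ^ i) - tr g).natAbs
  have h1 : g ^ P = g ^ i := by
    rw [ZMod.natCast_eq_natCast_iff] at hPi
    exact pow_eq_pow_iff_modEq.2 (hPi.of_dvd (orderOf_dvd_of_pow_eq_one hg))
  have h2 := dvd_tr_pow_sub hPp g
  rw [h1] at h2
  have h3 := Int.eq_zero_of_abs_lt_dvd h2 (by rw [Int.abs_eq_natAbs]; exact_mod_cast hP)
  linarith

theorem sum_tr_pow {x : LatAut} {m : ℕ} (hm : 0 < m) (hx : x ^ m = 1) :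
    ∑ i ∈ Finset.range m, tr (x ^ i) = m * fixRank x := by
  have hm0 : (m : ℚ) ≠ 0 := by exact_mod_cast hm.ne'
  set S : Module.End ℚ (Fin 9 → ℚ) := ∑ i ∈ Finset.range m, act ℚ x ^ i with hS
  have hxS : (act ℚ x - 1) * S = 0 := by
    rw [hS, mul_geom_sum, ← map_pow, hx, map_one, sub_self]
  have hproj : LinearMap.IsProj (LinearMap.ker (act ℚ x - 1)) ((m : ℚ)⁻¹ • S) := by
    constructor
    · intro v
      rw [LinearMap.mem_ker, LinearMap.smul_apply, map_smul, ← Module.End.mul_apply, hxS]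
      simp
    · intro v hv
      have hv' : act ℚ x v = v := sub_eq_zero.1 hv
      have hpow : ∀ i : ℕ, (act ℚ x ^ i) v = v := by
        intro i
        induction i with
        | zero => rfl
        | succ i ih => rw [pow_succ, Module.End.mul_apply, hv', ih]
      rw [LinearMap.smul_apply, hS, LinearMap.sum_apply, Finset.sum_congr rfl fun i _ => hpow i,
        Finset.sum_const, Finset.card_range, ← Nat.cast_smul_eq_nsmul ℚ, inv_smul_smul₀ hm0]
  have h := hproj.trace
  rw [map_smul, hS, map_sum, smul_eq_mul, inv_mul_eq_iff_eq_mul₀ hm0] at h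
  simp_rw [← map_pow, trace_act] at h
  exact_mod_cast h

theorem sum_range_ite_dvd {d : ℕ} (hd : 0 < d) (m : ℕ) (T : ℕ → ℤ) :
    ∑ i ∈ Finset.range (d * m), (if d ∣ i then T i else 0) =
      ∑ j ∈ Finset.range m, T (d * j) := by
  induction m with
  | zero => simp
  | succ m ih =>
    rw [mul_add, mul_one, Finset.sum_range_add, ih, Finset.sum_range_succ]
    congr 1
    rw [Finset.sum_eq_single_of_mem 0 (Finset.mem_range.2 hd)]
    · simp
    · intro j hj hj0
      rw [if_neg]
      rw [Nat.dvd_add_right (dvd_mul_right d m)]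
      exact fun h => (Nat.le_of_dvd (Nat.pos_of_ne_zero hj0) h).not_gt (Finset.mem_range.1 hj)

theorem sum_ite_dvd_tr {g : LatAut} {d m : ℕ} (hd : 0 < d) (hm : 0 < m) (hg : g ^ (d * m) = 1) :
    ∑ i ∈ Finset.range (d * m), (if d ∣ i then tr (g ^ i) else 0) = m * fixRank (g ^ d) := by
  rw [sum_range_ite_dvd hd m fun i => tr (g ^ i)]
  simp_rw [pow_mul]
  exact sum_tr_pow hm (by rw [← pow_mul, hg])

theorem sum_ite_dvd_const {d m : ℕ} (hd : 0 < d) (c : ℤ) :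
    ∑ i ∈ Finset.range (d * m), (if d ∣ i then c else 0) = m * c := by
  rw [sum_range_ite_dvd hd m fun _ => c]
  simp

/-- The trace of an element of prime power order. -/
theorem tr_prime_power {g : LatAut} {p m : ℕ} (hp : 0 < p) (hm : 0 < m) (hg : g ^ (p * m) = 1)
    (hcop : ∀ i, ¬ p ∣ i → i.Coprime (p * m)) :
    ((p : ℤ) - 1) * tr g = p * fixRank g - fixRank (g ^ p) := by
  have hpm : 0 < p * m := Nat.mul_pos hp hm
  have h1 := sum_tr_pow hpm hg
  have h2 := sum_ite_dvd_tr hp hm hg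
  have h3 := sum_ite_dvd_const (m := m) hp (tr g)
  have h4 : ∑ i ∈ Finset.range (p * m), (tr (g ^ i) - tr g) =
      ∑ i ∈ Finset.range (p * m), ((if p ∣ i then tr (g ^ i) else 0) - if p ∣ i then tr g else 0) := by
    refine Finset.sum_congr rfl fun i _ => ?_
    split_ifs with h
    · rfl
    · rw [tr_pow_coprime hpm hg (hcop i h)]; ring
  rw [Finset.sum_sub_distrib, Finset.sum_sub_distrib, h1, h2, h3] at h4
  simp only [Finset.sum_const, Finset.card_range, nsmul_eq_mul] at h4
  have hm0 : (m : ℤ) ≠ 0 := by exact_mod_cast hm.ne'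
  apply mul_left_cancel₀ hm0
  push_cast at h4
  linear_combination -h4

/-- The trace of an element whose order has exactly two prime divisors. -/
theorem tr_two_primes {g : LatAut} {p q m : ℕ} (hp : 0 < p) (hq : 0 < q) (hm : 0 < m)
    (hpq : p.Coprime q)
    (hg : g ^ (p * q * m) = 1) (hcop : ∀ i, ¬ p ∣ i → ¬ q ∣ i → i.Coprime (p * q * m)) :
    ((p : ℤ) - 1) * (q - 1) * tr g =
      p * q * fixRank g - q * fixRank (g ^ p) - p * fixRank (g ^ q) + fixRank (g ^ (p * q)) := by
  have hpm : 0 < p * q * m := by positivity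
  have e1 : p * q * m = p * (q * m) := by ring
  have e2 : p * q * m = q * (p * m) := by ring
  have h1 := sum_tr_pow hpm hg
  have h2 := sum_ite_dvd_tr hp (Nat.mul_pos hq hm) (e1 ▸ hg)
  have h3 := sum_ite_dvd_tr hq (Nat.mul_pos hp hm) (e2 ▸ hg)
  have h4 := sum_ite_dvd_tr (Nat.mul_pos hp hq) hm hg
  have k2 := sum_ite_dvd_const (m := q * m) hp (tr g)
  have k3 := sum_ite_dvd_const (m := p * m) hq (tr g)
  have k4 := sum_ite_dvd_const (m := m) (Nat.mul_pos hp hq) (tr g)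
  rw [← e1] at h2 k2
  rw [← e2] at h3 k3
  have h5 : ∑ i ∈ Finset.range (p * q * m), (tr (g ^ i) - tr g) =
      ∑ i ∈ Finset.range (p * q * m), (((if p ∣ i then tr (g ^ i) else 0) - if p ∣ i then tr g else 0)
       + ((if q ∣ i then tr (g ^ i) else 0) - if q ∣ i then tr g else 0)
       - ((if p * q ∣ i then tr (g ^ i) else 0) - if p * q ∣ i then tr g else 0)) := by
    refine Finset.sum_congr rfl fun i _ => ?_
    have hiff : p * q ∣ i ↔ p ∣ i ∧ q ∣ i :=
      ⟨fun h => ⟨(dvd_mul_right p q).trans h, (dvd_mul_left q p).trans h⟩,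
        fun h => hpq.mul_dvd_of_dvd_of_dvd h.1 h.2⟩
    by_cases a : p ∣ i <;> by_cases b : q ∣ i <;> simp only [hiff, a, b, and_true, true_and,
      and_false, false_and, if_true, if_false]
    · ring
    · ring
    · ring
    · rw [tr_pow_coprime hpm hg (hcop i a b)]; ring
  simp only [Finset.sum_sub_distrib, Finset.sum_add_distrib, h1, h2, h3, h4, k2, k3, k4,
    Finset.sum_const, Finset.card_range, nsmul_eq_mul] at h5
  have hm0 : (m : ℤ) ≠ 0 := by exact_mod_cast hm.ne'
  apply mul_left_cancel₀ hm0
  push_cast at h5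
  linear_combination -h5

open Polynomial

/-- The Gram matrix of the intersection form. -/
def gram : Matrix (Fin 9) (Fin 9) ℤ := Matrix.diagonal ![1, -1, -1, -1, -1, -1, -1, -1, -1]

theorem gram_mul_gram : gram * gram = 1 := by
  rw [gram, Matrix.diagonal_mul_diagonal, ← Matrix.diagonal_one]
  congr 1
  ext i
  fin_cases i <;> rfl

theorem bil_eq_dotProduct (x y : V) : bil x y = x ⬝ᵥ (gram.mulVec y) := by
  rw [bil_eq, gram]
  simp only [dotProduct, Matrix.mulVec_diagonal, Fin.sum_univ_succ]
  simp [Fin.succ]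
  ring

theorem mat_mulVec (g : LatAut) (x : V) : (mat g).mulVec x = g x := by
  show (LinearMap.toMatrixAlgEquiv' (g : V →ₗ[ℤ] V)).mulVec x = g x
  rw [← Matrix.toLinAlgEquiv'_apply, Matrix.toLinAlgEquiv'_toMatrixAlgEquiv']
  rfl

theorem gram_transpose : gram.transpose = gram := Matrix.diagonal_transpose _

theorem transpose_mul_gram_mul {g : LatAut} (hg : g ∈ W) :
    (mat g).transpose * gram * mat g = gram := by
  ext i j
  have h := hg.1 (Pi.single j 1) (Pi.single i 1)
  rw [bil_eq_dotProduct, bil_eq_dotProduct, ← mat_mulVec, ← mat_mulVec] at h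
  rw [Matrix.mulVec_mulVec, Matrix.dotProduct_mulVec, ← Matrix.mulVec_transpose,
    Matrix.mulVec_mulVec] at h
  simp [gram_transpose] at h
  rw [h, ← Matrix.transpose_apply gram, gram_transpose]

theorem charpoly_reverse {n : Type*} [Fintype n] [DecidableEq n] (hn : Odd (Fintype.card n))
    {A B J : Matrix n n ℚ} (hJ : J * J = 1)
    (hB : B = J * A.transpose * J) (hBA : B * A = 1) (hdet : A.det = 1) :
    A.charpoly.reverse = -A.charpoly := by
  have h1 : B.charpoly = A.charpoly := by
    rw [hB, mul_assoc, Matrix.charpoly_mul_comm, mul_assoc, hJ, mul_one, Matrix.charpoly_transpose]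
  rw [Matrix.reverse_charpoly, ← h1, Matrix.charpolyRev, Matrix.charpoly]
  have h2 : (1 - (X : ℚ[X]) • A.map C) = -(B.charmatrix) * A.map C := by
    rw [Matrix.charmatrix, neg_sub, sub_mul]
    have : B.map (C : ℚ →+* ℚ[X]) * A.map C = 1 := by
      rw [← Matrix.map_mul, hBA]; simp
    rw [RingHom.mapMatrix_apply, this]
    congr 1
    rw [Matrix.scalar_apply, ← Matrix.smul_one_eq_diagonal, smul_mul_assoc, one_mul]
  rw [h2, Matrix.det_mul, Matrix.det_neg]
  have h3 : (A.map (C : ℚ →+* ℚ[X])).det = 1 := by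
    rw [← RingHom.mapMatrix_apply, ← RingHom.map_det, hdet, map_one]
  rw [h3, mul_one, hn.neg_one_pow, neg_one_mul]

theorem odd_rootMultiplicity {P : ℚ[X]} (hP : P ≠ 0) (hrev : P.reverse = -P) :
    Odd (P.rootMultiplicity 1) := by
  obtain ⟨Q, hQ, hQ1⟩ := exists_eq_pow_rootMultiplicity_mul_and_not_dvd P hP 1
  set l := P.rootMultiplicity 1
  rw [dvd_iff_isRoot, IsRoot] at hQ1
  have hrevpow : ∀ n : ℕ, ((X - C 1 : ℚ[X]) ^ n).reverse = (1 - X) ^ n := by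
    intro n
    induction n with
    | zero => rw [pow_zero, pow_zero, ← C_1, reverse_C]
    | succ n ih =>
      rw [pow_succ, reverse_mul_of_domain, ih, pow_succ]
      congr 1
      have h : (X - C 1 : ℚ[X]) = C 1 * X + C (-1) := by simp [sub_eq_add_neg]
      rw [h, reverse_add_C, reverse_mul_X, reverse_C]
      simp [sub_eq_add_neg]
  have hQr : Q.reverse.eval 1 = Q.eval 1 := by
    let _ : Invertible (1 : ℚ) := invertibleOne
    have := eval₂_reverse_mul_pow (RingHom.id ℚ) (1 : ℚ) Q
    simpa using this
  rw [hQ, reverse_mul_of_domain, hrevpow] at hrev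
  have h1 : (1 - X : ℚ[X]) ^ l = (-1) ^ l * (X - C 1) ^ l := by
    rw [← mul_pow]; congr 1; simp
  rw [h1] at hrev
  have h2 : (X - C 1 : ℚ[X]) ^ l * ((-1) ^ l * Q.reverse + Q) = 0 := by
    linear_combination hrev
  have h3 := (mul_eq_zero.1 h2).resolve_left (pow_ne_zero _ (X_sub_C_ne_zero 1))
  have h4 := congrArg (eval 1) h3
  simp [hQr] at h4
  rcases Nat.even_or_odd l with he | ho
  · rw [he.neg_one_pow] at h4
    exact absurd (by linarith) hQ1
  · exact ho

theorem fixRank_eq_rootMultiplicity {g : LatAut} {n : ℕ} (hn : 0 < n) (hg : g ^ n = 1) :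
    fixRank g = (act ℚ g).charpoly.rootMultiplicity 1 := by
  rw [← LinearMap.finrank_maxGenEigenspace_eq]
  have hss : (act ℚ g).IsSemisimple := by
    apply Module.End.isSemisimple_of_squarefree_aeval_eq_zero (p := X ^ n - C 1)
    · exact (separable_X_pow_sub_C (1 : ℚ) (by exact_mod_cast hn.ne') one_ne_zero).squarefree
    · rw [map_sub, map_pow, aeval_X, aeval_C, ← map_pow, hg, map_one, map_one, sub_self]
  rw [hss.isFinitelySemisimple.maxGenEigenspace_eq_eigenspace, Module.End.eigenspace_def, one_smul,
    fixRank]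

theorem isOfFinOrder_of_mem_W {g : LatAut} (hg : g ∈ W) : IsOfFinOrder g := by
  have : Finite W := finite_W
  exact Submonoid.isOfFinOrder_coe.2 (isOfFinOrder_of_finite (⟨g, hg⟩ : W))

theorem odd_fixRank {g : LatAut} (hg : g ∈ W) (hdet : LinearMap.det (g : V →ₗ[ℤ] V) = 1) :
    Odd (fixRank g) := by
  rw [fixRank_eq_rootMultiplicity (isOfFinOrder_of_mem_W hg).orderOf_pos (pow_orderOf_eq_one g)]
  apply odd_rootMultiplicity (LinearMap.charpoly_monic _).ne_zero
  rw [act_eq_toLin', Matrix.charpoly_toLin']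
  have hJ : gram.map (Int.castRingHom ℚ) * gram.map (Int.castRingHom ℚ) = 1 := by
    rw [← Matrix.map_mul, gram_mul_gram]; simp
  apply charpoly_reverse (by decide) hJ rfl
  · rw [RingHom.mapMatrix_apply, ← Matrix.transpose_map, mul_assoc, mul_assoc, ← Matrix.map_mul,
      ← Matrix.map_mul, ← Matrix.map_mul, ← mul_assoc (mat g).transpose,
      transpose_mul_gram_mul hg, gram_mul_gram]
    simp
  · rw [← RingHom.map_det]
    have : (mat g).det = 1 := by
      rw [← hdet, ← LinearMap.det_toMatrix']; rfl
    rw [this, map_one]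

/-- The sum of the traces over a finite subgroup. -/
theorem sum_tr_subgroup (H : Subgroup LatAut) [Fintype H] :
    ∑ h : H, tr h = Fintype.card H * Module.finrank ℚ (Fix ℚ H) := by
  have hc : (Fintype.card H : ℚ) ≠ 0 := by exact_mod_cast Fintype.card_ne_zero
  have hproj : LinearMap.IsProj (Fix ℚ H) ((Fintype.card H : ℚ)⁻¹ • ∑ h : H, act ℚ (h : LatAut)) := by
    constructor
    · intro v g hg
      rw [LinearMap.smul_apply, map_smul, LinearMap.sum_apply, map_sum]
      congr 1
      apply Fintype.sum_equiv (Equiv.mulLeft (⟨g, hg⟩ : H))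
      intro h
      simp
    · intro v hv
      rw [LinearMap.smul_apply, LinearMap.sum_apply,
        Finset.sum_congr rfl fun (h : H) _ => hv h h.2]
      simp [← Nat.cast_smul_eq_nsmul ℚ, smul_smul, hc]
  have h := hproj.trace
  rw [map_smul, map_sum] at h
  simp only [trace_act] at h
  rw [smul_eq_mul, inv_mul_eq_iff_eq_mul₀ hc] at h
  exact_mod_cast h

/-- The elements of `Γ` commuting with `y` and acting trivially on the image of `y - 1`. -/
def complementary (Γ : Subgroup LatAut) (y : LatAut) : Subgroup LatAut where
  carrier := {k | k ∈ Γ ∧ k * y = y * k ∧ ∀ x, k (y x - x) = y x - x}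
  one_mem' := ⟨Γ.one_mem, by simp, fun _ => rfl⟩
  mul_mem' := by
    rintro a b ⟨ha, hay, ha'⟩ ⟨hb, hby, hb'⟩
    refine ⟨Γ.mul_mem ha hb, by rw [mul_assoc, hby, ← mul_assoc, hay, mul_assoc], fun x => ?_⟩
    rw [LinearEquiv.mul_apply, hb', ha']
  inv_mem' := by
    rintro a ⟨ha, hay, ha'⟩
    refine ⟨Γ.inv_mem ha, ((Commute.inv_left (show Commute a y from hay))).eq, fun x => ?_⟩
    conv_lhs => rw [← ha' x]
    exact a.symm_apply_apply _

theorem complementary_le (Γ : Subgroup LatAut) (y : LatAut) : complementary Γ y ≤ Γ :=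
  fun _ h => h.1

theorem act_mul_sub_one (R : Type*) [CommRing R] {Γ : Subgroup LatAut} {y k : LatAut}
    (hk : k ∈ complementary Γ y) : act R k * (act R y - 1) = act R y - 1 := by
  have h : (k : Module.End ℤ V) * ((y : Module.End ℤ V) - 1) = (y : Module.End ℤ V) - 1 :=
    LinearMap.ext hk.2.2
  have := congrArg (red R) h
  rwa [map_mul, map_sub, map_one] at this

theorem act_mul (R : Type*) [CommRing R] {Γ : Subgroup LatAut} {y k : LatAut}
    (hk : k ∈ complementary Γ y) : act R (y * k) = act R y + act R k - 1 := by
  have h := act_mul_sub_one R hk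
  rw [mul_sub, mul_one, sub_eq_iff_eq_add] at h
  rw [← hk.2.1, map_mul, h]
  abel

theorem tr_mul {Γ : Subgroup LatAut} {y k : LatAut}
    (hk : k ∈ complementary Γ y) : tr (y * k) = tr y + tr k - 9 := by
  have h := congrArg (LinearMap.trace ℚ _) (act_mul ℚ hk)
  rw [map_sub, map_add, trace_act, trace_act, trace_act, LinearMap.trace_one] at h
  simp only [Module.finrank_fin_fun] at h
  have h' : ((tr (y * k) : ℤ) : ℚ) = ((tr y + tr k - 9 : ℤ) : ℚ) := by
    rw [h]; push_cast; rfl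
  exact_mod_cast h'

theorem range_le_Fix (R : Type*) [CommRing R] (Γ : Subgroup LatAut) (y : LatAut) :
    LinearMap.range (act R y - 1) ≤ Fix R (complementary Γ y) := by
  rintro _ ⟨x, rfl⟩ k hk
  exact LinearMap.congr_fun (act_mul_sub_one R hk) x

theorem disjoint_ker_range {y : LatAut} (hy : IsOfFinOrder y) :
    Disjoint (LinearMap.ker (act ℚ y - 1)) (LinearMap.range (act ℚ y - 1)) := by
  rw [Submodule.disjoint_def]
  rintro _ hx ⟨z, rfl⟩
  set w := (act ℚ y - 1) z with hw
  have h1 : act ℚ y w = w := by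
    rw [LinearMap.mem_ker, LinearMap.sub_apply, sub_eq_zero] at hx; exact hx
  have h2 : act ℚ y z = z + w := by
    rw [hw, LinearMap.sub_apply, Module.End.one_apply]; abel
  have h3 : ∀ n : ℕ, act ℚ (y ^ n) z = z + (n : ℚ) • w := by
    intro n
    induction n with
    | zero => simp
    | succ n ih =>
      rw [pow_succ', map_mul, Module.End.mul_apply, ih, map_add, map_smul, h1, h2]
      push_cast
      rw [add_smul, one_smul]; abel
  have h4 := h3 (orderOf y)
  rw [pow_orderOf_eq_one, map_one, Module.End.one_apply, left_eq_add, smul_eq_zero] at h4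
  exact h4.resolve_left (by exact_mod_cast hy.orderOf_pos.ne')

theorem Fix_sup (R : Type*) [CommRing R] (H H' : Subgroup LatAut) :
    Fix R (H ⊔ H') = Fix R H ⊓ Fix R H' := by
  ext v
  rw [Submodule.mem_inf, mem_Fix, mem_Fix, mem_Fix, sup_le_iff]

theorem finrank_Fix_zmod {G : Subgroup LatAut} (hH1 : CondH1 G) {H : Subgroup LatAut}
    (hH : H ≤ G) (p : ℕ) [Fact p.Prime] :
    Module.finrank (ZMod p) (Fix (ZMod p) H) = Module.finrank ℚ (Fix ℚ H) := by
  rw [Fix_rat_eq_span, Fix_zmod_eq_span hH1 hH, finrank_span_cv_rat,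
    finrank_span_cv_zmod p _ fun n x hn => fixLat_saturated _ n hn x]

theorem finrank_range (y : LatAut) :
    Module.finrank ℚ (LinearMap.range (act ℚ y - 1)) + fixRank y = 9 := by
  rw [fixRank, LinearMap.finrank_range_add_finrank_ker]
  simp

theorem finrank_Fix_complementary {Γ : Subgroup LatAut} (hΓ : Nice Γ) {y : LatAut} (hy : y ∈ Γ)
    {p : ℕ} [Fact p.Prime] :
    9 + (Module.finrank (ZMod p) ↥(LinearMap.ker (act (ZMod p) y - 1) ⊓
        LinearMap.range (act (ZMod p) y - 1)) + 1) ≤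
      fixRank y + Module.finrank ℚ (Fix ℚ (complementary Γ y)) := by
  set T := Subgroup.zpowers y ⊔ complementary Γ y with hT
  have hTΓ : T ≤ Γ := sup_le ((Subgroup.zpowers_le).2 hy) (complementary_le Γ y)
  have h1 : Module.finrank (ZMod p) ↥(LinearMap.ker (act (ZMod p) y - 1) ⊓
        LinearMap.range (act (ZMod p) y - 1)) < Module.finrank (ZMod p) (Fix (ZMod p) T) := by
    apply Submodule.finrank_lt_finrank_of_lt
    refine lt_of_le_of_ne ?_ fun h => ?_
    · rw [hT, Fix_sup, Fix_zpowers]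
      exact inf_le_inf_left _ (range_le_Fix _ Γ y)
    · have hK : cv (ZMod p) Kvec ∈ Fix (ZMod p) T := fun g hg => act_Kvec _ (hΓ.le_W (hTΓ hg))
      rw [← h] at hK
      exact Kvec_not_mem_range (hΓ.le_W hy) hK.2
  rw [finrank_Fix_zmod hΓ.h1 hTΓ] at h1
  have h2 := finrank_range y
  have h3 : Module.finrank ℚ (Fix ℚ T) + Module.finrank ℚ (LinearMap.range (act ℚ y - 1)) ≤
      Module.finrank ℚ (Fix ℚ (complementary Γ y)) := by
    apply finrank_add_le_of_disjoint _ _ (range_le_Fix ℚ Γ y)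
    · refine (disjoint_ker_range (isOfFinOrder_of_mem_W (hΓ.le_W hy))).mono_left ?_
      rw [hT, Fix_sup, Fix_zpowers]
      exact inf_le_left
    · rw [hT, Fix_sup]
      exact inf_le_right
  omega

/-- The character sum over a coset of the complementary subgroup is nonnegative. -/
theorem sum_tr_section_nonneg {Γ : Subgroup LatAut} (hΓ : Nice Γ) {y : LatAut} (hy : y ∈ Γ)
    {p : ℕ} (hp : p.Prime) (htr : ((p : ℤ) - 1) * tr y = p * fixRank y - fixRank (y ^ p))
    [Fintype (complementary Γ y)] :
    0 ≤ ∑ k : complementary Γ y, (tr (y * k) - 1) := by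
  have : Fact p.Prime := ⟨hp⟩
  have h1 := finrank_Fix_complementary hΓ hy (p := p)
  have h2 := fixRank_pow_le_inf hΓ.h1 hy (p := p)
  set j := Module.finrank (ZMod p) ↥(LinearMap.ker (act (ZMod p) y - 1) ⊓
        LinearMap.range (act (ZMod p) y - 1))
  have h3 : ∀ k : complementary Γ y, tr (y * k) - 1 = (tr y - 10) + tr k := by
    intro k; rw [tr_mul k.2]; ring
  rw [Finset.sum_congr rfl fun k _ => h3 k, Finset.sum_add_distrib, sum_tr_subgroup]
  simp only [Finset.sum_const, Finset.card_univ, nsmul_eq_mul]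
  rw [← mul_add]
  apply mul_nonneg (by positivity)
  have hp1 : 1 ≤ p := hp.one_le
  zify [hp1] at h1 h2
  have h4 : (0 : ℤ) ≤ (p - 1) * (tr y - fixRank y + j) := by
    rw [mul_add, mul_sub, htr]; linarith
  have h5 : (0 : ℤ) ≤ tr y - fixRank y + j := by
    refine nonneg_of_mul_nonneg_right h4 ?_
    have := hp.two_le
    linarith [(by exact_mod_cast this : (2 : ℤ) ≤ p)]
  linarith

theorem fixRank_mul {Γ : Subgroup LatAut} (hΓ : Γ ≤ W) {y k : LatAut} (hy : y ∈ Γ)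
    (hk : k ∈ complementary Γ y) : fixRank (y * k) + 9 = fixRank y + fixRank k := by
  have hd := disjoint_ker_range (isOfFinOrder_of_mem_W (hΓ hy))
  set A := act ℚ y - 1 with hA
  have hkA : act ℚ k * A = A := act_mul_sub_one ℚ hk
  have hAk : A * act ℚ k = A := by
    have : A * act ℚ k = act ℚ k * A := by
      rw [hA, sub_mul, mul_sub, ← map_mul, ← map_mul, hk.2.1, one_mul, mul_one]
    rw [this, hkA]
  have hker : LinearMap.ker (act ℚ (y * k) - 1) = LinearMap.ker A ⊓ LinearMap.ker (act ℚ k - 1) := by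
    have he : act ℚ (y * k) - 1 = A + (act ℚ k - 1) := by
      rw [act_mul ℚ hk, hA]; abel
    rw [he]
    apply le_antisymm
    · intro v hv
      rw [LinearMap.mem_ker, LinearMap.add_apply] at hv
      have h1 : A (A v) = 0 := by
        have h2 := congrArg A hv
        have h3 : A ((act ℚ k - 1) v) = 0 := by
          rw [← Module.End.mul_apply, mul_sub, hAk, mul_one, sub_self]; rfl
        rwa [map_add, h3, add_zero, map_zero] at h2
      have h4 : A v = 0 := Submodule.disjoint_def.1 hd _ h1 ⟨v, rfl⟩
      refine ⟨h4, ?_⟩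
      rw [h4, zero_add] at hv
      exact hv
    · rintro v ⟨h1, h2⟩
      rw [SetLike.mem_coe, LinearMap.mem_ker] at h1 h2
      rw [LinearMap.mem_ker, LinearMap.add_apply, h1, h2, add_zero]
  have htop : LinearMap.ker A ⊔ LinearMap.ker (act ℚ k - 1) = ⊤ := by
    rw [eq_top_iff]
    have h1 : LinearMap.range A ≤ LinearMap.ker (act ℚ k - 1) := by
      rintro _ ⟨x, rfl⟩
      rw [LinearMap.mem_ker, ← Module.End.mul_apply, sub_mul, hkA, one_mul, sub_self]; rfl
    refine le_trans ?_ (sup_le_sup_left h1 _)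
    rw [top_le_iff]
    apply Submodule.eq_top_of_finrank_eq
    have h2 := Submodule.finrank_sup_add_finrank_inf_eq (LinearMap.ker A) (LinearMap.range A)
    rw [disjoint_iff.1 hd, finrank_bot, add_zero] at h2
    rw [h2, add_comm, LinearMap.finrank_range_add_finrank_ker]
  have h := Submodule.finrank_sup_add_finrank_inf_eq (LinearMap.ker A) (LinearMap.ker (act ℚ k - 1))
  rw [htop, finrank_top, ← hker] at h
  rw [fixRank, fixRank, fixRank, ← h]
  simp [add_comm]

theorem mem_complementary {Γ : Subgroup LatAut} {y k g : LatAut} (hk : k ∈ Γ) (hyk : k * y = y * k)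
    (hg : g = y * k) (hyg : y ∈ Subgroup.zpowers g) (hkg : k ∈ Subgroup.zpowers g)
    (h : fixRank y + fixRank k = 9 + fixRank g) : k ∈ complementary Γ y := by
  refine ⟨hk, hyk, fun x => ?_⟩
  have hinf : Fix ℚ (Subgroup.zpowers g) = Fix ℚ (Subgroup.zpowers y) ⊓ Fix ℚ (Subgroup.zpowers k) := by
    rw [← Fix_sup]
    congr 1
    apply le_antisymm
    · rw [Subgroup.zpowers_le, hg]
      exact Subgroup.mul_mem_sup (Subgroup.mem_zpowers y) (Subgroup.mem_zpowers k)
    · exact sup_le ((Subgroup.zpowers_le).2 hyg) ((Subgroup.zpowers_le).2 hkg)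
  have htop : Fix ℚ (Subgroup.zpowers y) ⊔ Fix ℚ (Subgroup.zpowers k) = ⊤ := by
    apply Submodule.eq_top_of_finrank_eq
    have h1 := Submodule.finrank_sup_add_finrank_inf_eq (Fix ℚ (Subgroup.zpowers y))
      (Fix ℚ (Subgroup.zpowers k))
    rw [← hinf, Fix_zpowers, Fix_zpowers, Fix_zpowers] at h1
    rw [fixRank, fixRank, fixRank] at h
    rw [Fix_zpowers, Fix_zpowers, Module.finrank_fin_fun]
    omega
  obtain ⟨a, ha, b, hb, hab⟩ := Submodule.mem_sup.1 (htop ▸ Submodule.mem_top : cv ℚ x ∈ _)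
  rw [mem_Fix_zpowers] at ha hb
  apply cv_rat_injective
  rw [← act_cv, map_sub, ← act_cv, ← hab, map_add, ha, add_sub_add_left_eq_sub, map_sub, hb,
    ← Module.End.mul_apply, ← map_mul, hyk, map_mul, Module.End.mul_apply, hb]

variable {Γ : Subgroup LatAut}

theorem Nice.isOfFinOrder (hΓ : Nice Γ) {g : LatAut} (hg : g ∈ Γ) : IsOfFinOrder g :=
  isOfFinOrder_of_mem_W (hΓ.le_W hg)

theorem Nice.odd (hΓ : Nice Γ) {g : LatAut} (hg : g ∈ Γ) : fixRank g % 2 = 1 :=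
  Nat.odd_iff.1 (odd_fixRank (hΓ.le_W hg) (hΓ.det_eq g hg))

theorem Nice.three_le (hΓ : Nice Γ) {g : LatAut} (hg : g ∈ Γ) : 3 ≤ fixRank g := by
  induction hn : orderOf g using Nat.strong_induction_on generalizing g with
  | _ n ih =>
    by_cases h1 : n = 1
    · rw [h1, orderOf_eq_one_iff] at hn
      rw [hn, fixRank_one]; norm_num
    · obtain ⟨p, hp, hpn⟩ := Nat.exists_prime_and_dvd h1
      have hpos : 0 < n := hn ▸ (hΓ.isOfFinOrder hg).orderOf_pos
      have h2 := ih (n / p) (Nat.div_lt_self hpos hp.one_lt) (Γ.pow_mem hg p)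
        (by rw [orderOf_pow_of_dvd hp.ne_zero (hn ▸ hpn), hn])
      have h3 := fixRank_pow_prime_le hΓ hg hp
      have h4 := hΓ.odd hg
      by_contra h5
      have h6 : fixRank g = 1 := by omega
      rw [h6] at h3
      omega

theorem fixRank_lt {g : LatAut} (h : g ≠ 1) : fixRank g < 9 :=
  lt_of_le_of_ne (fixRank_le g) fun h' => h (eq_one_of_fixRank h')

theorem tr_of_pow_prime {g : LatAut} {p : ℕ} (hp : p.Prime) (hg : g ^ p = 1) :
    ((p : ℤ) - 1) * tr g = p * fixRank g - 9 := by
  have := tr_prime_power (m := 1) hp.pos one_pos (by rwa [mul_one]) fun i hi => by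
    rw [mul_one]; exact ((Nat.Prime.coprime_iff_not_dvd hp).2 hi).symm
  rwa [hg, fixRank_one] at this

theorem Nice.prime_le (hΓ : Nice Γ) {g : LatAut} (hg : g ∈ Γ) {p : ℕ} (hp : p.Prime)
    (hgp : g ^ p = 1) (h1 : g ≠ 1) : p = 2 ∨ p = 3 ∨ p = 5 ∨ p = 7 := by
  have h2 := tr_of_pow_prime hp hgp
  have h3 := hΓ.three_le hg
  have h4 := fixRank_lt h1
  have h5 : ((p : ℤ) - 1) ∣ (9 - fixRank g : ℤ) := ⟨fixRank g - tr g, by linarith⟩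
  have h6 := Int.le_of_dvd (by omega) h5
  have h7 : p ≤ 7 := by omega
  have := hp.two_le
  interval_cases p <;> revert hp <;> norm_num

theorem Nice.fixRank_three (hΓ : Nice Γ) {g : LatAut} (hg : g ∈ Γ) (hgp : g ^ 3 = 1) :
    5 ≤ fixRank g := by
  have := fixRank_pow_prime_le hΓ hg Nat.prime_three
  rw [hgp, fixRank_one] at this
  have := hΓ.odd hg
  omega

theorem Nice.fixRank_le_seven (hΓ : Nice Γ) {g : LatAut} (hg : g ∈ Γ) (h1 : g ≠ 1) :
    fixRank g ≤ 7 := by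
  have := hΓ.odd hg
  have := fixRank_lt h1
  omega

theorem Nice.fixRank_five (hΓ : Nice Γ) {g : LatAut} (hg : g ∈ Γ) (hgp : g ^ 5 = 1) (h1 : g ≠ 1) :
    fixRank g = 5 := by
  have := tr_of_pow_prime Nat.prime_five hgp
  have := hΓ.odd hg
  have := hΓ.fixRank_le_seven hg h1
  have := hΓ.three_le hg
  push_cast at *
  omega

theorem Nice.fixRank_seven (hΓ : Nice Γ) {g : LatAut} (hg : g ∈ Γ) (hgp : g ^ 7 = 1) (h1 : g ≠ 1) :
    fixRank g = 3 := by
  have := tr_of_pow_prime (by norm_num : Nat.Prime 7) hgp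
  have := hΓ.odd hg
  have := hΓ.fixRank_le_seven hg h1
  have := hΓ.three_le hg
  push_cast at *
  omega

theorem pow_ne_one_of_orderOf {g : LatAut} {n d : ℕ} (hn : orderOf g = n) (hd : 0 < d) (hdn : d < n) :
    g ^ d ≠ 1 := pow_ne_one_of_lt_orderOf hd.ne' (hn ▸ hdn)

theorem Nice.not_seven_mul (hΓ : Nice Γ) {g : LatAut} (hg : g ∈ Γ) {q : ℕ} (hq : q.Prime)
    (hq7 : q ≠ 7) : orderOf g ≠ 7 * q := by
  intro hn
  have h7 : Nat.Prime 7 := by norm_num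
  have hgn : g ^ (7 * q) = 1 := hn ▸ pow_orderOf_eq_one g
  have h1 := hΓ.fixRank_seven (Γ.pow_mem hg q) (by rw [← pow_mul, mul_comm, hgn])
    (pow_ne_one_of_orderOf hn hq.pos (by have := hq.pos; omega))
  have h2 := fixRank_le_pow g q
  have h3 := hΓ.three_le hg
  have h4 := fixRank_pow_mul_le hΓ hg h7 hq hq7.symm
  rw [hgn, fixRank_one] at h4
  have := fixRank_lt (pow_ne_one_of_orderOf (d := 7) hn (by norm_num) (by have := hq.two_le; omega))
  omega

theorem Nice.not_thirty (hΓ : Nice Γ) {g : LatAut} (hg : g ∈ Γ) : orderOf g ≠ 30 := by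
  intro hn
  have hgn : g ^ 30 = 1 := hn ▸ pow_orderOf_eq_one g
  have hne : ∀ d, 0 < d → d < 30 → g ^ d ≠ 1 := fun d h1 h2 => pow_ne_one_of_orderOf hn h1 h2
  have h1 := hΓ.fixRank_five (Γ.pow_mem hg 6) (by rw [← pow_mul, hgn]) (hne 6 (by norm_num) (by norm_num))
  have h2 := fixRank_pow_mul_le hΓ (Γ.pow_mem hg 2) Nat.prime_five Nat.prime_three (by norm_num)
  have h3 := fixRank_pow_mul_le hΓ hg Nat.prime_five Nat.prime_two (by norm_num)
  have h4 := fixRank_pow_mul_le hΓ (Γ.pow_mem hg 5) Nat.prime_three Nat.prime_two (by norm_num)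
  simp only [← pow_mul, Nat.reduceMul, hgn, fixRank_one] at h2 h3 h4
  have h5 := fixRank_lt (hne 10 (by norm_num) (by norm_num))
  have h6 := fixRank_lt (hne 15 (by norm_num) (by norm_num))
  have h7 := hΓ.three_le (Γ.pow_mem hg 2)
  have h8 := hΓ.three_le hg
  have h9 := hΓ.odd (Γ.pow_mem hg 2)
  have h10 := fixRank_le_pow g 2
  have h11 := hΓ.odd (Γ.pow_mem hg 10)
  have h12 := hΓ.odd (Γ.pow_mem hg 5)
  omega

theorem Nice.not_nine (hΓ : Nice Γ) {g : LatAut} (hg : g ∈ Γ) : orderOf g ≠ 9 := by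
  intro hn
  have hgn : g ^ 9 = 1 := orderOf_dvd_iff_pow_eq_one.1 (by rw [hn])
  have h1 := tr_prime_power (g := g) (p := 3) (m := 3) (by norm_num) (by norm_num) hgn fun i hi =>
    ((Nat.Prime.coprime_iff_not_dvd Nat.prime_three).2 hi).symm.mul_right
      ((Nat.Prime.coprime_iff_not_dvd Nat.prime_three).2 hi).symm
  have h2 := tr_of_pow_prime (g := g ^ 3) Nat.prime_three (by rw [← pow_mul, hgn])
  have h3 := dvd_tr_pow_sub Nat.prime_three g
  have h4 := hΓ.fixRank_three (Γ.pow_mem hg 3) (by rw [← pow_mul, hgn])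
  have h5 := hΓ.fixRank_le_seven (Γ.pow_mem hg 3) (pow_ne_one_of_orderOf hn (by norm_num) (by norm_num))
  have h6 := hΓ.odd (Γ.pow_mem hg 3)
  push_cast at h1 h2 h3
  omega

theorem orderOf_pow_div {g : LatAut} {n d : ℕ} (hn : orderOf g = n) (hpos : 0 < n) (hd : d ∣ n) :
    orderOf (g ^ (n / d)) = d := by
  have h := Nat.div_ne_zero_iff_of_dvd hd
  rw [orderOf_pow_of_dvd (h.2 ⟨hpos.ne', fun h0 => hpos.ne' (by simpa [h0] using hd)⟩)
    (hn.symm ▸ Nat.div_dvd_of_dvd hd), hn, Nat.div_div_self hd hpos.ne']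

theorem coprime_of_prime_dvd {n i : ℕ} (h : ∀ r, r.Prime → r ∣ n → ¬ r ∣ i) : i.Coprime n :=
  Nat.Coprime.symm (Nat.coprime_of_dvd fun r hr hrn hri => h r hr hrn hri)

/-- A `p`-element with fixed rank `5` whose complementary subgroup has no elements of order `p`. -/
structure SectionBase (Γ : Subgroup LatAut) (y : LatAut) (p : ℕ) : Prop where
  mem : y ∈ Γ
  prime : p.Prime
  pow_eq_one : ∃ n : ℕ, y ^ p ^ n = 1
  fixRank_eq : fixRank y = 5
  eq_one : ∀ z ∈ complementary Γ y, z ^ p = 1 → z = 1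

theorem SectionBase.tr_eq {y : LatAut} {p : ℕ} (h : SectionBase Γ y p) :
    ((p : ℤ) - 1) * tr y = p * fixRank y - fixRank (y ^ p) := by
  obtain ⟨n, hn⟩ := h.pow_eq_one
  have hp := h.prime
  refine tr_prime_power (m := p ^ n) hp.pos (pow_pos hp.pos n) ?_ fun i hi => ?_
  · rw [mul_comm, pow_mul, hn, one_pow]
  · have := ((Nat.Prime.coprime_iff_not_dvd hp).2 hi).symm
    exact this.mul_right (this.pow_right n)

theorem fixRank_eq_of_zpowers {g h : LatAut} (h1 : h ∈ Subgroup.zpowers g)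
    (h2 : g ∈ Subgroup.zpowers h) : fixRank g = fixRank h :=
  le_antisymm (fixRank_mono_of_zpowers h1) (fixRank_mono_of_zpowers h2)

theorem Nice.exists_section_of_pow (hΓ : Nice Γ) {g : LatAut} (hg : g ∈ Γ) {c : ℕ}
    (hp : (2 * c + 1).Prime) (h5 : ∀ z ∈ Γ, z ^ (2 * c + 1) = 1 → 5 ≤ fixRank z)
    (hgp : g ^ (2 * (2 * c + 1)) = 1) (h1 : fixRank g = 3) (h2 : fixRank (g ^ 2) = 5)
    (h3 : fixRank (g ^ (2 * c + 1)) = 7) :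
    ∃ y p, SectionBase Γ y p ∧ ∃ k ∈ complementary Γ y, g = y * k := by
  set p := 2 * c + 1 with hpc
  have hgyk : g = g ^ (2 * (c + 1)) * g ^ p := by
    rw [← pow_add, (by omega : 2 * (c + 1) + p = 2 * p + 1), pow_succ, hgp, one_mul]
  have hyp : (g ^ (2 * (c + 1))) ^ p = 1 := by
    rw [← pow_mul, (by ring : 2 * (c + 1) * p = 2 * p * (c + 1)), pow_mul, hgp, one_pow]
  have hFy : fixRank (g ^ (2 * (c + 1))) = 5 := by
    rw [← h2]
    apply fixRank_eq_of_zpowers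
    · have : g ^ 2 = (g ^ (2 * (c + 1))) ^ 2 := by
        rw [← pow_mul, (by omega : 2 * (c + 1) * 2 = 2 * p + 2), pow_add, hgp, one_mul]
      rw [this]
      exact Subgroup.npow_mem_zpowers _ _
    · rw [pow_mul]
      exact Subgroup.npow_mem_zpowers _ _
  refine ⟨g ^ (2 * (c + 1)), p, ⟨Γ.pow_mem hg _, hp, ⟨1, by rwa [pow_one]⟩, hFy, ?_⟩, g ^ p, ?_, hgyk⟩
  · intro z hz hzp
    have h4 := fixRank_mul hΓ.le_W (Γ.pow_mem hg _) hz
    have h6 := h5 _ (Γ.mul_mem (Γ.pow_mem hg (2 * (c + 1))) hz.1) (by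
      rw [(show Commute (g ^ (2 * (c + 1))) z from hz.2.1.symm).mul_pow, hyp, hzp, one_mul])
    have h7 := fixRank_le z
    exact eq_one_of_fixRank (by omega)
  · refine mem_complementary (Γ.pow_mem hg _) (by rw [← pow_add, ← pow_add, add_comm]) hgyk
      (Subgroup.npow_mem_zpowers _ _) (Subgroup.npow_mem_zpowers _ _) (by omega)

theorem Nice.exists_section_of_two_pow (hΓ : Nice Γ) {g : LatAut} (hg : g ∈ Γ) {a : ℕ}
    (hga : g ^ (3 * 2 ^ a) = 1) (h1 : fixRank g = 3) (h2 : fixRank (g ^ 2) = 5)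
    (h3 : fixRank (g ^ 3) = 5) (h6 : fixRank (g ^ 6) = 7) :
    ∃ y p, SectionBase Γ y p ∧ ∃ k ∈ complementary Γ y, g = y * k := by
  have hg4 : g ^ (3 * 4 ^ a) = 1 := by
    rw [(by norm_num : 4 = 2 * 2), mul_pow, ← mul_assoc, pow_mul, hga, one_pow]
  obtain ⟨c, hc⟩ : 3 ∣ 1 + 2 * 4 ^ a := by
    have : 4 ^ a % 3 = 1 := by rw [Nat.pow_mod]; simp
    omega
  set u := g ^ (4 ^ a) with hu
  set h := g ^ (3 * c) with hh
  have hghu : g = h * u := by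
    rw [hh, hu, ← hc, ← pow_add, (by ring : 1 + 2 * 4 ^ a + 4 ^ a = 3 * 4 ^ a + 1), pow_succ, hg4,
      one_mul]
  have hu3 : u ^ 3 = 1 := by rw [hu, ← pow_mul, mul_comm, hg4]
  have hh2 : h ^ 2 ^ a = 1 := by
    rw [hh, ← pow_mul, (by ring : 3 * c * 2 ^ a = 3 * 2 ^ a * c), pow_mul, hga, one_pow]
  have hFh : ∀ j, fixRank (h ^ j) = fixRank (g ^ (3 * j)) := by
    intro j
    apply fixRank_eq_of_zpowers
    · have : g ^ (3 * j) = (h ^ j) ^ 3 := by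
        rw [hh, ← hc, ← pow_mul, ← pow_mul,
          (by ring : (1 + 2 * 4 ^ a) * (j * 3) = 3 * j + 3 * 4 ^ a * (2 * j)), pow_add,
          pow_mul g (3 * 4 ^ a), hg4, one_pow, mul_one]
      rw [this]
      exact Subgroup.npow_mem_zpowers _ _
    · have : h ^ j = (g ^ (3 * j)) ^ c := by
        rw [hh, ← pow_mul, ← pow_mul]; congr 1; ring
      rw [this]
      exact Subgroup.npow_mem_zpowers _ _
  have hFh1 : fixRank h = 5 := by rw [← pow_one h, hFh, ← h3]
  have hFh2 : fixRank (h ^ 2) = 7 := by rw [hFh, ← h6]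
  have huΓ : u ∈ Γ := Γ.pow_mem hg _
  have hhΓ : h ∈ Γ := Γ.pow_mem hg _
  have hu1 : u ≠ 1 := by
    intro h0
    rw [h0, mul_one] at hghu
    rw [hghu] at h1
    omega
  have hu4 : ∀ i : ℕ, u ^ 4 ^ i = u := by
    intro i
    induction i with
    | zero => simp
    | succ i ih => rw [pow_succ, pow_mul, ih, pow_succ, hu3, one_mul]
  have hFu : fixRank u = 7 := by
    have hle := hΓ.fixRank_three huΓ hu3
    have hle' := hΓ.fixRank_le_seven huΓ hu1
    have hodd := hΓ.odd huΓ
    by_contra hne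
    have hFu5 : fixRank u = 5 := by omega
    have key : ∀ i : ℕ, fixRank (g ^ 2 ^ (i + 1)) = 5 ∧ fixRank (g ^ (3 * 2 ^ (i + 1))) = 7 := by
      intro i
      induction i with
      | zero => exact ⟨h2, h6⟩
      | succ i ih =>
        obtain ⟨ih1, ih2⟩ := ih
        set x := g ^ 2 ^ (i + 1) with hx
        have e1 : g ^ 2 ^ (i + 1 + 1) = x ^ 2 := by rw [hx, ← pow_mul, ← pow_succ]
        have e2 : g ^ (3 * 2 ^ (i + 1 + 1)) = x ^ (3 * 2) := by
          rw [hx, ← pow_mul]; congr 1; ring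
        have e3 : g ^ (3 * 2 ^ (i + 1)) = x ^ 3 := by rw [hx, ← pow_mul, mul_comm]
        rw [e1, e2]
        rw [e3] at ih2
        have hux : u = (x ^ 2) ^ (2 ^ i * 4 ^ a) := by
          rw [← e1, ← pow_mul, ← mul_assoc, ← pow_add,
            (by ring : i + 1 + 1 + i = 2 * (i + 1)), pow_mul 2 2 (i + 1), mul_comm, pow_mul]
          exact (hu4 (i + 1)).symm
        have f1 := fixRank_le_pow x 2
        have f2 : fixRank (x ^ 2) ≤ fixRank u := by
          rw [hux]; exact fixRank_le_pow _ _
        have f3 := fixRank_pow_mul_le hΓ (Γ.pow_mem hg (2 ^ (i + 1))) Nat.prime_three Nat.prime_two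
          (by norm_num)
        rw [← hx] at f3
        have f4 := fixRank_le_pow (x ^ 3) 2
        rw [← pow_mul x 3 2] at f4
        constructor <;> omega
    have := (key a).2
    rw [pow_succ, ← mul_assoc, pow_mul, hga, one_pow, fixRank_one] at this
    omega
  refine ⟨h, 2, ⟨hhΓ, Nat.prime_two, ⟨a, hh2⟩, hFh1, ?_⟩, u, ?_, hghu⟩
  · intro z hz hz2
    by_contra hz1
    have h4 := fixRank_mul hΓ.le_W hhΓ hz
    have h5 := hΓ.fixRank_le_seven hz.1 hz1
    have h7 := fixRank_pow_prime_le hΓ (Γ.mul_mem hhΓ hz.1) Nat.prime_two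
    rw [(show Commute h z from hz.2.1.symm).mul_pow, hz2, mul_one] at h7
    omega
  · refine mem_complementary huΓ (by rw [hu, hh, ← pow_add, ← pow_add, add_comm]) hghu
      (Subgroup.npow_mem_zpowers _ _) (Subgroup.npow_mem_zpowers _ _) (by omega)

theorem tr_eq_of_prime_dvd {g : LatAut} {n p q : ℕ} (hn : orderOf g = n) (hpos : 0 < n)
    (hp : p.Prime) (hq : q.Prime) (hpq : p ≠ q) (hpn : p ∣ n) (hqn : q ∣ n)
    (hr : ∀ r, r.Prime → r ∣ n → r = p ∨ r = q) :
    ((p : ℤ) - 1) * (q - 1) * tr g =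
      p * q * fixRank g - q * fixRank (g ^ p) - p * fixRank (g ^ q) + fixRank (g ^ (p * q)) := by
  have hcop := (Nat.coprime_primes hp hq).2 hpq
  obtain ⟨m, hm⟩ := hcop.mul_dvd_of_dvd_of_dvd hpn hqn
  have hm0 : 0 < m := Nat.pos_of_ne_zero fun h0 => by simp [h0] at hm; omega
  refine tr_two_primes hp.pos hq.pos hm0 hcop (by rw [← hm, ← hn, pow_orderOf_eq_one]) ?_
  intro i hi hi'
  rw [← hm]
  refine coprime_of_prime_dvd fun r hr1 hr2 => ?_
  rcases hr r hr1 hr2 with rfl | rfl <;> assumption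

theorem tr_eq_of_unique_prime_dvd {g : LatAut} {n p : ℕ} (hn : orderOf g = n) (hpos : 0 < n)
    (hp : p.Prime) (hpn : p ∣ n) (hr : ∀ r, r.Prime → r ∣ n → r = p) :
    ((p : ℤ) - 1) * tr g = p * fixRank g - fixRank (g ^ p) := by
  obtain ⟨m, hm⟩ := hpn
  have hm0 : 0 < m := Nat.pos_of_ne_zero fun h0 => by simp [h0] at hm; omega
  refine tr_prime_power hp.pos hm0 (by rw [← hm, ← hn, pow_orderOf_eq_one]) ?_
  intro i hi
  rw [← hm]
  refine coprime_of_prime_dvd fun r hr1 hr2 => ?_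
  rwa [hr r hr1 hr2]

/-- An element of `Γ` whose character value is negative lies in one of the sections. -/
theorem Nice.exists_section (hΓ : Nice Γ) {g : LatAut} (hg : g ∈ Γ) (htr : tr g < 1) :
    ∃ y p, SectionBase Γ y p ∧ ∃ k ∈ complementary Γ y, g = y * k := by
  obtain ⟨n, hn⟩ : ∃ n, orderOf g = n := ⟨_, rfl⟩
  have hpos : 0 < n := hn ▸ (hΓ.isOfFinOrder hg).orderOf_pos
  have hord : ∀ d, d ∣ n → ∃ x ∈ Γ, orderOf x = d := fun d hd =>
    ⟨_, Γ.pow_mem hg (n / d), orderOf_pow_div hn hpos hd⟩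
  have hprimes : ∀ r, r.Prime → r ∣ n → r = 2 ∨ r = 3 ∨ r = 5 ∨ r = 7 := by
    intro r hr hrn
    obtain ⟨x, hx, hxr⟩ := hord r hrn
    refine hΓ.prime_le hx hr (hxr ▸ pow_orderOf_eq_one x) fun h1 => ?_
    rw [h1, orderOf_one] at hxr
    exact hr.one_lt.ne hxr
  have h30 : ¬ (2 ∣ n ∧ 3 ∣ n ∧ 5 ∣ n) := by
    intro h
    obtain ⟨x, hx, hxr⟩ := hord 30 (by omega)
    exact hΓ.not_thirty hx hxr
  have h9 : ¬ 9 ∣ n := by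
    intro h
    obtain ⟨x, hx, hxr⟩ := hord 9 h
    exact hΓ.not_nine hx hxr
  have h7 : ∀ q, q.Prime → q ≠ 7 → q ∣ n → ¬ 7 ∣ n := by
    intro q hq hq7 hqn h7n
    obtain ⟨x, hx, hxr⟩ := hord (7 * q) (Nat.Coprime.mul_dvd_of_dvd_of_dvd
      ((Nat.coprime_primes (by norm_num) hq).2 hq7.symm) h7n hqn)
    exact hΓ.not_seven_mul hx hq hq7 hxr
  have hn1 : n ≠ 1 := by
    rintro rfl
    rw [orderOf_eq_one_iff] at hn
    rw [hn, tr_one] at htr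
    norm_num at htr
  obtain ⟨p, hp, hpn⟩ := Nat.exists_prime_and_dvd hn1
  by_cases hall : ∀ r, r.Prime → r ∣ n → r = p
  · have h1 := tr_eq_of_unique_prime_dvd hn hpos hp hpn hall
    have h2 := fixRank_pow_prime_le hΓ hg hp
    have h3 : (1 : ℤ) ≤ p - 1 := by have := hp.two_le; omega
    zify at h2
    nlinarith
  push Not at hall
  obtain ⟨q, hq, hqn, hqp⟩ := hall
  have h7n : ¬ 7 ∣ n := by
    by_cases h : q = 7
    · exact h7 p hp (fun h' => hqp (h.trans h'.symm)) hpn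
    · exact h7 q hq h hqn
  have hprimes' : ∀ r, r.Prime → r ∣ n → r = 2 ∨ r = 3 ∨ r = 5 := by
    intro r hr hrn
    rcases hprimes r hr hrn with h | h | h | h
    · exact Or.inl h
    · exact Or.inr (Or.inl h)
    · exact Or.inr (Or.inr h)
    · exact absurd (h ▸ hrn) h7n
  have e1 := hΓ.odd hg
  have e2 : ∀ i, fixRank (g ^ i) % 2 = 1 := fun i => hΓ.odd (Γ.pow_mem hg i)
  have e3 := hΓ.three_le hg
  have e4 : ∀ i, fixRank (g ^ i) ≤ 9 := fun i => fixRank_le _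
  have e5 := fixRank_le_pow g
  have hsupp : (2 ∣ n ∧ 3 ∣ n ∧ ¬ 5 ∣ n) ∨ (2 ∣ n ∧ 5 ∣ n ∧ ¬ 3 ∣ n) ∨ (3 ∣ n ∧ 5 ∣ n ∧ ¬ 2 ∣ n) := by
    rcases hprimes' p hp hpn with rfl | rfl | rfl <;> rcases hprimes' q hq hqn with rfl | rfl | rfl <;>
      first | (exact absurd rfl hqp) | tauto
  have ineq : ∀ {p q : ℕ}, p.Prime → q.Prime → p ≠ q →
      fixRank (g ^ p) + fixRank (g ^ q) ≤ fixRank (g ^ (p * q)) + fixRank g ∧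
      fixRank (g ^ p) + p ≤ p * fixRank g + 1 ∧ fixRank (g ^ q) + q ≤ q * fixRank g + 1 ∧
      fixRank (g ^ (p * q)) + p ≤ p * fixRank (g ^ q) + 1 ∧
      fixRank (g ^ (p * q)) + q ≤ q * fixRank (g ^ p) + 1 ∧
      fixRank (g ^ (p * q)) + p * fixRank g ≤ fixRank (g ^ p) + p * fixRank (g ^ q) ∧
      fixRank (g ^ (p * q)) + q * fixRank g ≤ fixRank (g ^ q) + q * fixRank (g ^ p) := by
    intro p q hp hq hpq
    refine ⟨fixRank_add_le g ((Nat.coprime_primes hp hq).2 hpq), fixRank_pow_prime_le hΓ hg hp,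
      fixRank_pow_prime_le hΓ hg hq, ?_, ?_, fixRank_pow_mul_le hΓ hg hp hq hpq, ?_⟩
    · have := fixRank_pow_prime_le hΓ (Γ.pow_mem hg q) hp
      rwa [← pow_mul, mul_comm q p] at this
    · have := fixRank_pow_prime_le hΓ (Γ.pow_mem hg p) hq
      rwa [← pow_mul] at this
    · have := fixRank_pow_mul_le hΓ hg hq hp hpq.symm
      rwa [mul_comm q p] at this
  rcases hsupp with ⟨ha, hb, hc⟩ | ⟨ha, hb, hc⟩ | ⟨ha, hb, hc⟩
  · have ht := tr_eq_of_prime_dvd hn hpos Nat.prime_two Nat.prime_three (by norm_num) ha hb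
      fun r hr hrn => by
        rcases hprimes' r hr hrn with rfl | rfl | rfl
        · exact Or.inl rfl
        · exact Or.inr rfl
        · exact absurd hrn hc
    have hi := ineq Nat.prime_two Nat.prime_three (by norm_num)
    norm_num only at ht hi
    have a2 := e2 2
    have a3 := e2 3
    have a6 := e2 6
    have b6 := e4 6
    have hcases : fixRank g = 3 ∧ fixRank (g ^ 2) = 5 ∧ (fixRank (g ^ 3) = 7 ∧ fixRank (g ^ 6) = 9 ∨
        fixRank (g ^ 3) = 5 ∧ fixRank (g ^ 6) = 7) := by omega
    obtain ⟨h1, h2, ⟨h3, h6⟩ | ⟨h3, h6⟩⟩ := hcases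
    · exact hΓ.exists_section_of_pow hg (c := 1) Nat.prime_three
        (fun z hz hz3 => hΓ.fixRank_three hz hz3) (eq_one_of_fixRank h6) h1 h2 h3
    · obtain ⟨m, hm⟩ := hb
      have hm0 : m ≠ 0 := by rintro rfl; omega
      have hm2 : m = 2 ^ m.primeFactorsList.length :=
        Nat.eq_prime_pow_of_unique_prime_dvd hm0 fun {d} hd hdm => by
          rcases hprimes' d hd (hm ▸ Dvd.dvd.mul_left hdm 3) with rfl | rfl | rfl
          · rfl
          · exfalso; omega
          · exact absurd (hm ▸ Dvd.dvd.mul_left hdm 3) hc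
      refine hΓ.exists_section_of_two_pow hg (a := m.primeFactorsList.length) ?_ h1 h2 h3 h6
      rw [← hm2, ← hm, ← hn, pow_orderOf_eq_one]
  · have ht := tr_eq_of_prime_dvd hn hpos Nat.prime_two Nat.prime_five (by norm_num) ha hb
      fun r hr hrn => by
        rcases hprimes' r hr hrn with rfl | rfl | rfl
        · exact Or.inl rfl
        · exact absurd hrn hc
        · exact Or.inr rfl
    have hi := ineq Nat.prime_two Nat.prime_five (by norm_num)
    norm_num only at ht hi
    have a2 := e2 2
    have a3 := e2 5
    have a6 := e2 10
    have b6 := e4 10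
    have hcases : fixRank g = 3 ∧ fixRank (g ^ 2) = 5 ∧ fixRank (g ^ 5) = 7 ∧ fixRank (g ^ 10) = 9 := by
      omega
    obtain ⟨h1, h2, h3, h6⟩ := hcases
    refine hΓ.exists_section_of_pow hg (c := 2) Nat.prime_five ?_ (eq_one_of_fixRank h6) h1 h2 h3
    intro z hz hz5
    by_cases hz1 : z = 1
    · rw [hz1, fixRank_one]; norm_num
    · exact (hΓ.fixRank_five hz hz5 hz1).ge
  · have ht := tr_eq_of_prime_dvd hn hpos Nat.prime_three Nat.prime_five (by norm_num) ha hb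
      fun r hr hrn => by
        rcases hprimes' r hr hrn with rfl | rfl | rfl
        · exact absurd hrn hc
        · exact Or.inl rfl
        · exact Or.inr rfl
    have hi := ineq Nat.prime_three Nat.prime_five (by norm_num)
    norm_num only at ht hi
    have a2 := e2 3
    have a3 := e2 5
    have a6 := e2 15
    have b6 := e4 15
    exfalso
    omega

theorem SectionBase.coprime {y k : LatAut} {p : ℕ} (hΓ : Nice Γ) (h : SectionBase Γ y p)
    (hk : k ∈ complementary Γ y) : p.Coprime (orderOf k) := by
  rw [Nat.Prime.coprime_iff_not_dvd h.prime]
  intro hd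
  have hpos := (hΓ.isOfFinOrder hk.1).orderOf_pos
  have h1 := orderOf_pow_div rfl hpos hd
  have h2 := h.eq_one _ ((complementary Γ y).pow_mem hk (orderOf k / p))
    (orderOf_dvd_iff_pow_eq_one.1 h1.dvd)
  rw [h2, orderOf_one] at h1
  exact h.prime.one_lt.ne h1

theorem exists_pow_eq {y k : LatAut} (hyk : y * k = k * y) {a b : ℕ} (hab : a.Coprime b)
    (hy : y ^ a = 1) (hk : k ^ b = 1) : ∃ e, e % a = 1 % a ∧ b ∣ e ∧ (y * k) ^ e = y := by
  obtain ⟨e, he1, he2⟩ := Nat.chineseRemainder hab 1 0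
  refine ⟨e, he1, (Nat.modEq_zero_iff_dvd).1 he2, ?_⟩
  rw [(show Commute y k from hyk).mul_pow, orderOf_dvd_iff_pow_eq_one.1
    ((orderOf_dvd_of_pow_eq_one hk).trans ((Nat.modEq_zero_iff_dvd).1 he2)), mul_one,
    pow_eq_pow_mod e hy, he1, ← pow_eq_pow_mod 1 hy, pow_one]

/-- Distinct sections are disjoint. -/
theorem SectionBase.eq_of_mul_eq {y y' k k' : LatAut} {p q : ℕ} (hΓ : Nice Γ)
    (h : SectionBase Γ y p) (h' : SectionBase Γ y' q) (hk : k ∈ complementary Γ y)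
    (hk' : k' ∈ complementary Γ y') (heq : y * k = y' * k') : y = y' := by
  obtain ⟨n, hn⟩ := h.pow_eq_one
  obtain ⟨n', hn'⟩ := h'.pow_eq_one
  have hc := h.coprime hΓ hk
  have hc' := h'.coprime hΓ hk'
  by_cases hpq : p = q
  · subst hpq
    obtain ⟨e, he, hed, hey⟩ := exists_pow_eq (a := p ^ (n + n')) (b := orderOf k * orderOf k')
      hk.2.1.symm ((hc.mul_right hc').pow_left _) (by rw [pow_add, pow_mul, hn, one_pow])
      (by rw [pow_mul, pow_orderOf_eq_one, one_pow])
    have hy' : (y' * k') ^ e = y' := by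
      have h1 : y' ^ p ^ (n + n') = 1 := by rw [add_comm, pow_add, pow_mul, hn', one_pow]
      rw [(show Commute y' k' from hk'.2.1.symm).mul_pow,
        orderOf_dvd_iff_pow_eq_one.1 ((Dvd.intro_left _ rfl).trans hed), mul_one,
        pow_eq_pow_mod e h1, he, ← pow_eq_pow_mod 1 h1, pow_one]
    rw [← hey, heq, hy']
  · exfalso
    have hpq' := (Nat.coprime_primes h.prime h'.prime).2 hpq
    obtain ⟨e, he, hed, hey⟩ := exists_pow_eq (a := q ^ n') (b := p ^ n * orderOf k')
      hk'.2.1.symm ((hpq'.symm.pow n' n).mul_right (hc'.pow_left n')) hn'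
      (by rw [mul_comm, pow_mul, pow_orderOf_eq_one, one_pow])
    rw [← heq, (show Commute y k from hk.2.1.symm).mul_pow, orderOf_dvd_iff_pow_eq_one.1
      ((orderOf_dvd_of_pow_eq_one hn).trans ((Dvd.intro _ rfl).trans hed)), one_mul] at hey
    have h1 := fixRank_le_pow k e
    rw [hey, h'.fixRank_eq] at h1
    have h2 := fixRank_mul hΓ.le_W h.mem hk
    have h3 := hΓ.three_le (Γ.mul_mem h.mem hk.1)
    rw [h.fixRank_eq] at h2
    omega

theorem SectionBase.mul_ne_one {y k : LatAut} {p : ℕ} (hΓ : Nice Γ)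
    (h : SectionBase Γ y p) (hk : k ∈ complementary Γ y) : y * k ≠ 1 := by
  intro h1
  have h2 := fixRank_mul hΓ.le_W h.mem hk
  rw [h1, fixRank_one, h.fixRank_eq] at h2
  have := fixRank_le k
  omega

theorem Nice.finite (hΓ : Nice Γ) : (Γ : Set LatAut).Finite := finite_W.subset hΓ.le_W

theorem Nice.sum_pos (hΓ : Nice Γ) : 0 < ∑ g ∈ hΓ.finite.toFinset, (tr g - 1) := by
  classical
  have hfin : ∀ y, (complementary Γ y : Set LatAut).Finite := fun y =>
    hΓ.finite.subset (complementary_le Γ y)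
  set S := hΓ.finite.toFinset with hS
  have memS : ∀ g, g ∈ S ↔ g ∈ Γ := fun g => by rw [hS, Set.Finite.mem_toFinset]; rfl
  let sec : LatAut → Finset LatAut := fun y => (hfin y).toFinset.image (y * ·)
  have memsec : ∀ y g, g ∈ sec y ↔ ∃ k ∈ complementary Γ y, y * k = g := by
    intro y g
    simp only [sec, Finset.mem_image, Set.Finite.mem_toFinset, SetLike.mem_coe]
  set Y := S.filter (fun y => ∃ p, SectionBase Γ y p) with hY
  set U := Y.biUnion sec with hU
  have hUS : U ⊆ S := by
    intro g hg
    obtain ⟨y, hy, hg⟩ := Finset.mem_biUnion.1 hg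
    obtain ⟨k, hk, rfl⟩ := (memsec y g).1 hg
    exact (memS _).2 (Γ.mul_mem ((memS _).1 (Finset.mem_filter.1 hy).1) hk.1)
  have hdisj : (Y : Set LatAut).PairwiseDisjoint sec := by
    intro y hy y' hy' hne
    rw [Function.onFun, Finset.disjoint_left]
    intro g hg hg'
    obtain ⟨p, hp⟩ := (Finset.mem_filter.1 hy).2
    obtain ⟨q, hq⟩ := (Finset.mem_filter.1 hy').2
    obtain ⟨k, hk, rfl⟩ := (memsec y g).1 hg
    obtain ⟨k', hk', h⟩ := (memsec y' _).1 hg'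
    exact hne (hp.eq_of_mul_eq hΓ hq hk hk' h.symm)
  have hUsum : 0 ≤ ∑ g ∈ U, (tr g - 1) := by
    rw [hU, Finset.sum_biUnion hdisj]
    refine Finset.sum_nonneg fun y hy => ?_
    obtain ⟨p, hp⟩ := (Finset.mem_filter.1 hy).2
    rw [Finset.sum_image fun a _ b _ h => mul_left_cancel h]
    have : Fintype (complementary Γ y) := (hfin y).fintype
    have h := sum_tr_section_nonneg hΓ hp.mem hp.prime hp.tr_eq
    rwa [← Finset.sum_subtype (hfin y).toFinset (p := fun k => k ∈ complementary Γ y)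
      (fun k => by rw [Set.Finite.mem_toFinset]; rfl) (fun k => tr (y * k) - 1)] at h
  have h1U : 1 ∈ S \ U := by
    rw [Finset.mem_sdiff]
    refine ⟨(memS 1).2 Γ.one_mem, fun h => ?_⟩
    obtain ⟨y, hy, hg⟩ := Finset.mem_biUnion.1 h
    obtain ⟨p, hp⟩ := (Finset.mem_filter.1 hy).2
    obtain ⟨k, hk, h⟩ := (memsec y 1).1 hg
    exact hp.mul_ne_one hΓ hk h
  have hrest : 0 < ∑ g ∈ S \ U, (tr g - 1) := by
    refine Finset.sum_pos' (fun g hg => ?_) ⟨1, h1U, by rw [tr_one]; norm_num⟩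
    rw [Finset.mem_sdiff] at hg
    by_contra hlt
    obtain ⟨y, p, hy, k, hk, rfl⟩ := hΓ.exists_section ((memS g).1 hg.1) (by omega)
    exact hg.2 (Finset.mem_biUnion.2 ⟨y, Finset.mem_filter.2 ⟨(memS y).2 hy.mem, p, hy⟩,
      (memsec y _).2 ⟨k, hk, rfl⟩⟩)
  rw [← Finset.sum_sdiff hUS]
  exact add_pos_of_pos_of_nonneg hrest hUsum

theorem Nice.two_le_finrank (hΓ : Nice Γ) : 2 ≤ Module.finrank ℚ (Fix ℚ Γ) := by
  have : Fintype Γ := hΓ.finite.fintype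
  have h := hΓ.sum_pos
  rw [Finset.sum_subtype hΓ.finite.toFinset (p := fun k => k ∈ Γ)
      (fun k => by rw [Set.Finite.mem_toFinset]; rfl) (fun k => tr k - 1),
    Finset.sum_sub_distrib, sum_tr_subgroup, Finset.sum_const, Finset.card_univ, nsmul_eq_mul,
    ← mul_sub] at h
  have h2 := pos_of_mul_pos_right h (by positivity)
  omega

theorem bil_projection (z : V) : bil (z - bil z Kvec • Kvec) Kvec = 0 := by
  rw [bil_sub_left, bil_smul_left, bil_Kvec_Kvec]; ring

theorem Nice.exists_fixed (hΓ : Nice Γ) : ∃ w : V, w ≠ 0 ∧ bil w Kvec = 0 ∧ ∀ g ∈ Γ, g w = w := by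
  by_contra! hcon
  have hle : Fix ℚ Γ ≤ Submodule.span ℚ {cv ℚ Kvec} := by
    rw [Fix_rat_eq_span, Submodule.span_le]
    rintro _ ⟨z, hz, rfl⟩
    have h0 : z - bil z Kvec • Kvec = 0 := by
      by_contra hne
      obtain ⟨g, hg, hne'⟩ := hcon _ hne (bil_projection z)
      apply hne'
      rw [map_sub, map_smul, (hΓ.le_W hg).2, hz g hg]
    rw [sub_eq_zero.1 h0, cv_zsmul]
    exact Submodule.smul_mem _ _ (Submodule.mem_span_singleton_self _)
  have h1 := Submodule.finrank_mono hle
  have h2 := finrank_span_le_card (R := ℚ) ({cv ℚ Kvec} : Set (Fin 9 → ℚ))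
  rw [Set.toFinset_singleton, Finset.card_singleton] at h2
  have h3 := hΓ.two_le_finrank
  omega

theorem condH1_mono {G H : Subgroup LatAut} (hG : CondH1 G) (h : H ≤ G) : CondH1 H :=
  fun G' hG' => hG G' (hG'.trans h)

/-- The elements of determinant one. -/
def detOne : Subgroup LatAut := (LinearEquiv.det : LatAut →* ℤˣ).ker

theorem mul_mem_detOne {g h : LatAut} (hg : g ∉ detOne) (hh : h ∉ detOne) : g * h ∈ detOne := by
  rw [detOne, MonoidHom.mem_ker] at *
  rw [map_mul, (Int.units_eq_one_or _).resolve_left hg, (Int.units_eq_one_or _).resolve_left hh]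
  rfl

theorem nice_inf_detOne {G : Subgroup LatAut} (hGW : G ≤ W) (hH1 : CondH1 G) :
    Nice (G ⊓ detOne) where
  le_W := inf_le_left.trans hGW
  h1 := condH1_mono hH1 inf_le_left
  det_eq g hg := by
    have := congrArg Units.val (MonoidHom.mem_ker.1 hg.2)
    rwa [LinearEquiv.coe_det] at this

theorem exists_not_two_dvd {w : V} (hw : w ≠ 0) :
    ∃ (n : ℕ) (w' : V), w = (2 ^ n : ℤ) • w' ∧ ¬ ∃ u, w' = (2 : ℤ) • u := by
  obtain ⟨i, hi⟩ := Function.ne_iff.1 hw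
  induction hm : (w i).natAbs using Nat.strong_induction_on generalizing w with
  | _ m ih =>
    by_cases h : ∃ u, w = (2 : ℤ) • u
    · obtain ⟨u, rfl⟩ := h
      have hi' : u i ≠ 0 := fun h0 => hi (by simp [h0])
      obtain ⟨n, w', hw', hnd⟩ := ih (u i).natAbs
        (by simp only [Pi.smul_apply, smul_eq_mul] at hm; omega)
        (fun h0 => hi' (by simp [h0])) hi' rfl
      exact ⟨n + 1, w', by rw [hw', smul_smul, pow_succ'], hnd⟩
    · exact ⟨0, w, by simp, h⟩

/-- A group satisfying (H1) fixes a nonzero class orthogonal to the canonical class. -/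
theorem exists_fixed_of_condH1 {G : Subgroup LatAut} (hGW : G ≤ W) (hH1 : CondH1 G) :
    ∃ v : V, v ≠ 0 ∧ bil v Kvec = 0 ∧ ∀ g ∈ G, g v = v := by
  obtain ⟨w₀, hw₀, hw₀K, hw₀fix⟩ := (nice_inf_detOne hGW hH1).exists_fixed
  obtain ⟨n, w, hww, hnd⟩ := exists_not_two_dvd hw₀
  have hw : w ≠ 0 := fun h => hnd ⟨0, by simp [h]⟩
  have h2n : (2 ^ n : ℤ) ≠ 0 := by positivity
  have hwK : bil w Kvec = 0 := by
    rw [hww, bil_smul_left] at hw₀K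
    exact (mul_eq_zero.1 hw₀K).resolve_left h2n
  have hwfix : ∀ g ∈ G, g ∈ detOne → g w = w := by
    intro g hg hgd
    have := hw₀fix g ⟨hg, hgd⟩
    rw [hww, map_smul] at this
    exact smul_right_injective V h2n this
  by_cases hall : ∀ g ∈ G, g ∉ detOne → w + g w = 0
  · obtain ⟨z, hz, u, hu⟩ := exists_invariant_lift hH1 le_rfl (n := 2) (by norm_num) w (by
      intro g hg
      by_cases hgd : g ∈ detOne
      · exact ⟨0, by rw [hwfix g hg hgd]; simp⟩
      · refine ⟨-w, ?_⟩
        have := hall g hg hgd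
        rw [(eq_neg_of_add_eq_zero_right this)]
        module)
    refine ⟨z - bil z Kvec • Kvec, fun h0 => hnd ?_, bil_projection z, fun g hg => ?_⟩
    · have hz' := sub_eq_zero.1 h0
      have h1 : bil w Kvec = bil z Kvec + 2 * bil u Kvec := by
        rw [sub_eq_iff_eq_add.1 hu, bil_add_left, bil_smul_left, add_comm]
      refine ⟨u - bil u Kvec • Kvec, ?_⟩
      have h2 : bil z Kvec = -(2 * bil u Kvec) := by linarith
      rw [sub_eq_iff_eq_add.1 hu, hz', h2]
      module
    · rw [map_sub, map_smul, hz g hg, (hGW hg).2]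
  · push Not at hall
    obtain ⟨s, hs, hsd, hne⟩ := hall
    refine ⟨w + s w, hne, by rw [bil_add_left, bil_apply_Kvec (hGW hs), hwK, add_zero], ?_⟩
    intro g hg
    rw [map_add]
    by_cases hgd : g ∈ detOne
    · have h1 : g (s w) = s w := by
        have h2 : s⁻¹ * g * s ∈ detOne := by
          have := MonoidHom.normal_ker (LinearEquiv.det : LatAut →* ℤˣ)
          have h := this.conj_mem g hgd s⁻¹
          rwa [inv_inv] at h
        have h3 := hwfix _ (G.mul_mem (G.mul_mem (G.inv_mem hs) hg) hs) h2
        have h4 := congrArg s h3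
        rwa [← LinearEquiv.mul_apply, ← mul_assoc, ← mul_assoc, mul_inv_cancel, one_mul] at h4
      rw [hwfix g hg hgd, h1]
    · have h1 : g (s w) = w := hwfix _ (G.mul_mem hg hs) (mul_mem_detOne hgd hsd)
      have h2 : g w = s w := by
        have hsi : s⁻¹ ∉ detOne := fun h => hsd ((detOne.inv_mem_iff).1 h)
        have h3 := hwfix _ (G.mul_mem (G.inv_mem hs) hg) (mul_mem_detOne hsi hgd)
        have h4 := congrArg s h3
        rwa [← LinearEquiv.mul_apply, ← mul_assoc, mul_inv_cancel, one_mul] at h4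
      rw [h1, h2, add_comm]

end DP1

theorem dp1_minimal_H1_conic (G : Subgroup LatAut) (hGW : G ≤ W)
    (hmin : MinimalAction G) (hH1 : CondH1 G) :
    ∃ C, IsConic C ∧ ∀ g ∈ G, g C = C := by
  obtain ⟨v, hv, hvK, hfix⟩ := DP1.exists_fixed_of_condH1 hGW hH1
  exact DP1.exists_conic_of_fixed G hGW hmin v hv hvK hfix

end
end

section
/- No cyclic minimal subgroup of the Weyl group of a degree 1 del Pezzo surface satisfies condition (H1). Precisely: if G ≤ W is cyclic and minimal, then there exists a subgroup G' ≤ G with H¹(G', Λ) ≠ 0. -/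
open scoped BigOperators

noncomputable section

lemma bil_eq (x y : V) : bil x y = x 0 * y 0 - (x 1 * y 1 + x 2 * y 2 + x 3 * y 3 + x 4 * y 4
    + x 5 * y 5 + x 6 * y 6 + x 7 * y 7 + x 8 * y 8) := by
  have h : Finset.Ioi (0 : Fin 9) = {1, 2, 3, 4, 5, 6, 7, 8} := by decide
  rw [bil, h]
  simp [add_assoc]

lemma bil_comm (x y : V) : bil x y = bil y x := by
  rw [bil_eq, bil_eq]; ring

lemma bil_add_left (x y z : V) : bil (x + y) z = bil x z + bil y z := by
  simp only [bil_eq, Pi.add_apply]; ring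

lemma bil_sub_left (x y z : V) : bil (x - y) z = bil x z - bil y z := by
  simp only [bil_eq, Pi.sub_apply]; ring

lemma bil_smul_left (c : ℤ) (x z : V) : bil (c • x) z = c * bil x z := by
  simp only [bil_eq, Pi.smul_apply, smul_eq_mul]; ring

lemma bil_add_right (x y z : V) : bil x (y + z) = bil x y + bil x z := by
  simp only [bil_eq, Pi.add_apply]; ring

lemma bil_sub_right (x y z : V) : bil x (y - z) = bil x y - bil x z := by
  simp only [bil_eq, Pi.sub_apply]; ring

lemma bil_smul_right (c : ℤ) (x z : V) : bil x (c • z) = c * bil x z := by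
  simp only [bil_eq, Pi.smul_apply, smul_eq_mul]; ring

lemma bil_zero_left (x : V) : bil 0 x = 0 := by
  simp [bil_eq]

lemma bil_sum_left {ι : Type*} (s : Finset ι) (f : ι → V) (y : V) :
    bil (∑ i ∈ s, f i) y = ∑ i ∈ s, bil (f i) y := by
  classical
  induction s using Finset.induction_on with
  | empty => simp [bil_zero_left]
  | insert a s ha ih => rw [Finset.sum_insert ha, Finset.sum_insert ha, bil_add_left, ih]

lemma bil_sum_right {ι : Type*} (s : Finset ι) (f : ι → V) (y : V) :
    bil y (∑ i ∈ s, f i) = ∑ i ∈ s, bil y (f i) := by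
  simp only [bil_comm y, bil_sum_left]

lemma bil_Kvec_Kvec : bil Kvec Kvec = 1 := by
  simp [bil_eq, Kvec]

lemma bil_Kvec (x : V) : bil x Kvec
    = -3 * x 0 - (x 1 + x 2 + x 3 + x 4 + x 5 + x 6 + x 7 + x 8) := by
  simp [bil_eq, Kvec]; ring

lemma bil_map {g : LatAut} (hg : g ∈ W) (x y : V) : bil (g x) (g y) = bil x y := hg.1 x y

lemma map_Kvec {g : LatAut} (hg : g ∈ W) : g Kvec = Kvec := hg.2

lemma bil_map_Kvec {g : LatAut} (hg : g ∈ W) (x : V) : bil (g x) Kvec = bil x Kvec := by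
  conv_lhs => rw [← map_Kvec hg]
  exact bil_map hg x Kvec

/-- The form `2⟨x, K⟩² - ⟨x, x⟩` is positive definite, with an explicit bound on coordinates. -/
lemma sq_coord_le (x : V) (i : Fin 9) :
    (x i) ^ 2 ≤ 18 * (2 * bil x Kvec ^ 2 - bil x x) := by
  obtain ⟨S, hS⟩ : ∃ S, S = ∑ j : Fin 8, x j.succ := ⟨_, rfl⟩
  obtain ⟨T, hT⟩ : ∃ T, T = ∑ j : Fin 8, x j.succ ^ 2 := ⟨_, rfl⟩
  have hST : S ^ 2 ≤ 8 * T := by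
    rw [hS, hT]
    simpa using sq_sum_le_card_mul_sum_sq (s := Finset.univ) (f := fun j : Fin 8 => x j.succ)
  have hxK : bil x Kvec = -3 * x 0 - S := by
    rw [hS, bil_Kvec, Fin.sum_univ_eight]; rfl
  have hxx : bil x x = x 0 ^ 2 - T := by
    rw [hT, bil_eq, Fin.sum_univ_eight]; simp only [sq]; rfl
  rw [hxK, hxx]
  have hq : x 0 ^ 2 ≤ 17 * (2 * (-3 * x 0 - S) ^ 2 - (x 0 ^ 2 - T)) := by
    nlinarith [sq_nonneg (17 * S + 48 * x 0)]
  have hTq : T ≤ 18 * (2 * (-3 * x 0 - S) ^ 2 - (x 0 ^ 2 - T)) := by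
    nlinarith [sq_nonneg (-3 * x 0 - S)]
  induction i using Fin.cases with
  | zero => nlinarith [sq_nonneg (x 0)]
  | succ j =>
    refine le_trans ?_ hTq
    rw [hT]
    exact Finset.single_le_sum (f := fun j : Fin 8 => x j.succ ^ 2) (fun _ _ => sq_nonneg _)
      (Finset.mem_univ j)

lemma bil_self_neg {x : V} (hx : bil x Kvec = 0) (h : x ≠ 0) : bil x x < 0 := by
  by_contra! hn
  apply h
  funext i
  have := sq_coord_le x i
  rw [hx] at this
  have h0 : (x i) ^ 2 ≤ 0 := by nlinarith
  exact pow_eq_zero_iff two_ne_zero |>.1 (le_antisymm h0 (sq_nonneg _))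

lemma bil_self_nonpos {x : V} (hx : bil x Kvec = 0) : bil x x ≤ 0 := by
  by_cases h : x = 0
  · simp [h, bil_zero_left]
  · exact (bil_self_neg hx h).le

/-- The Cauchy–Schwarz inequality on the orthogonal complement of `K`. -/
lemma bil_sq_le {x y : V} (hx : bil x Kvec = 0) (hy : bil y Kvec = 0) :
    bil x y ^ 2 ≤ bil x x * bil y y := by
  by_cases h : y = 0
  · simp [h, bil_comm x, bil_zero_left]
  have hn := bil_self_neg hy h
  have h1 : bil (bil y y • x - bil x y • y) Kvec = 0 := by
    rw [bil_sub_left, bil_smul_left, bil_smul_left, hx, hy]; ring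
  have h2 := bil_self_nonpos h1
  simp only [bil_sub_left, bil_smul_left, bil_sub_right, bil_smul_right, bil_comm y x] at h2
  nlinarith

lemma bil_nonneg_of_ne {E F : V} (hE : E ∈ Exc) (hF : F ∈ Exc) (h : E ≠ F) : 0 ≤ bil E F := by
  have h1 : bil (E - F) Kvec = 0 := by rw [bil_sub_left, hE.2, hF.2]; rfl
  have h2 := bil_self_neg h1 (sub_ne_zero.2 h)
  simp only [bil_sub_left, bil_sub_right, bil_comm F E, hE.1, hF.1] at h2
  linarith

lemma map_mem_Exc {g : LatAut} (hg : g ∈ W) {E : V} (hE : E ∈ Exc) : g E ∈ Exc :=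
  ⟨by rw [bil_map hg, hE.1], by rw [bil_map_Kvec hg, hE.2]⟩

/-- Elements of `W` have finite order. -/
lemma exists_pow_eq_one {g : LatAut} (hg : g ∈ W) : ∃ n, 0 < n ∧ g ^ n = 1 := by
  have hfin : ∀ x : V, {y : V | ∃ k : ℕ, (g ^ k) x = y}.Finite := by
    intro x
    set B := 18 * (2 * bil x Kvec ^ 2 - bil x x) with hB
    refine (Set.finite_Icc (fun _ => -B : V) (fun _ => B)).subset ?_
    rintro y ⟨k, rfl⟩
    have hk := W.pow_mem hg k
    have h : ∀ i, ((g ^ k) x i) ^ 2 ≤ B := fun i => by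
      have := sq_coord_le ((g ^ k) x) i
      rwa [bil_map hk, bil_map_Kvec hk] at this
    refine ⟨fun i => ?_, fun i => ?_⟩ <;> have := h i <;> dsimp only <;> nlinarith
  let F : ℕ → Fin 9 → V := fun k i => (g ^ k) (Pi.single i 1)
  have hF : (Set.range F).Finite := by
    refine (Set.Finite.pi' fun i => hfin (Pi.single i 1)).subset ?_
    rintro _ ⟨k, rfl⟩ i
    exact ⟨k, rfl⟩
  have hni : ¬ Function.Injective F := fun hi => Set.infinite_range_of_injective hi hF
  obtain ⟨k, l, hkl, hne⟩ : ∃ k l, F k = F l ∧ k ≠ l := by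
    simpa [Function.Injective] using hni
  wlog hlt : k < l generalizing k l
  · exact this l k hkl.symm hne.symm (by omega)
  refine ⟨l - k, by omega, ?_⟩
  have h : g ^ k = g ^ l := by
    apply LinearEquiv.toLinearMap_injective
    refine (Pi.basisFun ℤ (Fin 9)).ext fun i => ?_
    simpa [F] using congrFun hkl i
  rw [pow_sub g hlt.le, ← h, mul_inv_cancel]

/-! ### Detecting nontrivial cohomology -/

/-- A cohomological obstruction for `a`: a vector of norm zero not of the form `a y - y`. -/
def HasObstruction (a : LatAut) : Prop :=
  ∃ n : ℕ, 0 < n ∧ a ^ n = 1 ∧ ∃ x : V, ∑ k ∈ Finset.range n, (a ^ k) x = 0 ∧ ∀ y, a y - y ≠ x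

lemma pow_succ_apply (a : LatAut) (k : ℕ) (x : V) : (a ^ (k + 1)) x = a ((a ^ k) x) := by
  rw [pow_succ']; rfl

lemma pow_succ_apply' (a : LatAut) (k : ℕ) (x : V) : (a ^ (k + 1)) x = (a ^ k) (a x) := by
  rw [pow_succ]; rfl

lemma map_sum_pow {a : LatAut} {n : ℕ} {x : V} (h : (a ^ n) x = x) :
    a (∑ k ∈ Finset.range n, (a ^ k) x) = ∑ k ∈ Finset.range n, (a ^ k) x := by
  have h1 := Finset.sum_range_succ (fun k => (a ^ k) x) n
  rw [Finset.sum_range_succ'] at h1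
  simp only [h, pow_zero, LinearEquiv.coe_one, id_eq, add_left_inj, pow_succ_apply] at h1
  rw [map_sum, h1]

lemma sub_weighted_sum (a : LatAut) (n : ℕ) (x : V) :
    a (∑ k ∈ Finset.range n, (k : ℤ) • (a ^ k) x) - ∑ k ∈ Finset.range n, (k : ℤ) • (a ^ k) x
      = (n : ℤ) • (a ^ n) x - a (∑ k ∈ Finset.range n, (a ^ k) x) := by
  induction n with
  | zero => simp
  | succ n ih =>
    simp only [Finset.sum_range_succ, map_add, map_smul, ← pow_succ_apply] at ih ⊢
    push_cast
    rw [add_smul, one_smul]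
    linear_combination (exp := 1) ih

theorem HasObstruction.nontrivial_H1 {a : LatAut} (h : HasObstruction a) :
    Nontrivial (groupCohomology.H1 (Rep.of (rep (Subgroup.zpowers a)))) := by
  obtain ⟨n, hn, han, x, hx, hxa⟩ := h
  have hn' : (n : ℤ) ≠ 0 := by exact_mod_cast hn.ne'
  set z := ∑ k ∈ Finset.range n, (k : ℤ) • (a ^ k) x with hz
  have haz : a z - z = (n : ℤ) • x := by
    rw [hz, sub_weighted_sum, hx, han]; simp
  have hdiv : ∀ b : Subgroup.zpowers a, ∃ y : V, (n : ℤ) • y = (b : LatAut) z - z := by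
    rintro ⟨_, m, rfl⟩
    change ∃ y : V, (n : ℤ) • y = (a ^ m) z - z
    refine zpow_induction_right (P := fun b : LatAut => ∃ y : V, (n : ℤ) • y = b z - z)
      ⟨0, by simp⟩ ?_ ?_ m
    · rintro b ⟨y, hy⟩
      refine ⟨y + b x, ?_⟩
      rw [smul_add, hy, ← map_smul, ← haz, map_sub]
      simp
    · rintro b ⟨y, hy⟩
      refine ⟨y - b (a⁻¹ x), ?_⟩
      have : a⁻¹ (a z) = z := a.symm_apply_apply z
      rw [smul_sub, hy, ← map_smul, ← map_smul, ← haz, map_sub, map_sub, this]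
      simp
  choose f hf using hdiv
  have hcoc : f ∈ groupCohomology.cocycles₁ (Rep.of (rep (Subgroup.zpowers a))) := by
    rw [groupCohomology.mem_cocycles₁_iff]
    intro b c
    apply smul_right_injective V hn'
    change (n : ℤ) • f (b * c) = (n : ℤ) • ((b : LatAut) (f c) + f b)
    rw [smul_add, ← map_smul, hf, hf, hf, map_sub]
    simp
  by_contra hnt
  rw [not_nontrivial_iff_subsingleton] at hnt
  have h0 := (groupCohomology.H1π_eq_zero_iff
    (⟨f, hcoc⟩ : groupCohomology.cocycles₁ (Rep.of (rep (Subgroup.zpowers a))))).1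
    (Subsingleton.elim _ _)
  obtain ⟨y, hy⟩ := h0
  apply hxa y
  have h1 : a y - y = f ⟨a, Subgroup.mem_zpowers a⟩ :=
    congrFun hy ⟨a, Subgroup.mem_zpowers a⟩
  rw [h1]
  apply smul_right_injective V hn'
  change (n : ℤ) • f _ = (n : ℤ) • x
  rw [hf, ← haz]

lemma HasObstruction.of_conj {h a : LatAut} (ho : HasObstruction (h * a * h⁻¹)) :
    HasObstruction a := by
  obtain ⟨n, hn, han, x, hx, hxa⟩ := ho
  have hh : ∀ y, h (h⁻¹ y) = y := h.apply_symm_apply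
  refine ⟨n, hn, ?_, h⁻¹ x, ?_, fun y hy => hxa (h y) ?_⟩
  · rwa [conj_pow, conj_eq_one_iff] at han
  · apply h.injective
    rw [map_sum, map_zero, ← hx]
    refine Finset.sum_congr rfl fun k _ => ?_
    rw [conj_pow]; rfl
  · have : h⁻¹ (h y) = y := h.symm_apply_apply y
    simp only [LinearEquiv.mul_apply, this]
    rw [← map_sub, hy, hh]

/-! ### Automorphisms without invariant vectors -/

lemma pow_apply_sub (a : LatAut) (n : ℕ) (y : V) :
    (a ^ n) y - y = ∑ k ∈ Finset.range n, (a ^ k) (a y - y) := by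
  induction n with
  | zero => simp
  | succ n ih =>
    rw [Finset.sum_range_succ, ← ih, map_sub, pow_succ_apply']
    abel

/-- If `a - 1` maps a set of `a ^ p`-fixed vectors onto itself, those vectors are divisible by
the prime `p`. -/
lemma exists_eq_smul_of_surjOn {a : LatAut} {p : ℕ} (hp : p.Prime) {M : Set V}
    (hM : ∀ x ∈ M, (a ^ p) x = x) (hsurj : ∀ x ∈ M, ∃ y ∈ M, a y - y = x) {x : V} (hx : x ∈ M) :
    ∃ y : V, x = (p : ℤ) • y := by
  let D : Module.End ℤ V := (a : V →ₗ[ℤ] V) - 1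
  have hD : ∀ k : ℕ, ∀ x ∈ M, ∃ y ∈ M, (D ^ k) y = x := by
    intro k
    induction k with
    | zero => exact fun x hx => ⟨x, hx, by simp⟩
    | succ k ih =>
      intro x hx
      obtain ⟨y, hy, rfl⟩ := ih x hx
      obtain ⟨w, hw, rfl⟩ := hsurj y hy
      exact ⟨w, hw, by rw [pow_succ]; rfl⟩
  obtain ⟨y, hy, rfl⟩ := hD p x hx
  obtain ⟨r, hr⟩ := (Commute.one_right D).exists_add_pow_prime_eq hp
  have hpow : ∀ k : ℕ, ∀ w : V, ((D + 1) ^ k) w = (a ^ k) w := by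
    intro k
    induction k with
    | zero => intro w; simp
    | succ k ih =>
      intro w
      rw [pow_succ_apply', ← ih, pow_succ]
      simp [D]
  have h := hpow p y
  rw [hr, hM y hy] at h
  refine ⟨-(D * r) y, ?_⟩
  have h' : (D ^ p) y + y + (p : ℤ) • (D * r) y = y := by
    conv_rhs => rw [← h]
    simp [mul_assoc]
  rw [smul_neg]
  linear_combination (exp := 1) h'

lemma eq_zero_of_forall_exists_smul {p : ℕ} (hp : p.Prime) {M : Set V}
    (hM : ∀ x ∈ M, ∃ y ∈ M, x = (p : ℤ) • y) {x : V} (hx : x ∈ M) : x = 0 := by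
  have h : ∀ k : ℕ, ∀ x ∈ M, ∃ y ∈ M, x = ((p : ℤ) ^ k) • y := by
    intro k
    induction k with
    | zero => exact fun x hx => ⟨x, hx, by simp⟩
    | succ k ih =>
      intro x hx
      obtain ⟨y, hy, rfl⟩ := ih x hx
      obtain ⟨w, hw, rfl⟩ := hM y hy
      exact ⟨w, hw, by rw [smul_smul, pow_succ]⟩
  funext i
  obtain ⟨y, -, hy⟩ := h (x i).natAbs x hx
  refine Int.eq_zero_of_abs_lt_dvd (m := (p : ℤ) ^ (x i).natAbs) ⟨y i, ?_⟩ ?_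
  · conv_lhs => rw [hy]
    rfl
  · rw [Int.abs_eq_natAbs]
    exact_mod_cast Nat.lt_pow_self hp.one_lt

/-- If `g` fixes no nonzero vector orthogonal to `K`, some power of `g` has an obstruction. -/
theorem exists_obstruction_of_no_invariants {g : LatAut} (hg : g ∈ W)
    (hinv : ∀ x : V, bil x Kvec = 0 → g x = x → x = 0) : ∃ j : ℕ, HasObstruction (g ^ j) := by
  classical
  obtain ⟨n, hn, hgn⟩ := exists_pow_eq_one hg
  let P : ℕ → Prop := fun m => 0 < m ∧ ∃ x : V, bil x Kvec = 0 ∧ (g ^ m) x = x ∧ x ≠ 0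
  have hP : ∃ m, P m := by
    refine ⟨n, hn, ![0, 1, -1, 0, 0, 0, 0, 0, 0], ?_, by rw [hgn]; rfl, ?_⟩
    · rw [bil_Kvec]; rfl
    · intro h
      have := congrFun h 1
      simp at this
  obtain ⟨hm, x₀, hx₀K, hx₀, hx₀'⟩ := Nat.find_spec hP
  have hmin := fun k (hk : k < Nat.find hP) => Nat.find_min hP hk
  generalize Nat.find hP = m at *
  have hm1 : m ≠ 1 := by
    rintro rfl
    exact hx₀' (hinv x₀ hx₀K (by simpa using hx₀))
  have hp := Nat.minFac_prime hm1
  obtain ⟨l, hl⟩ := Nat.minFac_dvd m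
  generalize m.minFac = p at *
  have hl0 : 0 < l := Nat.pos_of_ne_zero (by rintro rfl; omega)
  have hlm : l < m := by rw [hl]; exact lt_mul_of_one_lt_left hl0 hp.one_lt
  refine ⟨l, ?_⟩
  have haW : g ^ l ∈ W := W.pow_mem hg l
  have hap : (g ^ l) ^ p = g ^ m := by rw [← pow_mul, mul_comm, hl]
  have hainv : ∀ x, bil x Kvec = 0 → (g ^ l) x = x → x = 0 := by
    intro x hx hgx
    by_contra hne
    exact hmin l hlm ⟨hl0, x, hx, hgx, hne⟩
  have han : (g ^ l) ^ n = 1 := by rw [← pow_mul, mul_comm, pow_mul, hgn, one_pow]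
  generalize g ^ l = a at *
  have hsum : ∀ q x, bil x Kvec = 0 → (a ^ q) x = x → ∑ k ∈ Finset.range q, (a ^ k) x = 0 := by
    intro q x hx hqx
    refine hainv _ ?_ (map_sum_pow hqx)
    rw [bil_sum_left]
    exact Finset.sum_eq_zero fun k _ => by rw [bil_map_Kvec (W.pow_mem haW k), hx]
  by_contra hobs
  have hsurj : ∀ x, bil x Kvec = 0 → ∃ y, a y - y = x := by
    intro x hx
    by_contra! h
    exact hobs ⟨n, hn, han, x, hsum n x hx (by rw [han]; rfl), h⟩
  let M : Set V := {x | bil x Kvec = 0 ∧ (a ^ p) x = x}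
  have hMs : ∀ x ∈ M, ∃ y ∈ M, a y - y = x := by
    rintro x ⟨hx, hpx⟩
    obtain ⟨y, hy⟩ := hsurj x hx
    have hy' : a (y - bil y Kvec • Kvec) - (y - bil y Kvec • Kvec) = x := by
      rw [map_sub, map_smul, map_Kvec haW, ← hy]; abel
    refine ⟨y - bil y Kvec • Kvec, ⟨?_, ?_⟩, hy'⟩
    · rw [bil_sub_left, bil_smul_left, bil_Kvec_Kvec]; ring
    · rw [← sub_eq_zero, pow_apply_sub, hy', hsum p x hx hpx]
  have hp0 : (p : ℤ) ≠ 0 := by exact_mod_cast hp.ne_zero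
  refine hx₀' (eq_zero_of_forall_exists_smul hp (M := M) ?_ ⟨hx₀K, by rw [hap]; exact hx₀⟩)
  rintro x hx
  obtain ⟨y, rfl⟩ := exists_eq_smul_of_surjOn hp (M := M) (fun x hx => hx.2) hMs hx
  obtain ⟨h1, h2⟩ := hx
  refine ⟨y, ⟨?_, ?_⟩, rfl⟩
  · rw [bil_smul_left] at h1
    exact (mul_eq_zero.1 h1).resolve_left hp0
  · rw [map_smul] at h2
    exact smul_right_injective V hp0 h2

/-! ### Minimal elements -/

/-- Minimality of the cyclic group generated by `g`. -/
def IsMinimalElt (g : LatAut) : Prop :=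
  ∀ E ∈ Exc, ∃ k : ℕ, (g ^ k) E ≠ E ∧ bil ((g ^ k) E) E ≠ 0

lemma IsMinimalElt.conj {g h : LatAut} (hh : h ∈ W) (hm : IsMinimalElt g) :
    IsMinimalElt (h * g * h⁻¹) := by
  intro E hE
  obtain ⟨k, hk1, hk2⟩ := hm (h⁻¹ E) (map_mem_Exc (W.inv_mem hh) hE)
  have hhE : h (h⁻¹ E) = E := h.apply_symm_apply E
  have key : ((h * g * h⁻¹) ^ k) E = h ((g ^ k) (h⁻¹ E)) := by rw [conj_pow]; rfl
  refine ⟨k, fun he => hk1 (h.injective ?_), ?_⟩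
  · rw [← key, he, hhE]
  · rw [key]
    nth_rewrite 2 [← hhE]
    rwa [bil_map hh]

/-- For a minimal `g`, an exceptional class has bounded product with an invariant vector. -/
theorem IsMinimalElt.bil_sq_le {g : LatAut} (hg : g ∈ W) (hm : IsMinimalElt g) {v : V}
    (hvK : bil v Kvec = 0) (hv : g v = v) {E : V} (hE : E ∈ Exc) :
    bil E v ^ 2 ≤ - bil v v := by
  obtain ⟨n, hn, hgn⟩ := exists_pow_eq_one hg
  have hiter : ∀ k : ℕ, ∀ x, (g ^ k) x = g^[k] x := fun k => by
    induction k with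
    | zero => intro x; rfl
    | succ k ih => intro x; rw [pow_succ_apply', ih, Function.iterate_succ_apply]
  have hper : E ∈ Function.periodicPts g := ⟨n, hn, by
    change g^[n] E = E
    rw [← hiter, hgn]; rfl⟩
  obtain ⟨m, hmdef⟩ : ∃ m, m = Function.minimalPeriod g E := ⟨_, rfl⟩
  have hm0 : 0 < m := hmdef ▸ Function.minimalPeriod_pos_of_mem_periodicPts hper
  have hmE : (g ^ m) E = E := by rw [hiter, hmdef]; exact Function.iterate_minimalPeriod
  have hlt : ∀ k, 0 < k → k < m → (g ^ k) E ≠ E := by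
    intro k hk hkm h
    rw [hiter] at h
    exact Function.not_isPeriodicPt_of_pos_of_lt_minimalPeriod hk.ne' (hmdef ▸ hkm) h
  obtain ⟨k₀, hk0, hk1⟩ : ∃ k < m, (g ^ k) E ≠ E ∧ bil ((g ^ k) E) E ≠ 0 := by
    obtain ⟨k, hk⟩ := hm E hE
    refine ⟨k % m, Nat.mod_lt _ hm0, ?_⟩
    have : (g ^ (k % m)) E = (g ^ k) E := by
      rw [hiter, hiter, hmdef, Function.iterate_mod_minimalPeriod_eq]
    rwa [this]
  have hEk : ∀ k, (g ^ k) E ∈ Exc := fun k => map_mem_Exc (W.pow_mem hg k) hE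
  set r := E + Kvec with hr
  have hgr : ∀ k, (g ^ k) r = (g ^ k) E + Kvec := fun k => by
    rw [hr, map_add, map_Kvec (W.pow_mem hg k)]
  set s := ∑ k ∈ Finset.range m, (g ^ k) r with hs
  have hrK : bil r Kvec = 0 := by rw [hr, bil_add_left, hE.2, bil_Kvec_Kvec]; rfl
  have hgs : ∀ k : ℕ, (g ^ k) s = s := fun k => by
    induction k with
    | zero => rfl
    | succ k ih => rw [pow_succ_apply', map_sum_pow (by rw [hgr, hmE]), ih]
  have hgv : ∀ k : ℕ, (g ^ k) v = v := fun k => by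
    induction k with
    | zero => rfl
    | succ k ih => rw [pow_succ_apply', hv, ih]
  have hsK : bil s Kvec = 0 := by
    rw [hs, bil_sum_left]
    exact Finset.sum_eq_zero fun k _ => by rw [bil_map_Kvec (W.pow_mem hg k), hrK]
  have hsv : bil s v = m * bil E v := by
    have : ∀ k ∈ Finset.range m, bil ((g ^ k) r) v = bil E v := fun k _ => by
      conv_lhs => rw [← hgv k]
      rw [bil_map (W.pow_mem hg k), hr, bil_add_left, bil_comm Kvec, hvK, add_zero]
    rw [hs, bil_sum_left, Finset.sum_congr rfl this]
    simp
  have hss : bil s s = m * bil s r := by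
    have : ∀ k ∈ Finset.range m, bil s ((g ^ k) r) = bil s r := fun k _ => by
      conv_lhs => rw [← hgs k]
      rw [bil_map (W.pow_mem hg k)]
    nth_rewrite 2 [hs]
    rw [bil_sum_right, Finset.sum_congr rfl this]
    simp
  have hsr : -(m : ℤ) ≤ bil s r := by
    have hterm : ∀ k, bil ((g ^ k) r) r = bil ((g ^ k) E) E - 1 := fun k => by
      rw [hgr, hr, bil_add_left, bil_add_right, bil_add_right, (hEk k).2, bil_Kvec_Kvec,
        bil_comm Kvec, hE.2]
      ring
    have hk00 : k₀ ≠ 0 := by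
      rintro rfl
      exact hk1.1 rfl
    have hle : ∀ k ∈ Finset.range m,
        (-1 + (if k = 0 then -1 else 0) + (if k = k₀ then 1 else 0) : ℤ) ≤ bil ((g ^ k) r) r := by
      intro k hk
      rw [hterm]
      by_cases hk' : k = 0
      · subst hk'
        have : bil ((g ^ 0) E) E = -1 := hE.1
        rw [this, if_pos rfl, if_neg hk00.symm]
        norm_num
      · have hne := hlt k (Nat.pos_of_ne_zero hk') (Finset.mem_range.1 hk)
        have h0 := bil_nonneg_of_ne (hEk k) hE hne
        rw [if_neg hk']
        split_ifs with h
        · subst h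
          have := hk1.2
          omega
        · omega
    have hsum := Finset.sum_le_sum hle
    rw [← bil_sum_left, ← hs] at hsum
    simp only [Finset.sum_add_distrib, Finset.sum_ite_eq', Finset.mem_range, hm0, hk0, if_true,
      Finset.sum_const, Finset.card_range, nsmul_eq_mul] at hsum
    linarith
  have hcs := _root_.bil_sq_le hsK hvK
  rw [hsv, hss] at hcs
  have hvv := bil_self_nonpos hvK
  have hmpos : (0 : ℤ) < m := by exact_mod_cast hm0
  have h1 : (m : ℤ) ^ 2 * bil E v ^ 2 ≤ (m : ℤ) ^ 2 * (- bil v v) := by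
    have := mul_nonneg (mul_nonneg hmpos.le (by linarith : 0 ≤ bil s r + m)) (neg_nonneg.2 hvv)
    nlinarith
  exact le_of_mul_le_mul_left h1 (by positivity)

/-! ### Reduction to the fundamental chamber -/

/-- The reflection in a root. -/
def rootReflection (α : V) (hα : bil α α = -2) : LatAut :=
  LinearEquiv.ofInvolutive
    { toFun := fun x => x + bil x α • α
      map_add' := fun x y => by rw [bil_add_left, add_smul]; abel
      map_smul' := fun c x => by
        rw [bil_smul_left, RingHom.id_apply, smul_add, smul_smul] }
    (fun x => by
      change (x + bil x α • α) + bil (x + bil x α • α) α • α = x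
      rw [bil_add_left, bil_smul_left, hα, add_assoc, ← add_smul]
      ring_nf)

lemma rootReflection_apply (α : V) (hα : bil α α = -2) (x : V) :
    rootReflection α hα x = x + bil x α • α := rfl

lemma rootReflection_mem (α : V) (hα : bil α α = -2) (hK : bil α Kvec = 0) :
    rootReflection α hα ∈ W := by
  refine ⟨fun x y => ?_, ?_⟩
  · simp only [rootReflection_apply, bil_add_left, bil_add_right, bil_smul_left, bil_smul_right, hα,
      bil_comm α]
    ring
  · rw [rootReflection_apply, bil_comm, hK, zero_smul, add_zero]

/-- Every vector can be moved into the closed chamber determined by `ρ`. -/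
lemma exists_mem_chamber (v ρ : V) : ∃ h ∈ W, ∀ α : V, bil α α = -2 → bil α Kvec = 0 →
    bil α ρ < 0 → 0 ≤ bil (h v) α := by
  obtain ⟨b, hb⟩ : ∃ b : ℤ, ∀ h ∈ W, bil (h v) ρ ≤ b := by
    set B := 18 * (2 * bil v Kvec ^ 2 - bil v v) with hB
    refine ⟨B * (∑ i, |ρ i|), fun h hh => ?_⟩
    have hcoord : ∀ i, |h v i| ≤ B := fun i => by
      have h1 := sq_coord_le (h v) i
      rw [bil_map hh, bil_map_Kvec hh, ← hB] at h1
      rw [abs_le]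
      constructor <;> nlinarith
    have hle : ∀ i, |h v i * ρ i| ≤ B * |ρ i| := fun i => by
      rw [abs_mul]
      exact mul_le_mul_of_nonneg_right (hcoord i) (abs_nonneg _)
    rw [Finset.mul_sum, Fin.sum_univ_succ, bil]
    have h0 := (le_abs_self _).trans (hle 0)
    have hs : -∑ i ∈ Finset.Ioi (0 : Fin 9), h v i * ρ i ≤ ∑ i : Fin 8, B * |ρ i.succ| := by
      have : Finset.Ioi (0 : Fin 9) = Finset.univ.map (Fin.succEmb 8) := by decide
      rw [this, Finset.sum_map, ← Finset.sum_neg_distrib]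
      exact Finset.sum_le_sum fun i _ => (neg_le_abs _).trans (hle i.succ)
    linarith
  obtain ⟨_, ⟨h, hh, rfl⟩, hmax⟩ := Int.exists_greatest_of_bdd
    (P := fun z => ∃ h ∈ W, bil (h v) ρ = z) ⟨b, by rintro z ⟨h, hh, rfl⟩; exact hb h hh⟩
    ⟨_, 1, W.one_mem, rfl⟩
  refine ⟨h, hh, fun α hα hK hρ => ?_⟩
  have := hmax _ ⟨rootReflection α hα * h, W.mul_mem (rootReflection_mem α hα hK) hh, rfl⟩
  rw [LinearEquiv.mul_apply, rootReflection_apply, bil_add_left, bil_smul_left] at this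
  nlinarith

/-- The class of the conics through the first blown-up point. -/
def conic : V := ![1, -1, 0, 0, 0, 0, 0, 0, 0]

/-- A vector of the closed fundamental chamber which is short relative to its product with the
last exceptional curve is proportional to `C + 2K`, with `C` a conic class. -/
lemma eq_smul_conic_of_mem_chamber {u : V} (hK : bil u Kvec = 0)
    (h0 : 0 ≤ u 0 + u 1 + u 2 + u 3) (h1 : u 1 ≤ u 2) (h2 : u 2 ≤ u 3) (h3 : u 3 ≤ u 4)
    (h4 : u 4 ≤ u 5) (h5 : u 5 ≤ u 6) (h6 : u 6 ≤ u 7) (h7 : u 7 ≤ u 8)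
    (hu : u 8 ^ 2 ≤ - bil u u) : u = u 1 • (conic + (2 : ℤ) • Kvec) := by
  rw [bil_Kvec] at hK
  rw [bil_eq] at hu
  obtain ⟨c0, hc0⟩ : ∃ c, c = u 0 + u 1 + u 2 + u 3 := ⟨_, rfl⟩
  obtain ⟨c1, hc1⟩ : ∃ c, c = u 2 - u 1 := ⟨_, rfl⟩
  obtain ⟨c2, hc2⟩ : ∃ c, c = u 3 - u 2 := ⟨_, rfl⟩
  obtain ⟨c3, hc3⟩ : ∃ c, c = u 4 - u 3 := ⟨_, rfl⟩
  obtain ⟨c4, hc4⟩ : ∃ c, c = u 5 - u 4 := ⟨_, rfl⟩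
  obtain ⟨c5, hc5⟩ : ∃ c, c = u 6 - u 5 := ⟨_, rfl⟩
  obtain ⟨c6, hc6⟩ : ∃ c, c = u 7 - u 6 := ⟨_, rfl⟩
  obtain ⟨c7, hc7⟩ : ∃ c, c = u 8 - u 7 := ⟨_, rfl⟩
  have p0 : 0 ≤ c0 := by omega
  have p1 : 0 ≤ c1 := by omega
  have p2 : 0 ≤ c2 := by omega
  have p3 : 0 ≤ c3 := by omega
  have p4 : 0 ≤ c4 := by omega
  have p5 : 0 ≤ c5 := by omega
  have p6 : 0 ≤ c6 := by omega
  have p7 : 0 ≤ c7 := by omega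
  have e1 : u 1 = 3 * c0 + c1 + 3 * c2 + 5 * c3 + 4 * c4 + 3 * c5 + 2 * c6 + c7 := by linarith
  have e2 : u 2 = u 1 + c1 := by linarith
  have e3 : u 3 = u 2 + c2 := by linarith
  have e4 : u 4 = u 3 + c3 := by linarith
  have e5 : u 5 = u 4 + c4 := by linarith
  have e6 : u 6 = u 5 + c5 := by linarith
  have e7 : u 7 = u 6 + c6 := by linarith
  have e8 : u 8 = u 7 + c7 := by linarith
  have e0 : u 0 = c0 - u 1 - u 2 - u 3 := by linarith
  rw [e0, e8, e7, e6, e5, e4, e3, e2, e1] at hu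
  have hR : 0 ≤ 2 * (c0 * c1) + 4 * (c0 * c2) + 6 * (c0 * c3) + 6 * (c0 * c4) + 6 * (c0 * c5)
      + 6 * (c0 * c6) + 6 * (c0 * c7) + 2 * (c1 * c2) + 4 * (c1 * c3) + 4 * (c1 * c4)
      + 4 * (c1 * c5) + 4 * (c1 * c6) + 4 * (c1 * c7) + 8 * (c2 * c3) + 8 * (c2 * c4)
      + 8 * (c2 * c5) + 8 * (c2 * c6) + 8 * (c2 * c7) + 12 * (c3 * c4) + 12 * (c3 * c5)
      + 12 * (c3 * c6) + 12 * (c3 * c7) + 10 * (c4 * c5) + 10 * (c4 * c6) + 10 * (c4 * c7)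
      + 8 * (c5 * c6) + 8 * (c5 * c7) + 6 * (c6 * c7) := by positivity
  have hD : c0 ^ 2 + 2 * c2 ^ 2 + 6 * c3 ^ 2 + 5 * c4 ^ 2 + 4 * c5 ^ 2 + 3 * c6 ^ 2
      + 2 * c7 ^ 2 ≤ 0 := by linarith
  have hsq : ∀ c : ℤ, c ^ 2 ≤ 0 → c = 0 := fun c hc =>
    pow_eq_zero_iff two_ne_zero |>.1 (le_antisymm hc (sq_nonneg c))
  have q0 := sq_nonneg c0
  have q2 := sq_nonneg c2
  have q3 := sq_nonneg c3
  have q4 := sq_nonneg c4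
  have q5 := sq_nonneg c5
  have q6 := sq_nonneg c6
  have q7 := sq_nonneg c7
  have z0 : c0 = 0 := hsq _ (by linarith)
  have z2 : c2 = 0 := hsq _ (by linarith)
  have z3 : c3 = 0 := hsq _ (by linarith)
  have z4 : c4 = 0 := hsq _ (by linarith)
  have z5 : c5 = 0 := hsq _ (by linarith)
  have z6 : c6 = 0 := hsq _ (by linarith)
  have z7 : c7 = 0 := hsq _ (by linarith)
  have hw : conic + (2 : ℤ) • Kvec = ![-5, 1, 2, 2, 2, 2, 2, 2, 2] := by decide
  clear hu hR hD
  rw [hw]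
  funext i
  fin_cases i
  · change u 0 = u 1 * (-5); omega
  · change u 1 = u 1 * 1; omega
  · change u 2 = u 1 * 2; omega
  · change u 3 = u 1 * 2; omega
  · change u 4 = u 1 * 2; omega
  · change u 5 = u 1 * 2; omega
  · change u 6 = u 1 * 2; omega
  · change u 7 = u 1 * 2; omega
  · change u 8 = u 1 * 2; omega

/-! ### Elements preserving a conic class -/

lemma bil_conic (x : V) : bil x conic = x 0 + x 1 := by
  rw [bil_eq]
  simp [conic]

/-- The chosen component of the `j`-th degenerate fibre of the conic bundle given by `conic`. -/
def fibre (j : Fin 7) : V := Pi.single j.succ.succ 1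

lemma bil_fibre (x : V) (j : Fin 7) : bil x (fibre j) = - x j.succ.succ := by
  rw [bil, fibre, Finset.sum_eq_single j.succ.succ]
  · simp
  · intro i _ hi
    simp [hi]
  · intro h
    simp at h

lemma fibre_mem_Exc (j : Fin 7) : fibre j ∈ Exc := by
  constructor
  · rw [bil_fibre]
    simp [fibre]
  · rw [bil_comm, bil_fibre]
    fin_cases j <;> rfl

lemma bil_fibre_fibre (i j : Fin 7) : bil (fibre i) (fibre j) = if i = j then -1 else 0 := by
  rw [bil_fibre, fibre]
  by_cases h : i = j
  · simp [h]
  · simp [h, Ne.symm h]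

lemma bil_conic_fibre (j : Fin 7) : bil conic (fibre j) = 0 := by
  rw [bil_fibre]
  fin_cases j <;> rfl

lemma bil_fibre_conic (j : Fin 7) : bil (fibre j) conic = 0 := by
  rw [bil_comm, bil_conic_fibre]

/-- `E` is one of the two components of the `j`-th degenerate fibre. -/
def IsComponent (j : Fin 7) (E : V) : Prop := E = fibre j ∨ E = conic - fibre j

lemma IsComponent.bil_fibre_ne_zero_iff {i : Fin 7} {E : V} (h : IsComponent i E) (j : Fin 7) :
    bil E (fibre j) ≠ 0 ↔ i = j := by
  rcases h with rfl | rfl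
  · simp [bil_fibre_fibre]
  · simp [bil_sub_left, bil_fibre_fibre, bil_conic_fibre]

lemma IsComponent.unique {i j : Fin 7} {E : V} (h : IsComponent i E) (h' : IsComponent j E) :
    i = j :=
  (h.bil_fibre_ne_zero_iff j).1 ((h'.bil_fibre_ne_zero_iff j).2 rfl)

lemma IsComponent.conic_sub {i : Fin 7} {E : V} (h : IsComponent i E) :
    IsComponent i (conic - E) := by
  rcases h with rfl | rfl
  · exact Or.inr rfl
  · exact Or.inl (sub_sub_cancel _ _)

lemma fibre_ne_conic_sub (j : Fin 7) : fibre j ≠ conic - fibre j := by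
  intro h
  have := congrArg (fun x => bil x (fibre j)) h
  simp [bil_sub_left, bil_fibre_fibre, bil_conic_fibre] at this

/-- Exceptional classes orthogonal to a conic class are components of its degenerate fibres. -/
lemma exists_isComponent {E : V} (hE : E ∈ Exc) (hC : bil E conic = 0) :
    ∃ j, IsComponent j E := by
  obtain ⟨h1, h2⟩ := hE
  rw [bil_conic] at hC
  rw [bil_eq] at h1
  rw [bil_Kvec] at h2
  have hsq : ∑ j : Fin 7, E j.succ.succ ^ 2 = 1 := by
    simp only [Fin.sum_univ_seven]
    change E 2 ^ 2 + E 3 ^ 2 + E 4 ^ 2 + E 5 ^ 2 + E 6 ^ 2 + E 7 ^ 2 + E 8 ^ 2 = 1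
    have : E 1 = - E 0 := by linarith
    rw [this] at h1
    linarith
  have hsum : 2 * E 0 + ∑ j : Fin 7, E j.succ.succ = 1 := by
    simp only [Fin.sum_univ_seven]
    change 2 * E 0 + (E 2 + E 3 + E 4 + E 5 + E 6 + E 7 + E 8) = 1
    linarith
  obtain ⟨j, hj⟩ : ∃ j : Fin 7, E j.succ.succ ≠ 0 := by
    by_contra! h
    simp [h] at hsq
  have hj1 : 1 ≤ E j.succ.succ ^ 2 := by
    have := sq_pos_of_ne_zero hj
    omega
  have hother : ∀ i, i ≠ j → E i.succ.succ = 0 := by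
    intro i hi
    rw [← Finset.add_sum_erase _ _ (Finset.mem_univ j)] at hsq
    have := Finset.single_le_sum (f := fun i : Fin 7 => E i.succ.succ ^ 2)
      (fun i _ => sq_nonneg _) (Finset.mem_erase.2 ⟨hi, Finset.mem_univ i⟩)
    have h0 := sq_nonneg (E i.succ.succ)
    exact pow_eq_zero_iff two_ne_zero |>.1 (by linarith)
  rw [Finset.sum_eq_single j (fun i _ hi => by rw [hother i hi]; rfl) (by simp)] at hsq
  rw [Finset.sum_eq_single j (fun i _ hi => hother i hi) (by simp)] at hsum
  have hf1 : fibre j 1 = 0 := by fin_cases j <;> rfl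
  refine ⟨j, ?_⟩
  rcases sq_eq_one_iff.1 hsq with h | h
  · left
    funext i
    refine Fin.cases (by simp [fibre]; omega) (fun i => Fin.cases ?_ (fun i => ?_) i) i
    · change E 1 = fibre j 1
      omega
    · by_cases hij : i = j
      · simp [fibre, hij, h]
      · simp [fibre, hij, hother i hij]
  · right
    funext i
    refine Fin.cases (by simp [fibre, conic]; omega) (fun i => Fin.cases ?_ (fun i => ?_) i) i
    · change E 1 = -1 - fibre j 1
      omega
    · have hc : conic i.succ.succ = 0 := by fin_cases i <;> rfl
      by_cases hij : i = j
      · rw [hij] at hc ⊢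
        simp [fibre, h, hc]
      · simp [fibre, hij, hother i hij, hc]

lemma IsComponent.eq_or {i : Fin 7} {E F : V} (h : IsComponent i E) (h' : IsComponent i F) :
    E = F ∨ E = conic - F := by
  rcases h with rfl | rfl <;> rcases h' with rfl | rfl <;> simp

/-- A permutation of seven points of 2-power order has at least three cycles. -/
lemma exists_three_cycles {σ : Equiv.Perm (Fin 7)} {K : ℕ} (hσ : σ ^ 2 ^ K = 1) :
    ∃ i j k, ¬ σ.SameCycle i j ∧ ¬ σ.SameCycle i k ∧ ¬ σ.SameCycle j k := by
  classical
  have hp : IsPGroup 2 (Subgroup.zpowers σ) := by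
    rintro ⟨_, k, rfl⟩
    refine ⟨K, Subtype.ext ?_⟩
    change (σ ^ k) ^ 2 ^ K = 1
    rw [← zpow_natCast, ← zpow_mul, mul_comm, zpow_mul, zpow_natCast, hσ, one_zpow]
  have : Fact (Nat.Prime 2) := ⟨Nat.prime_two⟩
  let O : Fin 7 → Finset (Fin 7) := fun i => Finset.univ.filter (σ.SameCycle i)
  have hO : ∀ i, ∃ n, (O i).card = 2 ^ n := by
    intro i
    obtain ⟨n, hn⟩ := hp.card_orbit i
    refine ⟨n, ?_⟩
    rw [← hn, ← Set.ncard_coe_finset, ← Nat.card_coe_set_eq]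
    congr 2
    ext j
    simp [O, MulAction.mem_orbit_iff, Equiv.Perm.SameCycle, Subgroup.smul_def]
  have hmem : ∀ i j, j ∈ O i ↔ σ.SameCycle i j := fun i j => by simp [O]
  obtain ⟨a, ha⟩ := hO 0
  have hlt : ∀ n m, m ≤ 7 → m = 2 ^ n → n < 3 := fun n m h1 h2 => by
    by_contra! h
    have := Nat.pow_le_pow_right (show 0 < 2 by norm_num) h
    omega
  have hcard : ∀ s : Finset (Fin 7), s.card ≠ 7 → ∃ j, j ∉ s := fun s hs => by
    by_contra! h
    exact hs (by rw [Finset.eq_univ_iff_forall.2 h]; rfl)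
  have ha3 := hlt a _ (card_finset_fin_le _) ha
  obtain ⟨j, hj⟩ := hcard (O 0) (by rw [ha]; interval_cases a <;> norm_num)
  obtain ⟨b, hb⟩ := hO j
  have hb3 := hlt b _ (card_finset_fin_le _) hb
  rw [hmem] at hj
  have hdisj : Disjoint (O 0) (O j) := by
    rw [Finset.disjoint_left]
    intro k hk hk'
    rw [hmem] at hk hk'
    exact hj (hk.trans hk'.symm)
  obtain ⟨k, hk⟩ := hcard (O 0 ∪ O j) (by
    rw [Finset.card_union_of_disjoint hdisj, ha, hb]
    interval_cases a <;> interval_cases b <;> norm_num)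
  rw [Finset.mem_union, hmem, hmem, not_or] at hk
  exact ⟨0, j, k, hj, hk.1, hk.2⟩

lemma pow_conic {b : LatAut} (hC : b conic = conic) (k : ℕ) : (b ^ k) conic = conic := by
  induction k with
  | zero => rfl
  | succ k ih => rw [pow_succ_apply, ih, hC]

/-- An element preserving a conic class permutes the degenerate fibres. -/
lemma exists_perm_isComponent {b : LatAut} (hb : b ∈ W) (hC : b conic = conic) :
    ∃ σ : Equiv.Perm (Fin 7), ∀ (k : ℕ) (j : Fin 7),
      IsComponent ((σ ^ k) j) ((b ^ k) (fibre j)) := by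
  have h : ∀ j, ∃ i, IsComponent i (b (fibre j)) := fun j => by
    refine exists_isComponent (map_mem_Exc hb (fibre_mem_Exc j)) ?_
    rw [← hC, bil_map hb, bil_fibre_conic]
  choose s hs using h
  have hinj : Function.Injective s := by
    intro i j hij
    have hi := hs i
    rw [hij] at hi
    have hb' : IsComponent j (fibre i) := by
      rcases hi.eq_or (hs j) with h | h
      · exact Or.inl (b.injective h)
      · exact Or.inr (b.injective (by rw [h, map_sub, hC]))
    exact IsComponent.unique (Or.inl rfl) hb'
  refine ⟨Equiv.ofBijective s (Finite.injective_iff_bijective.1 hinj), fun k j => ?_⟩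
  induction k with
  | zero => exact Or.inl rfl
  | succ k ih =>
    rw [pow_succ_apply, pow_succ', Equiv.Perm.mul_apply, Equiv.ofBijective_apply]
    rcases ih with h | h
    · rw [h]
      exact hs _
    · rw [h, map_sub, hC]
      exact (hs _).conic_sub

lemma two_smul_sum_pow {b : LatAut} (hC : b conic = conic) {N t : ℕ} (hN : b ^ N = 1) {e : V}
    (ht : (b ^ t) e = conic - e) :
    (2 : ℤ) • ∑ k ∈ Finset.range N, (b ^ k) e = (N : ℤ) • conic := by
  set T := ∑ k ∈ Finset.range N, (b ^ k) e with hT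
  have h1 : b T = T := map_sum_pow (by rw [hN]; rfl)
  have h2 : (b ^ t) T = T := by
    clear ht
    induction t with
    | zero => rfl
    | succ t ih => rw [pow_succ_apply, ih, h1]
  have h3 : (b ^ t) T = (N : ℤ) • conic - T := by
    have : ∀ k, (b ^ t) ((b ^ k) e) = conic - (b ^ k) e := fun k => by
      rw [← LinearEquiv.mul_apply, ← pow_add, add_comm, pow_add, LinearEquiv.mul_apply, ht,
        map_sub, pow_conic hC]
    rw [hT, map_sum, Finset.sum_congr rfl fun k _ => this k, Finset.sum_sub_distrib]
    simp
  rw [two_smul]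
  nth_rewrite 1 [← h2]
  rw [h3]
  abel

/-- The sum of products with half an orbit is, on coboundaries, determined modulo 2 by the product
with the conic class. -/
lemma sum_bil_sub {b : LatAut} (hb : b ∈ W) (hC : b conic = conic) {m : ℕ} {e : V}
    (hm : (b ^ m) e = conic - e) (y : V) :
    ∑ k ∈ Finset.range m, bil (b y - y) ((b ^ k) e) = 2 * bil (b y) e - bil y conic := by
  have h : ∀ k, bil (b y - y) ((b ^ k) e)
      = bil (b y) ((b ^ k) e) - bil (b y) ((b ^ (k + 1)) e) := fun k => by
    rw [bil_sub_left, pow_succ_apply, bil_map hb]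
  rw [Finset.sum_congr rfl fun k _ => h k, Finset.sum_range_sub', hm, bil_sub_right]
  have : bil (b y) conic = bil y conic := by
    conv_lhs => rw [← hC]
    exact bil_map hb _ _
  rw [this]
  simp
  ring

/-- An element of 2-power order preserving a conic class and exchanging the two components of every
degenerate fibre has an obstruction. -/
theorem hasObstruction_of_swap {b : LatAut} (hb : b ∈ W) (hC : b conic = conic) {K : ℕ}
    (hK : b ^ 2 ^ K = 1) (hswap : ∀ j, ∃ t : ℕ, (b ^ t) (fibre j) = conic - fibre j) :
    HasObstruction b := by
  classical
  obtain ⟨σ, hσ⟩ := exists_perm_isComponent hb hC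
  have hσK : σ ^ 2 ^ K = 1 := Equiv.ext fun j => by
    have h := hσ (2 ^ K) j
    rw [hK] at h
    exact h.unique (Or.inl rfl)
  obtain ⟨i, j, l, hij, hil, hjl⟩ := exists_three_cycles hσK
  have horth : ∀ {p q : Fin 7}, ¬ σ.SameCycle q p → ∀ k : ℕ,
      bil (fibre p) ((b ^ k) (fibre q)) = 0 := fun {p q} hpq k => by
    by_contra h
    rw [bil_comm] at h
    exact hpq ⟨k, by rw [zpow_natCast]; exact ((hσ k q).bil_fibre_ne_zero_iff p).1 h⟩
  refine ⟨2 ^ K, by positivity, hK, fibre i - fibre j, ?_, fun y hy => ?_⟩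
  · obtain ⟨t, ht⟩ := hswap i
    obtain ⟨t', ht'⟩ := hswap j
    have h := (two_smul_sum_pow hC hK ht).trans (two_smul_sum_pow hC hK ht').symm
    simp only [map_sub, Finset.sum_sub_distrib]
    exact sub_eq_zero.2 (smul_right_injective V two_ne_zero h)
  · obtain ⟨m, hm⟩ := hswap l
    have hl := sum_bil_sub hb hC hm y
    rw [hy, Finset.sum_eq_zero fun k _ => by
      rw [bil_sub_left, horth (fun h => hil h.symm), horth (fun h => hjl h.symm), sub_zero]] at hl
    set n := Nat.find (hswap i) with hn
    have hni : (b ^ n) (fibre i) = conic - fibre i := Nat.find_spec (hswap i)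
    have hi := sum_bil_sub hb hC hni y
    have hn0 : 0 < n := Nat.pos_of_ne_zero fun h => fibre_ne_conic_sub i (by rwa [h] at hni)
    rw [hy, Finset.sum_eq_single_of_mem 0 (Finset.mem_range.2 hn0)] at hi
    · rw [bil_sub_left, horth hij] at hi
      simp [bil_fibre_fibre] at hi
      omega
    · intro k hk hk0
      rw [Finset.mem_range] at hk
      rw [bil_sub_left, horth hij, sub_zero]
      by_contra h
      rw [bil_comm] at h
      have hki := hσ k i
      rw [(hki.bil_fibre_ne_zero_iff i).1 h] at hki
      rcases hki with h | h
      · refine Nat.find_min (hswap i) (m := n - k) (by omega) ?_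
        rw [← hni, ← Nat.sub_add_cancel hk.le, pow_add, LinearEquiv.mul_apply, h,
          Nat.add_sub_cancel]
      · exact Nat.find_min (hswap i) hk h

/-- A minimal element preserving a conic class has a power with an obstruction. -/
theorem IsMinimalElt.exists_obstruction_of_conic {g : LatAut} (hg : g ∈ W) (hm : IsMinimalElt g)
    (hC : g conic = conic) : ∃ j : ℕ, HasObstruction (g ^ j) := by
  obtain ⟨n, hn, hgn⟩ := exists_pow_eq_one hg
  obtain ⟨K, q, hq, rfl⟩ := Nat.exists_eq_two_pow_mul_odd hn.ne'
  have hswap : ∀ j, ∃ t : ℕ, (g ^ t) (fibre j) = conic - fibre j := fun j => by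
    obtain ⟨t, h1, h2⟩ := hm _ (fibre_mem_Exc j)
    obtain ⟨σ, hσ⟩ := exists_perm_isComponent hg hC
    have h := hσ t j
    rw [(h.bil_fibre_ne_zero_iff j).1 h2] at h
    exact ⟨t, h.resolve_left h1⟩
  refine ⟨q, hasObstruction_of_swap (W.pow_mem hg q) (pow_conic hC q) (K := K) ?_ fun j => ?_⟩
  · rw [← pow_mul, mul_comm, hgn]
  · obtain ⟨t, ht⟩ := hswap j
    obtain ⟨r, rfl⟩ := hq
    refine ⟨t, ?_⟩
    rw [← pow_mul, mul_comm, pow_mul]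
    have h2 : ((g ^ t) ^ 2) (fibre j) = fibre j := by
      rw [pow_two, LinearEquiv.mul_apply, ht, map_sub, pow_conic hC, ht, sub_sub_cancel]
    have h3 : ∀ r : ℕ, (((g ^ t) ^ 2) ^ r) (fibre j) = fibre j := fun r => by
      induction r with
      | zero => rfl
      | succ r ih => rw [pow_succ_apply, ih, h2]
    rw [pow_succ_apply, pow_mul, h3, ht]

theorem IsMinimalElt.exists_obstruction {g : LatAut} (hg : g ∈ W) (hm : IsMinimalElt g) :
    ∃ j : ℕ, HasObstruction (g ^ j) := by
  by_cases hinv : ∀ x : V, bil x Kvec = 0 → g x = x → x = 0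
  · exact exists_obstruction_of_no_invariants hg hinv
  push Not at hinv
  obtain ⟨v, hvK, hgv, hv⟩ := hinv
  obtain ⟨h, hh, hch⟩ := exists_mem_chamber v ![-19, 7, 6, 5, 4, 3, 2, 1, 0]
  set u := h v with hu
  have hg' : h * g * h⁻¹ ∈ W := W.mul_mem (W.mul_mem hh hg) (W.inv_mem hh)
  have hm' := hm.conj hh
  have huK : bil u Kvec = 0 := by rw [hu, bil_map_Kvec hh, hvK]
  have hgu : (h * g * h⁻¹) u = u := by
    change h (g (h.symm (h v))) = h v
    rw [h.symm_apply_apply, hgv]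
  have hu0 : u ≠ 0 := fun h0 => hv (h.injective (by rw [map_zero]; exact h0))
  have key : u = u 1 • (conic + (2 : ℤ) • Kvec) := by
    have hroot : ∀ α : V, bil α α = -2 → bil α Kvec = 0 →
        bil α ![-19, 7, 6, 5, 4, 3, 2, 1, 0] < 0 → 0 ≤ bil u α := hch
    have c0 := hroot ![1, -1, -1, -1, 0, 0, 0, 0, 0] (by decide) (by decide) (by decide)
    have c1 := hroot ![0, 1, -1, 0, 0, 0, 0, 0, 0] (by decide) (by decide) (by decide)
    have c2 := hroot ![0, 0, 1, -1, 0, 0, 0, 0, 0] (by decide) (by decide) (by decide)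
    have c3 := hroot ![0, 0, 0, 1, -1, 0, 0, 0, 0] (by decide) (by decide) (by decide)
    have c4 := hroot ![0, 0, 0, 0, 1, -1, 0, 0, 0] (by decide) (by decide) (by decide)
    have c5 := hroot ![0, 0, 0, 0, 0, 1, -1, 0, 0] (by decide) (by decide) (by decide)
    have c6 := hroot ![0, 0, 0, 0, 0, 0, 1, -1, 0] (by decide) (by decide) (by decide)
    have c7 := hroot ![0, 0, 0, 0, 0, 0, 0, 1, -1] (by decide) (by decide) (by decide)
    have h8 := hm'.bil_sq_le hg' huK hgu (fibre_mem_Exc 6)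
    rw [bil_comm, bil_fibre, neg_sq] at h8
    simp [bil_eq] at c0 c1 c2 c3 c4 c5 c6 c7
    exact eq_smul_conic_of_mem_chamber huK (by linarith) (by linarith) (by linarith) (by linarith)
      (by linarith) (by linarith) (by linarith) (by linarith) h8
  have hu1 : u 1 ≠ 0 := fun h1 => hu0 (by rw [key, h1, zero_smul])
  have hC : (h * g * h⁻¹) conic = conic := by
    rw [key, map_smul] at hgu
    have := smul_right_injective V hu1 hgu
    rw [map_add, map_smul, map_Kvec hg'] at this
    exact add_right_cancel this
  obtain ⟨j, hj⟩ := hm'.exists_obstruction_of_conic hg' hC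
  rw [conj_pow] at hj
  exact ⟨j, hj.of_conj⟩

lemma isMinimalElt_of_minimalAction {G : Subgroup LatAut} (hGW : G ≤ W) (hmin : MinimalAction G)
    {g : LatAut} (hg : g ∈ W) (hgen : ∀ x ∈ G, x ∈ Subgroup.zpowers g) : IsMinimalElt g := by
  intro E hE
  have h := hmin E hE
  push Not at h
  obtain ⟨_, ⟨a, ha, rfl⟩, _, ⟨c, hc, rfl⟩, hne, hbil⟩ := h
  obtain ⟨n, hn, hgn⟩ := exists_pow_eq_one hg
  have hfin : IsOfFinOrder g := isOfFinOrder_iff_pow_eq_one.2 ⟨n, hn, hgn⟩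
  obtain ⟨k, hk⟩ := hfin.mem_powers_iff_mem_zpowers.2 (hgen _ (G.mul_mem (G.inv_mem hc) ha))
  have hcE : c ((c⁻¹ * a) E) = a E := c.apply_symm_apply _
  refine ⟨k, fun he => hne ?_, fun h0 => hbil ?_⟩
  · rw [← hcE, ← hk]
    exact congrArg c he
  · rw [← hcE, bil_map (hGW hc), ← hk]
    exact h0

theorem dp1_cyclic_minimal_H1 (G : Subgroup LatAut) (hGW : G ≤ W)
    (hcyc : IsCyclic G) (hmin : MinimalAction G) :
    ∃ G' : Subgroup LatAut, G' ≤ G ∧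
      Nontrivial (groupCohomology.H1 (Rep.of (rep G'))) := by
  obtain ⟨⟨g, hgG⟩, hgen⟩ := hcyc
  have hgen' : ∀ x ∈ G, x ∈ Subgroup.zpowers g := fun x hx => by
    obtain ⟨k, hk⟩ := hgen ⟨x, hx⟩
    exact ⟨k, congrArg Subtype.val hk⟩
  obtain ⟨j, hj⟩ :=
    (isMinimalElt_of_minimalAction hGW hmin (hGW hgG) hgen').exists_obstruction (hGW hgG)
  exact ⟨Subgroup.zpowers (g ^ j), Subgroup.zpowers_le.2 (G.pow_mem hgG j), hj.nontrivial_H1⟩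

end
end
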